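/- arXiv:1503.08353 — 4 statements merged into one kernel-verified Lean document; each statement's English description precedes it below -/
import Mathlib

section
/- There exists a unique probability measure μ on [0, ∞) such that for every bounded continuous function f : [0, ∞) → ℝ, the averages (1/(q−2)) ∑_{χ mod q, χ ≠ χ₀} f(|L'/L(1, χ)|) converge to ∫₀^∞ f(t) dμ(t) as q tends to infinity through the odd primes. -/
open Filter MeasureTheory

/-- The average `(1/(q-2)) ∑_{χ mod q, χ ≠ χ₀} f(|L'/L(1, χ)|)` over the
non-principal Dirichlet characters modulo `q` (defined to be `0` for `q < 2`). -/
noncomputable def charAverage (q : ℕ) (f : ℝ → ℝ) : ℝ :=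
  if h : 2 ≤ q then by
    haveI : NeZero q := ⟨by omega⟩
    exact (∑ χ : DirichletCharacter ℂ q,
        if χ ≠ 1 then
          f ‖logDeriv (DirichletCharacter.LFunction χ) 1‖
        else 0) / ((q : ℝ) - 2)
  else 0


section part1

lemma abel_id (a : ℕ → ℂ) (c : ℕ → ℝ) (N K : ℕ) (hK : N ≤ K) :
    ∑ k ∈ Finset.Ico N K, (c k : ℂ) * a k =
      c K * (∑ j ∈ Finset.range K, a j) - c N * (∑ j ∈ Finset.range N, a j) +
      ∑ k ∈ Finset.Ico N K, ((c k : ℂ) - c (k+1)) * (∑ j ∈ Finset.range (k+1), a j) := by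
  induction K, hK using Nat.le_induction with
  | base => simp
  | succ K hK ih =>
    rw [Finset.sum_Ico_succ_top hK, Finset.sum_Ico_succ_top hK, ih, Finset.sum_range_succ]
    ring

lemma abel_tail (a : ℕ → ℂ) (B : ℝ) (hB : ∀ n, ‖∑ k ∈ Finset.range n, a k‖ ≤ B) (c : ℕ → ℝ)
    (N : ℕ) (hc : ∀ n ≥ N, c (n+1) ≤ c n) (h0 : ∀ n ≥ N, 0 ≤ c n) (K : ℕ) (hK : N ≤ K) :
    ‖∑ k ∈ Finset.Ico N K, (c k : ℂ) * a k‖ ≤ 2 * B * c N := by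
  have hB0 : 0 ≤ B := (norm_nonneg _).trans (hB 0)
  have h1 : ∀ n ≥ N, ∀ m, ‖(c n : ℂ) * ∑ j ∈ Finset.range m, a j‖ ≤ c n * B := by
    intro n hn m
    rw [norm_mul, Complex.norm_real, Real.norm_of_nonneg (h0 n hn)]
    exact mul_le_mul_of_nonneg_left (hB m) (h0 n hn)
  have h2 : ‖∑ k ∈ Finset.Ico N K, ((c k : ℂ) - c (k+1)) * (∑ j ∈ Finset.range (k+1), a j)‖
      ≤ ∑ k ∈ Finset.Ico N K, (c k - c (k+1)) * B := by
    refine norm_sum_le_of_le _ fun k hk => ?_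
    have := hc k (Finset.mem_Ico.1 hk).1
    rw [norm_mul, ← Complex.ofReal_sub, Complex.norm_real, Real.norm_of_nonneg (by linarith)]
    exact mul_le_mul_of_nonneg_left (hB _) (by linarith)
  have h3 : ∑ k ∈ Finset.Ico N K, (c k - c (k+1)) * B = (c N - c K) * B := by
    rw [← Finset.sum_mul]
    congr 1
    have := Finset.sum_Ico_sub c hK
    have h : ∑ k ∈ Finset.Ico N K, (c k - c (k+1)) = - ∑ k ∈ Finset.Ico N K, (c (k+1) - c k) := by
      rw [← Finset.sum_neg_distrib]; simp
    rw [h, this]; ring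
  rw [abel_id a c N K hK]
  calc _ ≤ c K * B + c N * B + (c N - c K) * B := by
        refine (norm_add_le _ _).trans (add_le_add ((norm_sub_le _ _).trans
          (add_le_add (h1 K hK K) (h1 N le_rfl N))) (h2.trans h3.le))
    _ = _ := by ring

lemma char_partial_sum {M : ℕ} [NeZero M] (ψ : DirichletCharacter ℂ M) (hψ : ψ ≠ 1) (n : ℕ) :
    ‖∑ k ∈ Finset.range n, ψ (k : ZMod M)‖ ≤ M := by
  have hM : 0 < M := Nat.pos_of_ne_zero (NeZero.ne M)
  have hz : ∑ k ∈ Finset.range M, ψ (k : ZMod M) = 0 := by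
    rw [← MulChar.sum_eq_zero_of_ne_one hψ]
    refine Finset.sum_nbij' (fun k => (k : ZMod M)) (fun a => a.val) ?_ ?_ ?_ ?_ ?_
    · simp
    · intro a _; simpa using ZMod.val_lt a
    · intro a ha; simpa using ZMod.val_cast_of_lt (Finset.mem_range.1 ha)
    · intro a _; simp
    · simp
  induction n using Nat.strong_induction_on with
  | _ n ih =>
    by_cases h : n < M
    · calc _ ≤ ∑ k ∈ Finset.range n, (1 : ℝ) :=
            norm_sum_le_of_le _ fun k _ => ψ.norm_le_one _
        _ = n := by simp
        _ ≤ M := by exact_mod_cast h.le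
    · push Not at h
      obtain ⟨m, rfl⟩ := Nat.exists_eq_add_of_le h
      rw [Finset.sum_range_add, hz, zero_add]
      have := ih m (by omega)
      simpa using this

lemma tail_lim {M : ℕ} [NeZero M] (ψ : DirichletCharacter ℂ M) (hψ : ψ ≠ 1)
    (G : ℂ → ℂ) (hG : ContinuousAt G 1) (f : ℕ → ℂ) (w : ℕ → ℝ) (hf : ∀ n, f n = w n * ψ n)
    (hsum : ∀ x : ℝ, 1 < x → LSeriesHasSum f x (G x)) (N : ℕ) (hN : 1 ≤ N)
    (hw : ∀ n ≥ N, w (n+1) / (n+1 : ℕ) ≤ w n / n) (hw0 : ∀ n ≥ N, 0 ≤ w n) :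
    ‖G 1 - ∑ n ∈ Finset.range N, f n / n‖ ≤ 2 * M * (w N / N) := by
  have key : ∀ x : ℝ, 1 < x → ‖G x - ∑ n ∈ Finset.range N, LSeries.term f x n‖ ≤ 2 * M * (w N / N) := by
    intro x hx
    have ht := (hsum x hx).tendsto_sum_nat
    refine le_of_tendsto ((ht.sub_const _).norm) ?_
    filter_upwards [eventually_ge_atTop N] with K hK
    rw [← Finset.sum_Ico_eq_sub _ hK]
    set c : ℕ → ℝ := fun n => w n / n * ((n : ℝ) ^ (-(x-1))) with hc
    have e : ∑ n ∈ Finset.Ico N K, LSeries.term f x n = ∑ n ∈ Finset.Ico N K, (c n : ℂ) * ψ n := by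
      refine Finset.sum_congr rfl fun n hn => ?_
      have hn0 : n ≠ 0 := by have := (Finset.mem_Ico.1 hn).1; omega
      have hn' : (0:ℝ) < n := by exact_mod_cast Nat.pos_of_ne_zero hn0
      have e1 : (c n : ℝ) = w n / (n : ℝ) ^ x := by
        rw [hc]; simp only
        rw [Real.rpow_neg hn'.le, Real.rpow_sub hn', Real.rpow_one]
        field_simp
      rw [LSeries.term_of_ne_zero hn0, hf, e1]
      push_cast
      rw [Complex.ofReal_cpow hn'.le]
      push_cast
      ring
    rw [e]
    have hp : ∀ n ≥ N, (1:ℝ) ≤ n := fun n hn => by exact_mod_cast hN.trans hn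
    refine (abel_tail _ M (char_partial_sum ψ hψ) c N ?_ ?_ K hK).trans ?_
    · intro n hn
      refine mul_le_mul (hw n hn) ?_ (by positivity) (div_nonneg (hw0 n hn) (by positivity))
      refine Real.rpow_le_rpow_of_nonpos (by linarith [hp n hn]) (by simp) (by linarith)
    · intro n hn
      exact mul_nonneg (div_nonneg (hw0 n hn) (by positivity)) (by positivity)
    · refine mul_le_mul_of_nonneg_left ?_ (by positivity)
      refine mul_le_of_le_one_right (div_nonneg (hw0 N le_rfl) (by positivity)) ?_
      exact Real.rpow_le_one_of_one_le_of_nonpos (hp N le_rfl) (by linarith)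
  have hcast : Tendsto (fun x : ℝ => (x : ℂ)) (nhdsWithin 1 (Set.Ioi 1)) (nhds 1) := by
    have : Tendsto (fun x : ℝ => (x : ℂ)) (nhds 1) (nhds 1) := by
      simpa using (Complex.continuous_ofReal.tendsto 1)
    exact this.mono_left nhdsWithin_le_nhds
  have hterm : ∀ n, Tendsto (fun x : ℝ => LSeries.term f x n) (nhdsWithin 1 (Set.Ioi 1))
      (nhds (f n / n)) := by
    intro n
    rcases eq_or_ne n 0 with rfl | hn
    · simp
    · simp_rw [LSeries.term_of_ne_zero hn]
      have hc : ContinuousAt (fun s : ℂ => (n : ℂ) ^ s) 1 :=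
        continuousAt_const_cpow (by exact_mod_cast hn)
      have h1 := (hc.tendsto.comp hcast)
      rw [Complex.cpow_one] at h1
      exact tendsto_const_nhds.div h1 (by exact_mod_cast hn)
  refine le_of_tendsto (((hG.tendsto.comp hcast).sub
    (tendsto_finsetSum _ fun n _ => hterm n)).norm) ?_
  filter_upwards [self_mem_nhdsWithin] with x hx
  exact key x hx

lemma L_tail {M : ℕ} [NeZero M] (ψ : DirichletCharacter ℂ M) (hψ : ψ ≠ 1) (N : ℕ) (hN : 1 ≤ N) :
    ‖DirichletCharacter.LFunction ψ 1 - ∑ n ∈ Finset.range N, ψ n / n‖ ≤ 2 * M * (1 / N) := by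
  refine tail_lim ψ hψ _ (DirichletCharacter.differentiable_LFunction hψ).continuous.continuousAt
    (fun n => ψ n) (fun _ => 1) (by simp) ?_ N hN ?_ (by simp)
  · intro x hx
    have hx' : 1 < (x:ℂ).re := by simpa using hx
    rw [DirichletCharacter.LFunction_eq_LSeries ψ hx']
    exact (DirichletCharacter.LSeriesSummable_of_one_lt_re ψ hx').LSeriesHasSum
  · intro n hn
    have : (0:ℝ) < n := by exact_mod_cast (by omega)
    push_cast
    exact one_div_le_one_div_of_le this (by linarith)

lemma Lderiv_tail {M : ℕ} [NeZero M] (ψ : DirichletCharacter ℂ M) (hψ : ψ ≠ 1) (N : ℕ) (hN : 3 ≤ N) :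
    ‖deriv (DirichletCharacter.LFunction ψ) 1 + ∑ n ∈ Finset.range N, (Real.log n) * ψ n / n‖
      ≤ 2 * M * (Real.log N / N) := by
  have := tail_lim ψ hψ (fun s => - deriv (DirichletCharacter.LFunction ψ) s)
    ((((DirichletCharacter.differentiable_LFunction hψ).contDiff (n := 1)).continuous_deriv
      le_rfl).neg.continuousAt)
    (fun n => Real.log n * ψ n) (fun n => Real.log n) (by simp) ?_ N (by omega) ?_ ?_
  · rw [← norm_neg]
    rw [neg_add, ← sub_eq_add_neg]
    exact this
  · intro x hx
    have hx' : 1 < (x:ℂ).re := by simpa using hx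
    have ha : LSeries.abscissaOfAbsConv (fun n => ψ n) < (x:ℂ).re := by
      rw [DirichletCharacter.absicssaOfAbsConv_eq_one (NeZero.ne M)]
      exact_mod_cast hx'
    rw [DirichletCharacter.deriv_LFunction_eq_deriv_LSeries ψ hx', LSeries_deriv ha, neg_neg]
    have e : (fun n : ℕ => (Real.log n : ℂ) * ψ n) = LSeries.logMul (fun n => ψ n) := by
      ext n; simp [LSeries.logMul, Complex.natCast_log]
    rw [e]
    exact (LSeriesSummable_logMul_of_lt_re ha).LSeriesHasSum
  · intro n hn
    have he : Real.exp 1 ≤ n := by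
      have h3 : (3:ℝ) ≤ n := by exact_mod_cast hN.trans hn
      linarith [Real.exp_one_lt_d9]
    exact Real.log_div_self_antitoneOn (by simpa using he) (by simp; linarith) (by simp)
  · intro n hn
    exact Real.log_natCast_nonneg n

end part1


section part2

/-- The Euler-factor part. -/
noncomputable def Fpart (P : ℕ) (u : ℕ → ℂ) : ℂ :=
  ∑ p ∈ P.primeFactors, Real.log p * u p / (p - u p)

lemma factor_ne (p : ℕ) (hp : p.Prime) (u : ℂ) (hu : ‖u‖ ≤ 1) : (p : ℂ) - u ≠ 0 := by
  intro h
  have h1 : (p : ℂ) = u := sub_eq_zero.1 h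
  have h2 : ‖(p:ℂ)‖ = p := by simp
  have h3 : (2:ℝ) ≤ p := by exact_mod_cast hp.two_le
  rw [h1] at h2
  linarith

lemma logDeriv_factor (p : ℕ) (hp : p.Prime) (u : ℂ) (hu : ‖u‖ ≤ 1) :
    (1 - u * (p:ℂ) ^ (-(1:ℂ)) ≠ 0) ∧ DifferentiableAt ℂ (fun s : ℂ => 1 - u * (p:ℂ) ^ (-s)) 1 ∧
    logDeriv (fun s : ℂ => 1 - u * (p:ℂ) ^ (-s)) 1 = Real.log p * u / (p - u) := by
  have hp0 : (p : ℂ) ≠ 0 := by exact_mod_cast hp.ne_zero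
  have hne := factor_ne p hp u hu
  have hd : HasDerivAt (fun s : ℂ => 1 - u * (p:ℂ) ^ (-s))
      (-(u * ((p:ℂ) ^ (-(1:ℂ)) * Complex.log p * (-1)))) 1 := by
    refine HasDerivAt.const_sub _ (HasDerivAt.const_mul _ ?_)
    exact (hasDerivAt_neg (1:ℂ)).const_cpow (Or.inl hp0)
  have h1 : 1 - u * (p:ℂ) ^ (-(1:ℂ)) = (p - u) / p := by
    rw [Complex.cpow_neg_one]; field_simp
  refine ⟨?_, hd.differentiableAt, ?_⟩
  · rw [h1]; exact div_ne_zero hne hp0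
  · rw [logDeriv_apply, hd.deriv, h1, Complex.cpow_neg_one, Complex.natCast_log]
    field_simp

lemma logDeriv_decomp {q : ℕ} [NeZero q] (hq : q.Prime) (P : ℕ) [NeZero P] (χ : DirichletCharacter ℂ q)
    (hχ : χ ≠ 1) :
    logDeriv (DirichletCharacter.LFunction
      (DirichletCharacter.changeLevel (Dvd.intro P rfl : q ∣ q * P) χ)) 1 =
    logDeriv (DirichletCharacter.LFunction χ) 1 + Fpart P (fun n => χ n) := by
  have e : DirichletCharacter.LFunction
      (DirichletCharacter.changeLevel (Dvd.intro P rfl : q ∣ q * P) χ) =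
      fun s => DirichletCharacter.LFunction χ s *
        ∏ p ∈ (q * P).primeFactors, (1 - χ p * (p:ℂ) ^ (-s)) := by
    ext s
    exact DirichletCharacter.LFunction_changeLevel _ χ (Or.inl hχ)
  have hf := fun p (hp : p ∈ (q * P).primeFactors) =>
    logDeriv_factor p (Nat.prime_of_mem_primeFactors hp) (χ p) (χ.norm_le_one _)
  rw [e, logDeriv_mul, logDeriv_prod]
  · congr 1
    rw [Finset.sum_congr rfl fun p hp => (hf p hp).2.2, Fpart]
    symm
    refine Finset.sum_subset (Nat.primeFactors_mono (Dvd.intro_left q rfl) (NeZero.ne _)) ?_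
    intro p hp hp'
    have hpp := Nat.prime_of_mem_primeFactors hp
    have : p = q := by
      have h1 := Nat.dvd_of_mem_primeFactors hp
      rcases (hpp.dvd_mul).1 h1 with h | h
      · exact (Nat.prime_dvd_prime_iff_eq hpp hq).1 h
      · exact absurd (Nat.mem_primeFactors.2 ⟨hpp, h, NeZero.ne _⟩) hp'
    subst this
    have : χ (p : ZMod p) = 0 := by
      rw [ZMod.natCast_self]; exact χ.map_zero' hpp.ne_one
    rw [this]; simp
  · exact fun p hp => (hf p hp).1
  · exact fun p hp => (hf p hp).2.1
  · exact χ.LFunction_apply_one_ne_zero hχ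
  · exact Finset.prod_ne_zero_iff.2 fun p hp => (hf p hp).1
  · exact (DirichletCharacter.differentiable_LFunction hχ).differentiableAt
  · exact DifferentiableAt.fun_finsetProd fun p hp => (hf p hp).2.1

lemma changeLevel_apply' {q : ℕ} [NeZero q] (P : ℕ) [NeZero P] (χ : DirichletCharacter ℂ q) (n : ℕ) :
    (DirichletCharacter.changeLevel (Dvd.intro P rfl : q ∣ q * P) χ) (n : ZMod (q*P)) =
      if n.Coprime P then χ n else 0 := by
  by_cases h : n.Coprime (q * P)
  · have h' : IsCoprime (n:ℤ) ((q * P : ℕ) : ℤ) := by exact_mod_cast Nat.isCoprime_iff_coprime.2 h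
    have := χ.changeLevel_eq_cast_of_dvd' (Dvd.intro P rfl : q ∣ q * P) h'
    rw [if_pos (Nat.Coprime.coprime_dvd_right (Dvd.intro_left q rfl) h)]
    simpa using this
  · have h0 : ¬ IsUnit (n : ZMod (q*P)) := by rwa [ZMod.isUnit_iff_coprime]
    rw [MulChar.map_nonunit _ h0]
    split_ifs with h1
    · have : ¬ n.Coprime q := fun h2 => h (Nat.Coprime.mul_right h2 h1)
      rw [MulChar.map_nonunit]
      rwa [ZMod.isUnit_iff_coprime]
    · rfl

end part2


section part3

lemma sum_range_zmod {q : ℕ} [NeZero q] (g : ZMod q → ℂ) :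
    ∑ k ∈ Finset.range q, g (k : ZMod q) = ∑ z : ZMod q, g z := by
  refine Finset.sum_nbij' (fun k => (k : ZMod q)) (fun a => a.val) ?_ ?_ ?_ ?_ ?_
  · simp
  · intro a _; simpa using ZMod.val_lt a
  · intro a ha; simpa using ZMod.val_cast_of_lt (Finset.mem_range.1 ha)
  · intro a _; simp
  · simp

lemma sum_range_zmodR {q : ℕ} [NeZero q] (g : ZMod q → ℝ) :
    ∑ k ∈ Finset.range q, g (k : ZMod q) = ∑ z : ZMod q, g z := by
  refine Finset.sum_nbij' (fun k => (k : ZMod q)) (fun a => a.val) ?_ ?_ ?_ ?_ ?_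
  · simp
  · intro a _; simpa using ZMod.val_lt a
  · intro a ha; simpa using ZMod.val_cast_of_lt (Finset.mem_range.1 ha)
  · intro a _; simp
  · simp

lemma parseval_le {q : ℕ} [Fact q.Prime] (b : ZMod q → ℂ) :
    ∑ χ : DirichletCharacter ℂ q, ‖∑ r : ZMod q, b r * χ r‖ ^ 2 ≤ q * ∑ r : ZMod q, ‖b r‖ ^ 2 := by
  have key : ∑ χ : DirichletCharacter ℂ q,
      ((∑ r : ZMod q, b r * χ r) * (starRingEnd ℂ) (∑ r : ZMod q, b r * χ r)) =
      ∑ r : ZMod q, if r = 0 then 0 else (q.totient : ℂ) * (b r * (starRingEnd ℂ) (b r)) := by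
    simp_rw [map_sum, Finset.sum_mul_sum]
    rw [Finset.sum_comm]
    simp_rw [Finset.sum_comm (s := (Finset.univ : Finset (DirichletCharacter ℂ q)))]
    refine Finset.sum_congr rfl fun r _ => ?_
    have h1 : ∀ s : ZMod q, ∑ χ : DirichletCharacter ℂ q, b r * χ r * (starRingEnd ℂ) (b s * χ s) =
        if r = s then (if r = 0 then 0 else (q.totient : ℂ) * (b r * (starRingEnd ℂ) (b r))) else 0 := by
      intro s
      have e : ∀ χ : DirichletCharacter ℂ q, b r * χ r * (starRingEnd ℂ) (b s * χ s) =
          b r * (starRingEnd ℂ) (b s) * (χ s⁻¹ * χ r) := by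
        intro χ
        have : (starRingEnd ℂ) (χ s) = χ s⁻¹ := by
          rw [← MulChar.inv_apply', ← MulChar.star_apply']; rfl
        rw [map_mul, this]; ring
      simp_rw [e, ← Finset.mul_sum]
      by_cases hs : s = 0
      · subst hs
        have : ∀ χ : DirichletCharacter ℂ q, χ (0 : ZMod q)⁻¹ * χ r = 0 := by
          intro χ
          rw [inv_zero, χ.map_zero' (Fact.out : q.Prime).ne_one, zero_mul]
        simp_rw [this]
        split_ifs <;> simp_all
      · rw [DirichletCharacter.sum_char_inv_mul_char_eq ℂ (Ne.isUnit hs)]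
        by_cases hrs : r = s
        · subst hrs; simp [hs]; ring
        · simp [hrs, Ne.symm hrs]
    simp_rw [h1]
    simp
  have key2 : ∑ χ : DirichletCharacter ℂ q, ‖∑ r : ZMod q, b r * χ r‖ ^ 2 =
      ∑ r : ZMod q, if r = 0 then 0 else (q.totient : ℝ) * ‖b r‖ ^ 2 := by
    have hc : ∀ z : ℂ, z * (starRingEnd ℂ) z = ((‖z‖ ^ 2 : ℝ) : ℂ) := by
      intro z; rw [Complex.mul_conj']; push_cast; rfl
    simp_rw [hc] at key
    have := congrArg Complex.re key
    rw [← Complex.ofReal_sum, Complex.ofReal_re] at this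
    rw [this, Complex.re_sum]
    refine Finset.sum_congr rfl fun r _ => ?_
    split_ifs
    · simp
    · rw [← Complex.ofReal_natCast, ← Complex.ofReal_mul, Complex.ofReal_re]
  rw [key2, Finset.mul_sum]
  refine Finset.sum_le_sum fun r _ => ?_
  split_ifs
  · positivity
  · gcongr
    exact_mod_cast Nat.totient_le q

lemma sum_range_mul' (q m : ℕ) (g : ℕ → ℂ) :
    ∑ n ∈ Finset.range (q * m), g n = ∑ k ∈ Finset.range m, ∑ r ∈ Finset.range q, g (q * k + r) := by
  induction m with
  | zero => simp
  | succ m ih => rw [Nat.mul_succ, Finset.sum_range_add, ih, Finset.sum_range_succ]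

/-- error term in the second moment -/
noncomputable def Eerr (q : ℕ) : ℝ := ((1 + 2 * Real.log q) * (1 + Real.log q)) ^ 2 / q

lemma second_moment {q : ℕ} [Fact q.Prime] (a : ℕ → ℝ) (ha : ∀ n, 0 ≤ a n)
    (ha' : ∀ n, 1 ≤ n → a n ≤ (1 + Real.log n) / n) :
    ∑ χ : DirichletCharacter ℂ q, ‖∑ n ∈ Finset.range (q * q), (a n : ℂ) * χ n‖ ^ 2 ≤
      q * (2 * ∑ r ∈ Finset.range q, a r ^ 2 + 2 * Eerr q) := by
  have hq : q.Prime := Fact.out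
  have hq1 : (1:ℝ) < q := by exact_mod_cast hq.one_lt
  have hlq : 0 ≤ Real.log q := Real.log_natCast_nonneg q
  set b : ℕ → ℝ := fun r => if r = 0 then 0 else ∑ k ∈ Finset.range q, a (q * k + r) with hb
  have e1 : ∀ χ : DirichletCharacter ℂ q, ∑ n ∈ Finset.range (q * q), (a n : ℂ) * χ n =
      ∑ z : ZMod q, (b z.val : ℂ) * χ z := by
    intro χ
    rw [sum_range_mul', Finset.sum_comm, ← sum_range_zmod]
    refine Finset.sum_congr rfl fun r hr => ?_
    rw [ZMod.val_cast_of_lt (Finset.mem_range.1 hr), hb]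
    by_cases h0 : r = 0
    · subst h0; simp [χ.map_zero' hq.ne_one]
    · simp [h0, Finset.sum_mul]
  simp_rw [e1]
  refine (parseval_le _).trans ?_
  refine mul_le_mul_of_nonneg_left ?_ (by positivity)
  rw [← sum_range_zmodR]
  set δ : ℝ := (1 + 2 * Real.log q) * (1 + Real.log q) / q with hδ
  have hδ0 : 0 ≤ δ := by positivity
  have hE : Eerr q = q * δ ^ 2 := by
    rw [Eerr, hδ]; field_simp
  have hharm : ∑ k ∈ Finset.range (q-1), ((k:ℝ)+1)⁻¹ ≤ 1 + Real.log q := by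
    have h := harmonic_le_one_add_log (q-1)
    have h2 : ((harmonic (q-1) : ℚ) : ℝ) = ∑ k ∈ Finset.range (q-1), ((k:ℝ)+1)⁻¹ := by
      simp [harmonic]
    rw [← h2]
    refine h.trans ?_
    have : Real.log ((q-1 : ℕ):ℝ) ≤ Real.log q := by
      apply Real.log_le_log
      · exact_mod_cast (by have := hq.two_le; omega)
      · exact_mod_cast Nat.sub_le q 1
    linarith
  have hbr : ∀ r ∈ Finset.range q, 0 ≤ b r ∧ b r ≤ a r + δ := by
    intro r hr
    have hr := Finset.mem_range.1 hr
    by_cases h0 : r = 0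
    · simp [hb, h0]; exact add_nonneg (ha 0) hδ0
    · simp only [hb, h0, if_false]
      refine ⟨Finset.sum_nonneg fun k _ => ha _, ?_⟩
      have hqs : q = (q - 1) + 1 := by have := hq.two_le; omega
      have hs : ∑ k ∈ Finset.range q, a (q * k + r) =
          (∑ k ∈ Finset.range (q-1), a (q * (k+1) + r)) + a r := by
        conv_lhs => rw [show Finset.range q = Finset.range ((q-1)+1) by rw [← hqs]]
        rw [Finset.sum_range_succ']
        simp
      rw [hs, add_comm]
      refine add_le_add le_rfl ?_
      calc ∑ k ∈ Finset.range (q-1), a (q * (k+1) + r)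
          ≤ ∑ k ∈ Finset.range (q-1), (1 + 2 * Real.log q) / q * ((k:ℝ)+1)⁻¹ := by
            refine Finset.sum_le_sum fun k hk => ?_
            have hk := Finset.mem_range.1 hk
            have hlt : q * (k+1) + r ≤ q * q := by
              have : q * (k+1) + q ≤ q * q := by
                have : k + 1 + 1 ≤ q := by omega
                calc q * (k+1) + q = q * (k+1+1) := by ring
                  _ ≤ q * q := Nat.mul_le_mul_left q this
              omega
            have hn1 : 1 ≤ q * (k+1) + r := by omega
            refine (ha' _ hn1).trans ?_
            have hlog : Real.log ((q * (k+1) + r : ℕ) : ℝ) ≤ 2 * Real.log q := by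
              have : Real.log (((q * (k+1) + r : ℕ)) : ℝ) ≤ Real.log ((q * q : ℕ) : ℝ) :=
                Real.log_le_log (by exact_mod_cast hn1) (by exact_mod_cast hlt)
              refine this.trans (le_of_eq ?_)
              push_cast
              rw [Real.log_mul (by positivity) (by positivity)]; ring
            have hden : (q:ℝ) * (k+1) ≤ ((q * (k+1) + r : ℕ) : ℝ) := by
              push_cast; linarith [(Nat.cast_nonneg r : (0:ℝ) ≤ r)]
            calc _ ≤ (1 + 2 * Real.log q) / (q * (k+1)) := by
                  apply div_le_div₀ (by positivity) (by linarith) (by positivity) hden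
              _ = _ := by field_simp
        _ = (1 + 2 * Real.log q) / q * ∑ k ∈ Finset.range (q-1), ((k:ℝ)+1)⁻¹ := by
            rw [Finset.mul_sum]
        _ ≤ (1 + 2 * Real.log q) / q * (1 + Real.log q) := by
            refine mul_le_mul_of_nonneg_left hharm (by positivity)
        _ = δ := by rw [hδ]; ring
  calc ∑ k ∈ Finset.range q, ‖((b (k : ZMod q).val : ℝ) : ℂ)‖ ^ 2
      ≤ ∑ k ∈ Finset.range q, (2 * a k ^ 2 + 2 * δ ^ 2) := by
        refine Finset.sum_le_sum fun r hr => ?_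
        rw [ZMod.val_cast_of_lt (Finset.mem_range.1 hr), Complex.norm_real,
          Real.norm_of_nonneg (hbr r hr).1]
        have := hbr r hr
        nlinarith [sq_nonneg (a r - δ), ha r]
    _ = 2 * ∑ r ∈ Finset.range q, a r ^ 2 + 2 * Eerr q := by
        rw [Finset.sum_add_distrib, ← Finset.mul_sum, hE]; simp; ring

/-- majorant of the diagonal terms -/
noncomputable def gdiag (n : ℕ) : ℝ := ((1 + Real.log n) / n) ^ 2

lemma gdiag_nonneg (n : ℕ) : 0 ≤ gdiag n := sq_nonneg _

lemma gdiag_summable : Summable gdiag := by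
  have h : Summable (fun n : ℕ => 25 * (1 / (n:ℝ) ^ (3/2 : ℝ))) :=
    (Real.summable_one_div_nat_rpow.2 (by norm_num)).mul_left 25
  refine Summable.of_nonneg_of_le (fun n => sq_nonneg _) (fun n => ?_) h
  rcases Nat.eq_zero_or_pos n with rfl | hn
  · simp [gdiag]
  have hn' : (0:ℝ) < n := by exact_mod_cast hn
  have hn1 : (1:ℝ) ≤ n := by exact_mod_cast hn
  have h1 : Real.log n ≤ 4 * (n:ℝ) ^ (1/4 : ℝ) := by
    have := Real.log_le_rpow_div hn'.le (show (0:ℝ) < 1/4 by norm_num)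
    linarith
  have h2 : (1:ℝ) ≤ (n:ℝ) ^ (1/4 : ℝ) := Real.one_le_rpow hn1 (by norm_num)
  have h3 : (0:ℝ) ≤ Real.log n := Real.log_nonneg hn1
  have h4 : (1 + Real.log n) ^ 2 ≤ 25 * (n:ℝ) ^ (1/2 : ℝ) := by
    have : ((n:ℝ) ^ (1/4 : ℝ)) ^ 2 = (n:ℝ) ^ (1/2 : ℝ) := by
      rw [← Real.rpow_natCast, ← Real.rpow_mul hn'.le]; norm_num
    rw [← this]
    nlinarith
  have h5 : (n:ℝ) ^ (1/2 : ℝ) * (n:ℝ) ^ (3/2 : ℝ) = (n:ℝ)^2 := by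
    rw [← Real.rpow_add hn', ← Real.rpow_natCast]; norm_num
  rw [gdiag, div_pow, div_le_iff₀ (by positivity), ← h5]
  have : (n:ℝ) ^ (3/2 : ℝ) ≠ 0 := by positivity
  calc _ ≤ _ := h4
    _ = _ := by field_simp

/-- tail of the diagonal majorant -/
noncomputable def eta (y : ℕ) : ℝ := ∑' n, gdiag (n + (y+1))

lemma eta_tendsto : Tendsto eta atTop (nhds 0) :=
  (tendsto_sum_nat_add gdiag).comp (tendsto_add_atTop_nat 1)

lemma eta_nonneg (y : ℕ) : 0 ≤ eta y := tsum_nonneg fun _ => sq_nonneg _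

lemma second_moment_sieved {q : ℕ} [Fact q.Prime] (y : ℕ) (w : ℕ → ℝ)
    (hw0 : ∀ n, 0 ≤ w n) (hw : ∀ n, 1 ≤ n → w n ≤ 1 + Real.log n) :
    ∑ χ : DirichletCharacter ℂ q, ‖∑ n ∈ Finset.range (q * q),
      ((if n.Coprime y.factorial ∧ 2 ≤ n then w n / n else 0 : ℝ) : ℂ) * χ n‖ ^ 2 ≤
      q * (2 * eta y + 2 * Eerr q) := by
  refine (second_moment (fun n => if n.Coprime y.factorial ∧ 2 ≤ n then w n / n else 0)
    ?_ ?_).trans ?_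
  · intro n; split_ifs
    · exact div_nonneg (hw0 n) (by positivity)
    · exact le_rfl
  · intro n hn; split_ifs
    · gcongr; exact hw n hn
    · have := Real.log_natCast_nonneg n
      positivity
  · gcongr
    have h1 : ∀ r ∈ Finset.range q,
        (if r.Coprime y.factorial ∧ 2 ≤ r then w r / r else 0) ^ 2 ≤
        if y < r then gdiag r else 0 := by
      intro r _
      by_cases h : r.Coprime y.factorial ∧ 2 ≤ r
      · have hyr : y < r := by
          by_contra hcon
          push Not at hcon
          have : r ∣ y.factorial := Nat.dvd_factorial (by omega) hcon
          have := Nat.Coprime.eq_one_of_dvd h.1 this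
          omega
        rw [if_pos h, if_pos hyr, gdiag]
        have : 0 ≤ w r / r := div_nonneg (hw0 r) (by positivity)
        gcongr
        exact hw r (by omega)
      · rw [if_neg h]
        split_ifs
        · simpa using gdiag_nonneg r
        · simp
    refine (Finset.sum_le_sum h1).trans ?_
    have hs : Summable (fun r => if y < r then gdiag r else 0) := by
      refine Summable.of_nonneg_of_le (fun r => ?_) (fun r => ?_) gdiag_summable
      · split_ifs
        · exact sq_nonneg _
        · exact le_rfl
      · split_ifs
        · exact le_rfl
        · exact sq_nonneg _
    refine (hs.sum_le_tsum _ (fun r _ => ?_)).trans ?_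
    · split_ifs
      · exact sq_nonneg _
      · exact le_rfl
    · rw [← hs.sum_add_tsum_nat_add (y+1), eta]
      have : ∑ i ∈ Finset.range (y+1), (if y < i then gdiag i else 0) = 0 := by
        refine Finset.sum_eq_zero fun i hi => ?_
        have := Finset.mem_range.1 hi
        rw [if_neg (by omega)]
      rw [this, zero_add]
      refine le_of_eq (tsum_congr fun n => ?_)
      rw [if_pos (by omega)]

lemma Eerr_tendsto : Tendsto Eerr atTop (nhds 0) := by
  have h := fun k : ℕ => (Real.isLittleO_pow_log_id_atTop (n := k)).tendsto_div_nhds_zero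
  have h' : Tendsto (fun x : ℝ => ((1 + 2 * Real.log x) * (1 + Real.log x)) ^ 2 / x) atTop (nhds 0) := by
    have e : (fun x : ℝ => ((1 + 2 * Real.log x) * (1 + Real.log x)) ^ 2 / x) =
      fun x : ℝ => Real.log x ^ 0 / x + 6 * (Real.log x ^ 1 / x) + 13 * (Real.log x ^ 2 / x)
        + 12 * (Real.log x ^ 3 / x) + 4 * (Real.log x ^ 4 / x) := by
      ext x; ring
    rw [e]
    have := ((((h 0).add ((h 1).const_mul 6)).add ((h 2).const_mul 13)).add
      ((h 3).const_mul 12)).add ((h 4).const_mul 4)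
    simpa using this
  exact h'.comp tendsto_natCast_atTop_atTop

end part3


section part4

noncomputable def Terr (y q : ℕ) : ℝ := 2 * (y.factorial : ℝ) * ((1 + 2 * Real.log q) / q)

noncomputable def rho (y q : ℕ) : ℝ := 2 * Terr y q ^ 2 + 4 * Eerr q

lemma rho_tendsto (y : ℕ) : Tendsto (rho y) atTop (nhds 0) := by
  have h := fun k : ℕ => (Real.isLittleO_pow_log_id_atTop (n := k)).tendsto_div_nhds_zero
  have h1 : Tendsto (fun x : ℝ => (1 + 2 * Real.log x) / x) atTop (nhds 0) := by
    have e : (fun x : ℝ => (1 + 2 * Real.log x) / x) =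
      fun x : ℝ => Real.log x ^ 0 / x + 2 * (Real.log x ^ 1 / x) := by
      ext x; ring
    rw [e]
    simpa using (h 0).add ((h 1).const_mul 2)
  have h2 : Tendsto (Terr y) atTop (nhds 0) := by
    have := (h1.comp tendsto_natCast_atTop_atTop).const_mul (2 * (y.factorial : ℝ))
    rw [mul_zero] at this
    exact this
  have := ((h2.pow 2).const_mul 2).add (Eerr_tendsto.const_mul 4)
  have e : (2 * (0:ℝ) ^ 2 + 4 * 0) = 0 := by norm_num
  rw [e] at this
  exact this

/-- The character with the small primes removed. -/
noncomputable def sieved (y : ℕ) {q : ℕ} (χ : DirichletCharacter ℂ q) :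
    DirichletCharacter ℂ (q * y.factorial) :=
  DirichletCharacter.changeLevel (Dvd.intro y.factorial rfl : q ∣ q * y.factorial) χ

instance factNeZero (y : ℕ) : NeZero y.factorial := ⟨y.factorial_ne_zero⟩

lemma moment_generic {q : ℕ} [Fact q.Prime] (y : ℕ) (w : ℕ → ℝ)
    (hw0 : ∀ n, 0 ≤ w n) (hw : ∀ n, 1 ≤ n → w n ≤ 1 + Real.log n)
    (V : DirichletCharacter ℂ q → ℂ)
    (hV : ∀ χ, χ ≠ 1 → ‖V χ + ((w 1 : ℝ) : ℂ) - ∑ n ∈ Finset.range (q * q),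
      (w n : ℂ) * sieved y χ n / n‖ ≤ Terr y q) :
    ∑ χ : DirichletCharacter ℂ q, (if χ ≠ 1 then ‖V χ‖ ^ 2 else 0) ≤
      q * (4 * eta y + rho y q) := by
  have hq : q.Prime := Fact.out
  have hq2 := hq.two_le
  have hlq : 0 ≤ Real.log q := Real.log_natCast_nonneg q
  have hT : 0 ≤ Terr y q := by rw [Terr]; positivity
  set S : DirichletCharacter ℂ q → ℂ := fun χ => ∑ n ∈ Finset.range (q * q),
      ((if n.Coprime y.factorial ∧ 2 ≤ n then w n / n else 0 : ℝ) : ℂ) * χ n with hS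
  have hSe : ∀ χ, ∑ n ∈ Finset.range (q * q), (w n : ℂ) * sieved y χ n / n = w 1 + S χ := by
    intro χ
    have h1 : ∑ n ∈ Finset.range (q * q), (if n = 1 then ((w 1 : ℝ) : ℂ) else 0) = w 1 := by
      rw [Finset.sum_ite_eq', if_pos]
      rw [Finset.mem_range]; nlinarith
    rw [hS, ← h1]
    simp only
    rw [← Finset.sum_add_distrib]
    refine Finset.sum_congr rfl fun n _ => ?_
    rw [sieved, changeLevel_apply']
    rcases Nat.lt_or_ge n 2 with h | h
    · interval_cases n
      · simp
      · simp
    · by_cases hc : n.Coprime y.factorial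
      · rw [if_pos hc, if_neg (show n ≠ 1 by omega), if_pos (show n.Coprime y.factorial ∧ 2 ≤ n from ⟨hc, h⟩), zero_add]
        push_cast; ring
      · simp [hc, show n ≠ 1 by omega]
  have hb : ∀ χ : DirichletCharacter ℂ q, (if χ ≠ 1 then ‖V χ‖ ^ 2 else 0) ≤
      (if χ ≠ 1 then 2 * Terr y q ^ 2 else 0) + 2 * ‖S χ‖ ^ 2 := by
    intro χ
    by_cases h : χ ≠ 1
    · rw [if_pos h, if_pos h]
      have h1 := hV χ h
      rw [hSe, show V χ + (w 1 : ℂ) - (w 1 + S χ) = V χ - S χ by ring] at h1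
      have h2 : ‖V χ‖ ≤ Terr y q + ‖S χ‖ := by
        have := norm_add_le (V χ - S χ) (S χ)
        rw [sub_add_cancel] at this
        linarith
      nlinarith [norm_nonneg (V χ), norm_nonneg (S χ), sq_nonneg (Terr y q - ‖S χ‖)]
    · rw [if_neg h, if_neg h]; positivity
  have hcard : ∑ χ : DirichletCharacter ℂ q, (if χ ≠ 1 then 2 * Terr y q ^ 2 else 0) ≤
      q * (2 * Terr y q ^ 2) := by
    calc _ ≤ ∑ χ : DirichletCharacter ℂ q, 2 * Terr y q ^ 2 := by
          refine Finset.sum_le_sum fun χ _ => ?_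
          split_ifs
          · exact le_rfl
          · positivity
      _ = (Fintype.card (DirichletCharacter ℂ q)) * (2 * Terr y q ^ 2) := by
          rw [Finset.sum_const, Finset.card_univ, nsmul_eq_mul]
      _ ≤ _ := by
          refine mul_le_mul_of_nonneg_right ?_ (by positivity)
          rw [← Nat.card_eq_fintype_card, DirichletCharacter.card_eq_totient_of_hasEnoughRootsOfUnity]
          exact_mod_cast Nat.totient_le q
  refine (Finset.sum_le_sum fun χ _ => hb χ).trans ?_
  rw [Finset.sum_add_distrib, ← Finset.mul_sum]
  have := second_moment_sieved (q := q) y w hw0 hw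
  rw [rho]
  calc _ ≤ q * (2 * Terr y q ^ 2) + 2 * (q * (2 * eta y + 2 * Eerr q)) := by
        exact add_le_add hcard (mul_le_mul_of_nonneg_left this (by norm_num))
    _ = _ := by ring

lemma sieved_ne_one {q : ℕ} [Fact q.Prime] (y : ℕ) (χ : DirichletCharacter ℂ q) (h : χ ≠ 1) :
    sieved y χ ≠ 1 := h ∘ (DirichletCharacter.changeLevel_eq_one_iff _).mp

lemma moment0 {q : ℕ} [Fact q.Prime] (y : ℕ) :
    ∑ χ : DirichletCharacter ℂ q,
      (if χ ≠ 1 then ‖DirichletCharacter.LFunction (sieved y χ) 1 - 1‖ ^ 2 else 0) ≤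
      q * (4 * eta y + rho y q) := by
  have hq : q.Prime := Fact.out
  have hq2 := hq.two_le
  have hlq : 0 ≤ Real.log q := Real.log_natCast_nonneg q
  refine moment_generic y (fun _ => 1) (by simp)
    (fun n _ => by linarith [Real.log_natCast_nonneg n]) _ ?_
  intro χ h
  have := L_tail (sieved y χ) (sieved_ne_one y χ h) (q * q) (by nlinarith)
  simp only [Complex.ofReal_one, sub_add_cancel, one_mul]
  refine this.trans ?_
  rw [Terr]
  push_cast
  have hq0 : (0:ℝ) < q := by exact_mod_cast hq.pos
  calc _ = 2 * (y.factorial : ℝ) * (1 / q) := by field_simp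
    _ ≤ _ := by gcongr; linarith

lemma moment1 {q : ℕ} [Fact q.Prime] (y : ℕ) :
    ∑ χ : DirichletCharacter ℂ q,
      (if χ ≠ 1 then ‖deriv (DirichletCharacter.LFunction (sieved y χ)) 1‖ ^ 2 else 0) ≤
      q * (4 * eta y + rho y q) := by
  have hq : q.Prime := Fact.out
  have hq2 := hq.two_le
  have hlq : 0 ≤ Real.log q := Real.log_natCast_nonneg q
  have := moment_generic (q := q) y (fun n => Real.log n) (fun n => Real.log_natCast_nonneg n)
    (fun n _ => by linarith [Real.log_natCast_nonneg n])
    (fun χ => - deriv (DirichletCharacter.LFunction (sieved y χ)) 1) ?_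
  · simpa only [norm_neg] using this
  intro χ h
  have := Lderiv_tail (sieved y χ) (sieved_ne_one y χ h) (q * q) (by nlinarith)
  rw [← norm_neg] at this
  refine (le_of_eq ?_).trans (this.trans ?_)
  · congr 1
    simp; ring
  rw [Terr]
  push_cast
  have hq0 : (0:ℝ) < q := by exact_mod_cast hq.pos
  rw [Real.log_mul hq0.ne' hq0.ne']
  calc _ = 2 * (y.factorial : ℝ) * ((2 * Real.log q) / q) := by field_simp; ring
    _ ≤ _ := by
        refine mul_le_mul_of_nonneg_left (div_le_div_of_nonneg_right ?_ hq0.le) (by positivity)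
        linarith

lemma min_bound (A B : ℂ) (ε : ℝ) (hε : 0 < ε) :
    min 1 ‖B / A‖ ≤ 4 * ‖A - 1‖ ^ 2 + ε + ‖B‖ ^ 2 / ε := by
  by_cases h : ‖A - 1‖ ≤ 1/2
  · have hA : 1/2 ≤ ‖A‖ := by
      have := norm_sub_norm_le (1:ℂ) (1 - A)
      rw [norm_one, sub_sub_cancel, norm_sub_rev] at this
      linarith
    have h1 : ‖B / A‖ ≤ 2 * ‖B‖ := by
      rw [norm_div, div_le_iff₀ (by linarith)]
      nlinarith [norm_nonneg B]
    have h2 : 2 * ‖B‖ ≤ ε + ‖B‖ ^ 2 / ε := by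
      have : ε + ‖B‖ ^ 2 / ε - 2 * ‖B‖ = (ε - ‖B‖) ^ 2 / ε := by field_simp; ring
      have h3 : 0 ≤ (ε - ‖B‖) ^ 2 / ε := by positivity
      linarith
    have : 0 ≤ 4 * ‖A - 1‖ ^ 2 := by positivity
    linarith [min_le_right 1 ‖B / A‖]
  · push Not at h
    have h1 : 1 ≤ 4 * ‖A - 1‖ ^ 2 := by nlinarith
    have : 0 ≤ ‖B‖ ^ 2 / ε := by positivity
    linarith [min_le_left 1 ‖B / A‖]

lemma card_ne_one {q : ℕ} [Fact q.Prime] (c : ℝ) :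
    ∑ χ : DirichletCharacter ℂ q, (if χ ≠ 1 then c else 0) = ((q:ℝ) - 2) * c := by
  have hq : q.Prime := Fact.out
  have h : ∑ χ : DirichletCharacter ℂ q, (if χ ≠ 1 then c else 0) =
      ∑ χ : DirichletCharacter ℂ q, (c - if χ = 1 then c else 0) := by
    refine Finset.sum_congr rfl fun χ _ => ?_
    by_cases h : χ = 1 <;> simp [h]
  rw [h, Finset.sum_sub_distrib, Finset.sum_const, Finset.card_univ, nsmul_eq_mul,
    ← Nat.card_eq_fintype_card, DirichletCharacter.card_eq_totient_of_hasEnoughRootsOfUnity,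
    Nat.totient_prime hq, Nat.cast_sub hq.one_lt.le]
  simp; ring

/-- mean distance between `|L'/L|` and the finite Euler product part -/
lemma mean_min {q : ℕ} [Fact q.Prime] (hq3 : 3 ≤ q) (y : ℕ) (ε : ℝ) (hε : 0 < ε) :
    (∑ χ : DirichletCharacter ℂ q, (if χ ≠ 1 then
      min 1 ‖logDeriv (DirichletCharacter.LFunction χ) 1 + Fpart y.factorial (fun n => χ n)‖ else 0))
      / ((q:ℝ) - 2) ≤ ε + (12 + 3 / ε) * (4 * eta y + rho y q) := by
  have hq : q.Prime := Fact.out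
  have hq3' : (3:ℝ) ≤ q := by exact_mod_cast hq3
  have hρ : 0 ≤ 4 * eta y + rho y q := by
    have := eta_nonneg y
    rw [rho, Eerr]; positivity
  rw [div_le_iff₀ (by linarith)]
  have h1 : ∀ χ : DirichletCharacter ℂ q, (if χ ≠ 1 then
      min 1 ‖logDeriv (DirichletCharacter.LFunction χ) 1 + Fpart y.factorial (fun n => χ n)‖ else 0)
      ≤ 4 * (if χ ≠ 1 then ‖DirichletCharacter.LFunction (sieved y χ) 1 - 1‖ ^ 2 else 0)
        + (if χ ≠ 1 then ε else 0) +
        (1/ε) * (if χ ≠ 1 then ‖deriv (DirichletCharacter.LFunction (sieved y χ)) 1‖ ^ 2 else 0) := by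
    intro χ
    by_cases h : χ ≠ 1
    · simp only [if_pos h]
      rw [← logDeriv_decomp hq y.factorial χ h, logDeriv_apply]
      refine (min_bound _ _ ε hε).trans (le_of_eq ?_)
      rw [sieved]; ring
    · simp only [if_neg h]; simp
  refine (Finset.sum_le_sum fun χ _ => h1 χ).trans ?_
  rw [Finset.sum_add_distrib, Finset.sum_add_distrib, ← Finset.mul_sum, ← Finset.mul_sum,
    card_ne_one]
  have h2 : (q:ℝ) ≤ 3 * (q - 2) := by linarith
  have m0 := (moment0 (q := q) y).trans (mul_le_mul_of_nonneg_right h2 hρ)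
  have m1 := (moment1 (q := q) y).trans (mul_le_mul_of_nonneg_right h2 hρ)
  have m1' := mul_le_mul_of_nonneg_left m1 (show 0 ≤ 1 / ε by positivity)
  calc _ ≤ 4 * (3 * ((q:ℝ) - 2) * (4 * eta y + rho y q)) + ((q:ℝ) - 2) * ε +
        1 / ε * (3 * ((q:ℝ) - 2) * (4 * eta y + rho y q)) := by linarith
    _ = _ := by ring

end part4


section part5

lemma exists_lim_of_approx {E : Type*} [NormedAddCommGroup E] [CompleteSpace E] {F : Filter ℕ}
    [F.NeBot] (A : ℕ → E)
    (h : ∀ ε > 0, ∃ B : ℕ → E, ∃ l, Tendsto B F (nhds l) ∧ ∀ᶠ q in F, ‖A q - B q‖ ≤ ε) :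
    ∃ l, Tendsto A F (nhds l) := by
  rw [← cauchy_map_iff_exists_tendsto, cauchy_map_iff]
  refine ⟨inferInstance, ?_⟩
  rw [Metric.uniformity_basis_dist.tendsto_right_iff]
  intro ε hε
  obtain ⟨B, l, hB, hAB⟩ := h (ε / 8) (by positivity)
  have h1 : ∀ᶠ q in F, dist (A q) l < ε / 2 := by
    filter_upwards [hAB, (Metric.tendsto_nhds.1 hB) (ε / 8) (by positivity)] with q h1 h2
    rw [← dist_eq_norm] at h1
    linarith [dist_triangle (A q) (B q) l]
  filter_upwards [prod_mem_prod h1 h1] with p hp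
  have h2 : dist (A p.1) l < ε / 2 := hp.1
  have h3 : dist (A p.2) l < ε / 2 := hp.2
  show dist (A p.1) (A p.2) < ε
  linarith [dist_triangle_right (A p.1) (A p.2) l]

/-- Compact space containing the values of all characters at the primes. -/
abbrev XX : Type := Nat.Primes → Metric.closedBall (0:ℂ) 1

noncomputable def pt {q : ℕ} (χ : DirichletCharacter ℂ q) : XX :=
  fun p => ⟨χ (p : ℕ), by simpa using χ.norm_le_one _⟩

/-- Coordinates -/
def coord (p : Nat.Primes) : C(XX, ℂ) := ⟨fun u => (u p : ℂ), by fun_prop⟩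

noncomputable def AA : StarSubalgebra ℂ C(XX, ℂ) := StarAlgebra.adjoin ℂ (Set.range coord)

lemma AA_dense : AA.topologicalClosure = ⊤ := by
  apply ContinuousMap.starSubalgebra_topologicalClosure_eq_top_of_separatesPoints
  intro u v huv
  obtain ⟨p, hp⟩ := Function.ne_iff.1 huv
  refine ⟨coord p, ⟨coord p, StarAlgebra.subset_adjoin ℂ _ ⟨p, rfl⟩, rfl⟩, ?_⟩
  intro h
  exact hp (Subtype.ext h)

noncomputable def avgC (q : ℕ) (g : XX → ℂ) : ℂ :=
  if h : q.Prime then by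
    haveI : Fact q.Prime := ⟨h⟩
    exact (∑ χ : DirichletCharacter ℂ q, if χ ≠ 1 then g (pt χ) else 0) / ((q : ℂ) - 2)
  else 0

noncomputable def FF : Filter ℕ := atTop ⊓ principal {q : ℕ | q.Prime ∧ Odd q}

lemma FF_event {p : ℕ → Prop} (N : ℕ) (h : ∀ q, N ≤ q → 3 ≤ q → q.Prime → p q) : ∀ᶠ q in FF, p q := by
  rw [FF, eventually_inf_principal]
  filter_upwards [eventually_ge_atTop N] with q hq hp
  refine h q hq ?_ hp.1
  obtain ⟨k, hk⟩ := hp.2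
  have := hp.1.two_le
  omega

instance FF_neBot : FF.NeBot := by
  rw [FF, ← frequently_mem_iff_neBot, frequently_atTop]
  intro a
  obtain ⟨p, hp, hpp⟩ := Nat.exists_infinite_primes (a + 3)
  exact ⟨p, by omega, hpp, hpp.odd_of_ne_two (by omega)⟩

instance FF_cg : FF.IsCountablyGenerated := by
  rw [FF]; infer_instance

lemma FF_le : FF ≤ atTop := inf_le_left

lemma FF_inv : Tendsto (fun q : ℕ => ((q:ℂ) - 2)⁻¹) FF (nhds 0) := by
  refine Tendsto.mono_left ?_ FF_le
  have h1 : Tendsto (fun q : ℕ => ((q:ℝ) - 2)⁻¹) atTop (nhds 0) :=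
    tendsto_inv_atTop_zero.comp (tendsto_atTop_add_const_right _ _ tendsto_natCast_atTop_atTop)
  have h2 := (Complex.continuous_ofReal.tendsto 0).comp h1
  simpa [Function.comp_def] using h2

lemma avgC_mono (g : XX → ℂ) (m n : ℕ) (hm : 0 < m) (hn : 0 < n)
    (h : ∀ q (χ : DirichletCharacter ℂ q), g (pt χ) = χ m * (starRingEnd ℂ) (χ n)) :
    ∃ l, Tendsto (fun q => avgC q g) FF (nhds l) := by
  refine ⟨if m = n then 1 else 0, ?_⟩
  have hev : ∀ᶠ q : ℕ in FF, (if m = n then 1 else 0 : ℂ) + ((if m = n then 1 else 0) - 1) * ((q:ℂ) - 2)⁻¹ = avgC q g := by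
    refine FF_event (m + n + 1) fun q hq hq3 hp => ?_
    have : Fact q.Prime := ⟨hp⟩
    rw [avgC, dif_pos hp]
    have hmq : (m : ZMod q) ≠ 0 := by
      rw [Ne, ZMod.natCast_eq_zero_iff]
      exact fun hd => by have := Nat.le_of_dvd hm hd; omega
    have hnq : (n : ZMod q) ≠ 0 := by
      rw [Ne, ZMod.natCast_eq_zero_iff]
      exact fun hd => by have := Nat.le_of_dvd hn hd; omega
    have hmn : (n : ZMod q) = m ↔ m = n := by
      rw [ZMod.natCast_eq_natCast_iff', Nat.mod_eq_of_lt (by omega), Nat.mod_eq_of_lt (by omega)]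
      exact eq_comm
    have e : ∀ χ : DirichletCharacter ℂ q, g (pt χ) = χ (n : ZMod q)⁻¹ * χ m := by
      intro χ
      rw [h, ← MulChar.inv_apply', ← MulChar.star_apply', mul_comm]; rfl
    have e1 : g (pt (1 : DirichletCharacter ℂ q)) = 1 := by
      rw [h, MulChar.one_apply (Ne.isUnit hmq), MulChar.one_apply (Ne.isUnit hnq)]; simp
    have s : (∑ χ : DirichletCharacter ℂ q, if χ ≠ 1 then g (pt χ) else 0) =
        (∑ χ : DirichletCharacter ℂ q, g (pt χ)) - 1 := by
      have : ∀ χ : DirichletCharacter ℂ q, (if χ ≠ 1 then g (pt χ) else 0) =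
          g (pt χ) - if χ = 1 then g (pt (1 : DirichletCharacter ℂ q)) else 0 := by
        intro χ; by_cases h : χ = 1 <;> simp [h]
      simp_rw [this]
      rw [Finset.sum_sub_distrib]; simp [e1]
    rw [s]
    simp_rw [e]
    rw [DirichletCharacter.sum_char_inv_mul_char_eq ℂ (Ne.isUnit hnq), Nat.totient_prime hp,
      Nat.cast_sub hp.one_lt.le]
    have hq2 : (q:ℂ) - 2 ≠ 0 := by
      rw [sub_ne_zero]; exact_mod_cast (by omega : q ≠ 2)
    by_cases hc : m = n
    · rw [if_pos hc, if_pos (hmn.2 hc)]; field_simp; push_cast; ring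
    · rw [if_neg hc, if_neg (fun h => hc (hmn.1 h))]; field_simp; ring
  have := tendsto_const_nhds (x := (if m = n then 1 else 0 : ℂ)) (f := FF) |>.add
    (FF_inv.const_mul ((if m = n then 1 else 0 : ℂ) - 1))
  rw [mul_zero, add_zero] at this
  exact this.congr' hev

lemma avgC_add (q : ℕ) (g h : XX → ℂ) : avgC q (g + h) = avgC q g + avgC q h := by
  rw [avgC, avgC, avgC]
  split_ifs
  · rw [← add_div, ← Finset.sum_add_distrib]
    congr 1
    refine Finset.sum_congr rfl fun χ _ => ?_
    split_ifs <;> simp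
  · simp

lemma avgC_smul (q : ℕ) (c : ℂ) (g : XX → ℂ) : avgC q (c • g) = c * avgC q g := by
  rw [avgC, avgC]
  split_ifs
  · rw [← mul_div_assoc, Finset.mul_sum]
    congr 1
    refine Finset.sum_congr rfl fun χ _ => ?_
    split_ifs <;> simp
  · simp

lemma avgC_AA (g : C(XX, ℂ)) (hg : g ∈ AA) : ∃ l, Tendsto (fun q => avgC q g) FF (nhds l) := by
  have hg' : g ∈ Submodule.span ℂ (Submonoid.closure (Set.range coord ∪ star (Set.range coord)) : Set C(XX, ℂ)) := by
    rw [← Algebra.adjoin_eq_span]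
    exact hg
  clear hg
  induction hg' using Submodule.span_induction with
  | mem x hx =>
    have : ∃ m n : ℕ, 0 < m ∧ 0 < n ∧
        ∀ q (χ : DirichletCharacter ℂ q), x (pt χ) = χ m * (starRingEnd ℂ) (χ n) := by
      induction hx using Submonoid.closure_induction with
      | mem x hx =>
        rcases hx with ⟨p, rfl⟩ | hx
        · exact ⟨p, 1, p.2.pos, one_pos, fun q χ => by simp [coord, pt]⟩
        · obtain ⟨p, hp⟩ := Set.mem_star.1 hx
          refine ⟨1, p, one_pos, p.2.pos, fun q χ => ?_⟩
          rw [← star_star x, ← hp]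
          simp [coord, pt]
      | one => exact ⟨1, 1, one_pos, one_pos, fun q χ => by simp⟩
      | mul x y _ _ hx hy =>
        obtain ⟨m, n, hm, hn, h⟩ := hx
        obtain ⟨m', n', hm', hn', h'⟩ := hy
        refine ⟨m * m', n * n', by positivity, by positivity, fun q χ => ?_⟩
        simp only [ContinuousMap.mul_apply, h, h', Nat.cast_mul, map_mul]
        ring
    obtain ⟨m, n, hm, hn, h⟩ := this
    exact avgC_mono x m n hm hn h
  | zero => exact ⟨0, by simp [avgC]⟩
  | add x y _ _ hx hy =>
    obtain ⟨l, hl⟩ := hx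
    obtain ⟨l', hl'⟩ := hy
    refine ⟨l + l', (hl.add hl').congr fun q => ?_⟩
    rw [ContinuousMap.coe_add, avgC_add]
  | smul c x _ hx =>
    obtain ⟨l, hl⟩ := hx
    refine ⟨c * l, (hl.const_mul c).congr fun q => ?_⟩
    rw [ContinuousMap.coe_smul, avgC_smul]

end part5


section part6

lemma avgC_norm {q : ℕ} (hp : q.Prime) (h3 : 3 ≤ q) (g : XX → ℂ) (C : ℝ) (h : ∀ x, ‖g x‖ ≤ C) :
    ‖avgC q g‖ ≤ C := by
  have : Fact q.Prime := ⟨hp⟩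
  have h3' : (3:ℝ) ≤ q := by exact_mod_cast h3
  have e : ‖(q:ℂ) - 2‖ = (q:ℝ) - 2 := by
    rw [show (q:ℂ) - 2 = (((q:ℝ) - 2 : ℝ) : ℂ) by push_cast; ring, Complex.norm_real,
      Real.norm_of_nonneg (by linarith)]
  rw [avgC, dif_pos hp, norm_div, e, div_le_iff₀ (by linarith), mul_comm, ← card_ne_one]
  refine (norm_sum_le _ _).trans (Finset.sum_le_sum fun χ _ => ?_)
  split_ifs
  · exact h _
  · simp

lemma avgC_sub (q : ℕ) (g h : XX → ℂ) : avgC q g - avgC q h = avgC q (g - h) := by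
  rw [sub_eq_add_neg g h, show -h = (-1 : ℂ) • h by simp, avgC_add, avgC_smul]; ring

lemma avgC_all (g : C(XX, ℂ)) : ∃ l, Tendsto (fun q => avgC q g) FF (nhds l) := by
  apply exists_lim_of_approx
  intro ε hε
  have hg : g ∈ AA.topologicalClosure := by rw [AA_dense]; trivial
  have hg' : g ∈ closure (AA : Set C(XX, ℂ)) := hg
  obtain ⟨h, hA, hd⟩ := Metric.mem_closure_iff.1 hg' ε hε
  obtain ⟨l, hl⟩ := avgC_AA h hA
  refine ⟨_, l, hl, FF_event 0 fun q _ h3 hp => ?_⟩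
  rw [avgC_sub]
  refine avgC_norm hp h3 _ _ fun x => ?_
  have := ContinuousMap.norm_coe_le_norm (g - h) x
  rw [dist_eq_norm] at hd
  exact this.trans hd.le

/-- average of a function of the finite Euler part -/
noncomputable def avgF (y : ℕ) (f : ℝ → ℝ) (q : ℕ) : ℝ :=
  if h : q.Prime then by
    haveI : Fact q.Prime := ⟨h⟩
    exact (∑ χ : DirichletCharacter ℂ q, if χ ≠ 1 then
      f ‖Fpart y.factorial (fun n => χ n)‖ else 0) / ((q : ℝ) - 2)
  else 0

lemma avgF_lim (y : ℕ) (f : ℝ → ℝ) (hf : Continuous f) :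
    ∃ l, Tendsto (avgF y f) FF (nhds l) := by
  let S := y.factorial.primeFactors
  let G : XX → ℂ := fun u => ∑ p ∈ S.attach, Real.log (p:ℕ) *
    (u ⟨p, Nat.prime_of_mem_primeFactors p.2⟩ : ℂ) /
      (((p:ℕ):ℂ) - (u ⟨p, Nat.prime_of_mem_primeFactors p.2⟩ : ℂ))
  have hG : Continuous G := by
    refine continuous_finsetSum _ fun p _ => ?_
    refine Continuous.div (by fun_prop) (by fun_prop) fun u => ?_
    refine factor_ne _ (Nat.prime_of_mem_primeFactors p.2) _ ?_
    exact mem_closedBall_zero_iff.1 (u ⟨p, Nat.prime_of_mem_primeFactors p.2⟩).2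
  have hGF : ∀ q (χ : DirichletCharacter ℂ q), G (pt χ) = Fpart y.factorial (fun n => χ n) := by
    intro q χ
    simp only [G, Fpart, pt]
    exact Finset.sum_attach S (fun p => (Real.log p : ℂ) * χ p / ((p:ℂ) - χ p))
  obtain ⟨l, hl⟩ := avgC_all ⟨fun u => ((f ‖G u‖ : ℝ) : ℂ), by fun_prop⟩
  refine ⟨l.re, ((Complex.continuous_re.tendsto l).comp hl).congr fun q => ?_⟩
  simp only [Function.comp]
  rw [avgC, avgF]
  split_ifs with hp
  · have : Fact q.Prime := ⟨hp⟩
    rw [show ((q:ℂ) - 2) = (((q:ℝ) - 2 : ℝ) : ℂ) by push_cast; ring, Complex.div_ofReal_re,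
      Complex.re_sum]
    congr 1
    refine Finset.sum_congr rfl fun χ _ => ?_
    split_ifs
    · simp [hGF]
    · simp
  · simp

lemma charAverage_eq {q : ℕ} [Fact q.Prime] (f : ℝ → ℝ) : charAverage q f =
    (∑ χ : DirichletCharacter ℂ q, if χ ≠ 1 then
      f ‖logDeriv (DirichletCharacter.LFunction χ) 1‖ else 0) / ((q : ℝ) - 2) := by
  have hq : q.Prime := Fact.out
  rw [charAverage, dif_pos hq.two_le]

lemma approx (ε : ℝ) (hε : 0 < ε) : ∃ y, ∀ᶠ q in FF, ∀ (f : ℝ → ℝ) (C : ℝ), 0 ≤ C →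
    (∀ a b, |f a - f b| ≤ C * min 1 |a - b|) → |charAverage q f - avgF y f q| ≤ C * ε := by
  set K := 12 + 3 / (ε / 2)
  have hK : 0 < K := by positivity
  have h1 := (eta_tendsto.const_mul (K * 4))
  rw [mul_zero] at h1
  obtain ⟨y, hy⟩ := ((h1.eventually_lt_const (show 0 < ε / 4 by positivity))).exists
  have h2 := ((rho_tendsto y).const_mul K)
  rw [mul_zero] at h2
  have h3 := FF_le (h2.eventually_lt_const (show 0 < ε / 4 by positivity))
  refine ⟨y, ?_⟩
  filter_upwards [h3, FF_event (p := fun q => 3 ≤ q ∧ q.Prime) 0 fun q _ h3 hp => ⟨h3, hp⟩]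
    with q hr hq f C hC hf
  have : Fact q.Prime := ⟨hq.2⟩
  have h3' : (3:ℝ) ≤ q := by exact_mod_cast hq.1
  have hr' : K * rho y q < ε / 4 := hr
  have hm := mean_min hq.1 y (ε / 2) (by positivity)
  rw [charAverage_eq, avgF, dif_pos hq.2, ← sub_div, ← Finset.sum_sub_distrib, abs_div,
    abs_of_pos (show 0 < (q:ℝ) - 2 by linarith)]
  have hb : (∑ χ : DirichletCharacter ℂ q, (if χ ≠ 1 then
      min 1 ‖logDeriv (DirichletCharacter.LFunction χ) 1 + Fpart y.factorial (fun n => χ n)‖ else 0))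
      / ((q:ℝ) - 2) ≤ ε := by
    refine hm.trans ?_
    have : K * (4 * eta y + rho y q) = K * 4 * eta y + K * rho y q := by ring
    show ε / 2 + K * (4 * eta y + rho y q) ≤ ε
    linarith
  rw [div_le_iff₀ (by linarith)] at hb ⊢
  refine (Finset.abs_sum_le_sum_abs _ _).trans ?_
  rw [mul_assoc]
  refine le_trans ?_ (mul_le_mul_of_nonneg_left hb hC)
  rw [Finset.mul_sum]
  refine Finset.sum_le_sum fun χ _ => ?_
  split_ifs
  · refine (hf _ _).trans (mul_le_mul_of_nonneg_left (min_le_min_left _ ?_) hC)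
    have := abs_norm_sub_norm_le (logDeriv (DirichletCharacter.LFunction χ) 1)
      (-Fpart y.factorial (fun n => χ n))
    rwa [norm_neg, sub_neg_eq_add] at this
  · simp

lemma charAverage_lim (f : ℝ → ℝ) (C : ℝ) (hC : 0 ≤ C)
    (hf : ∀ a b, |f a - f b| ≤ C * min 1 |a - b|) :
    ∃ l, Tendsto (fun q => charAverage q f) FF (nhds l) := by
  have hc : Continuous f := by
    refine (LipschitzWith.of_dist_le_mul (K := ⟨C, hC⟩) fun a b => ?_).continuous
    rw [Real.dist_eq, Real.dist_eq]
    exact (hf a b).trans (mul_le_mul_of_nonneg_left (min_le_right _ _) hC)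
  apply exists_lim_of_approx
  intro ε hε
  obtain ⟨y, hy⟩ := approx (ε / (C + 1)) (by positivity)
  obtain ⟨l, hl⟩ := avgF_lim y f hc
  refine ⟨_, l, hl, ?_⟩
  filter_upwards [hy] with q hq
  refine (hq f C hC hf).trans ?_
  rw [← mul_div_assoc, div_le_iff₀ (by positivity)]
  nlinarith

lemma Fpart_bound (P : ℕ) : ∃ C : ℝ, 0 ≤ C ∧ ∀ q (χ : DirichletCharacter ℂ q),
    ‖Fpart P (fun n => χ n)‖ ≤ C := by
  refine ⟨∑ p ∈ P.primeFactors, Real.log p, Finset.sum_nonneg fun p _ => Real.log_natCast_nonneg p,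
    fun q χ => ?_⟩
  rw [Fpart]
  refine (norm_sum_le _ _).trans (Finset.sum_le_sum fun p hp => ?_)
  have hp2 : (2:ℝ) ≤ p := by exact_mod_cast (Nat.prime_of_mem_primeFactors hp).two_le
  have hχ := χ.norm_le_one (p : ZMod q)
  have h1 : 1 ≤ ‖(p:ℂ) - χ p‖ := by
    have := norm_sub_norm_le (p:ℂ) (χ p)
    rw [Complex.norm_natCast] at this
    linarith
  rw [norm_div, norm_mul, Complex.norm_real, Real.norm_of_nonneg (Real.log_natCast_nonneg p)]
  rw [div_le_iff₀ (by linarith)]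
  exact mul_le_mul_of_nonneg_left (hχ.trans h1) (Real.log_natCast_nonneg p)

/-- tightness -/
lemma tight_avg (ε : ℝ) (hε : 0 < ε) : ∃ R : ℝ, 0 ≤ R ∧ ∀ᶠ q in FF,
    charAverage q (fun x => min 1 (max 0 (|x| - R))) ≤ ε := by
  obtain ⟨y, hy⟩ := approx ε hε
  obtain ⟨R, hR, hb⟩ := Fpart_bound y.factorial
  refine ⟨R, hR, ?_⟩
  filter_upwards [hy, FF_event (p := fun q => 3 ≤ q ∧ q.Prime) 0 fun q _ h3 hp => ⟨h3, hp⟩]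
    with q h hq
  have h1 := h (fun x => min 1 (max 0 (|x| - R))) 1 zero_le_one ?_
  · have h0 : avgF y (fun x => min 1 (max 0 (|x| - R))) q = 0 := by
      rw [avgF, dif_pos hq.2, div_eq_zero_iff]
      left
      refine Finset.sum_eq_zero fun χ _ => ?_
      have := hb q χ
      rw [abs_norm, max_eq_left (by linarith)]
      simp
    rw [h0, sub_zero, one_mul] at h1
    exact (le_abs_self _).trans h1
  · intro a b
    rw [one_mul, le_min_iff]
    constructor
    · rw [abs_le]
      have := min_le_left 1 (max 0 (|a| - R))
      have := min_le_left 1 (max 0 (|b| - R))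
      have : 0 ≤ min 1 (max 0 (|a| - R)) := by positivity
      have : 0 ≤ min 1 (max 0 (|b| - R)) := by positivity
      constructor <;> linarith
    · refine (abs_min_sub_min_le_max _ _ _ _).trans ?_
      rw [sub_self, abs_zero, max_eq_right (abs_nonneg _)]
      refine (abs_max_sub_max_le_max _ _ _ _).trans ?_
      rw [sub_self, abs_zero, max_eq_right (abs_nonneg _), sub_sub_sub_cancel_right]
      exact abs_abs_sub_abs_le a b

end part6


section part7

noncomputable def nu (q : ℕ) : Measure ℝ :=
  if h : q.Prime ∧ 3 ≤ q then by
    haveI : Fact q.Prime := ⟨h.1⟩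
    exact ENNReal.ofReal ((q:ℝ) - 2)⁻¹ • ∑ χ : DirichletCharacter ℂ q,
      if χ ≠ 1 then Measure.dirac ‖logDeriv (DirichletCharacter.LFunction χ) 1‖ else 0
  else Measure.dirac 0

instance nu_prob (q : ℕ) : IsProbabilityMeasure (nu q) := by
  constructor
  rw [nu]
  split_ifs with h
  · have : Fact q.Prime := ⟨h.1⟩
    have h3 : (3:ℝ) ≤ q := by exact_mod_cast h.2
    rw [Measure.smul_apply, Measure.finsetSum_apply]
    have e : ∀ χ : DirichletCharacter ℂ q, (if χ ≠ 1 then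
        Measure.dirac ‖logDeriv (DirichletCharacter.LFunction χ) 1‖ else 0) Set.univ =
        ENNReal.ofReal (if χ ≠ 1 then 1 else 0) := by
      intro χ; split_ifs <;> simp
    rw [Finset.sum_congr rfl fun χ _ => e χ, ← ENNReal.ofReal_sum_of_nonneg
      (fun χ _ => by positivity), card_ne_one, smul_eq_mul, ← ENNReal.ofReal_mul
      (by rw [inv_nonneg]; linarith), mul_one, inv_mul_cancel₀ (by linarith), ENNReal.ofReal_one]
  · simp

lemma nu_integral {q : ℕ} (hp : q.Prime) (h3 : 3 ≤ q) (f : ℝ → ℝ) :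
    ∫ x, f x ∂(nu q) = charAverage q f := by
  have : Fact q.Prime := ⟨hp⟩
  have h3' : (3:ℝ) ≤ q := by exact_mod_cast h3
  rw [nu, dif_pos ⟨hp, h3⟩, charAverage_eq, integral_smul_measure, integral_finsetSum_measure,
    ENNReal.toReal_ofReal (by rw [inv_nonneg]; linarith), smul_eq_mul, div_eq_inv_mul]
  · congr 1
    refine Finset.sum_congr rfl fun χ _ => ?_
    split_ifs <;> simp
  · intro χ _
    split_ifs
    · exact integrable_dirac (by simp)
    · exact integrable_zero_measure

lemma nu_neg (q : ℕ) : nu q (Set.Iio 0) = 0 := by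
  rw [nu]
  split_ifs with h
  · have : Fact q.Prime := ⟨h.1⟩
    rw [Measure.smul_apply, Measure.finsetSum_apply, Finset.sum_eq_zero, smul_zero]
    intro χ _
    split_ifs
    · rw [Measure.dirac_apply' _ measurableSet_Iio]; simp
    · simp
  · rw [Measure.dirac_apply' _ measurableSet_Iio]; simp

/-- support bound for one measure -/
lemma nu_supp (q : ℕ) : ∃ R : ℝ, 0 ≤ R ∧ nu q (Set.Icc (-R) R)ᶜ = 0 := by
  rw [nu]
  split_ifs with h
  · have : Fact q.Prime := ⟨h.1⟩
    refine ⟨∑ χ : DirichletCharacter ℂ q, ‖logDeriv (DirichletCharacter.LFunction χ) 1‖,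
      by positivity, ?_⟩
    rw [Measure.smul_apply, Measure.finsetSum_apply, Finset.sum_eq_zero, smul_zero]
    intro χ _
    split_ifs
    · rw [Measure.dirac_apply' _ measurableSet_Icc.compl]
      have h1 := Finset.single_le_sum
        (f := fun χ : DirichletCharacter ℂ q => ‖logDeriv (DirichletCharacter.LFunction χ) 1‖)
        (fun χ _ => norm_nonneg _) (Finset.mem_univ χ)
      rw [Set.indicator_of_notMem]
      rw [Set.notMem_compl_iff]
      have := norm_nonneg (logDeriv (DirichletCharacter.LFunction χ) 1)
      exact ⟨by linarith, h1⟩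
    · simp
  · exact ⟨0, le_rfl, by rw [Measure.dirac_apply' _ measurableSet_Icc.compl]; simp⟩

lemma nu_tail {q : ℕ} (hp : q.Prime) (h3 : 3 ≤ q) (R ε : ℝ)
    (h : charAverage q (fun x => min 1 (max 0 (|x| - R))) ≤ ε) :
    nu q (Set.Icc (-(R + 1)) (R + 1))ᶜ ≤ ENNReal.ofReal ε := by
  rw [← nu_integral hp h3] at h
  have hi : Integrable (fun x : ℝ => min 1 (max 0 (|x| - R))) (nu q) := by
    refine Integrable.of_bound (C := 1) (by fun_prop) (ae_of_all _ fun x => ?_)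
    rw [Real.norm_of_nonneg (by positivity)]
    exact min_le_left _ _
  refine le_trans ?_ (ENNReal.ofReal_le_ofReal h)
  rw [ofReal_integral_eq_lintegral_ofReal hi (ae_of_all _ fun x => by positivity)]
  rw [← lintegral_indicator_one measurableSet_Icc.compl]
  refine lintegral_mono fun x => ?_
  by_cases hx : x ∈ (Set.Icc (-(R + 1)) (R + 1))ᶜ
  · rw [Set.indicator_of_mem hx]
    have : R + 1 < |x| := by
      by_contra hc
      exact hx (abs_le.1 (not_lt.1 hc))
    rw [min_eq_left (le_max_of_le_right (by linarith))]
    simp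
  · rw [Set.indicator_of_notMem hx]; simp

noncomputable def nuP (q : ℕ) : ProbabilityMeasure ℝ := ⟨nu q, nu_prob q⟩

lemma nu_set_tight : IsTightMeasureSet
    {((μ : ProbabilityMeasure ℝ) : Measure ℝ) | μ ∈ nuP '' {q | q.Prime ∧ Odd q}} := by
  rw [isTightMeasureSet_iff_exists_isCompact_measure_compl_le]
  intro ε hε
  obtain ⟨δ, hδ, hδε⟩ : ∃ δ : ℝ, 0 < δ ∧ ENNReal.ofReal δ ≤ ε := by
    obtain ⟨r, h1, h2⟩ := ENNReal.lt_iff_exists_nnreal_btwn.1 hε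
    exact ⟨r, by exact_mod_cast h1, by simpa using h2.le⟩
  obtain ⟨R, hR, hev⟩ := tight_avg δ hδ
  rw [FF, eventually_inf_principal, eventually_atTop] at hev
  obtain ⟨N, hN⟩ := hev
  choose r hr0 hr using nu_supp
  set T := (R + 1) + ∑ q ∈ Finset.range N, r q
  have hs : 0 ≤ ∑ q ∈ Finset.range N, r q := Finset.sum_nonneg fun q _ => hr0 q
  refine ⟨Set.Icc (-T) T, isCompact_Icc, ?_⟩
  rintro _ ⟨_, ⟨q, hq, rfl⟩, rfl⟩
  have mono : ∀ a, a ≤ T → nu q (Set.Icc (-T) T)ᶜ ≤ nu q (Set.Icc (-a) a)ᶜ := fun a ha =>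
    measure_mono (Set.compl_subset_compl.2 (Set.Icc_subset_Icc (by linarith) ha))
  show nu q (Set.Icc (-T) T)ᶜ ≤ ε
  rcases Nat.lt_or_ge q N with h | h
  · refine (mono (r q) ?_).trans ?_
    · have := Finset.single_le_sum (f := r) (fun q _ => hr0 q) (Finset.mem_range.2 h)
      linarith
    · rw [hr]; exact zero_le
  · refine (mono (R + 1) (by linarith)).trans ((nu_tail hq.1 ?_ R δ (hN q h hq)).trans hδε)
    obtain ⟨k, hk⟩ := hq.2
    have := hq.1.two_le
    omega

lemma exists_limit : ∃ μ : ProbabilityMeasure ℝ, Tendsto nuP FF (nhds μ) := by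
  have hc := isCompact_closure_of_isTightMeasureSet nu_set_tight
  have hle : map nuP FF ≤ principal (closure (nuP '' {q | q.Prime ∧ Odd q})) := by
    rw [le_principal_iff, mem_map]
    have : {q : ℕ | q.Prime ∧ Odd q} ∈ FF := mem_inf_of_right (mem_principal_self _)
    filter_upwards [this] with q hq
    exact subset_closure ⟨q, hq, rfl⟩
  obtain ⟨μ, -, hμ⟩ := hc hle
  have hμ' : MapClusterPt μ FF nuP := hμ
  obtain ⟨U, hU, hUt⟩ := mapClusterPt_iff_ultrafilter.1 hμ'
  refine ⟨μ, ?_⟩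
  rw [tendsto_iff_forall_lipschitz_integral_tendsto]
  rintro f ⟨C, hC⟩ ⟨L, hL⟩
  rw [ProbabilityMeasure.tendsto_iff_forall_integral_tendsto] at hUt
  have hU1 : Tendsto (fun q => ∫ x, f x ∂(nu q)) U (nhds (∫ x, f x ∂(μ : Measure ℝ))) :=
    hUt (BoundedContinuousFunction.mkOfBound ⟨f, hL.continuous⟩ C hC)
  obtain ⟨l, hl⟩ := charAverage_lim f (max C L) (le_max_of_le_right L.2) (fun a b => by
    have hm : 0 ≤ max C (L:ℝ) := le_max_of_le_right L.2
    rcases min_cases 1 |a - b| with ⟨h, _⟩ | ⟨h, _⟩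
    · rw [h, mul_one]
      exact (hC a b).trans (le_max_left _ _)
    · rw [h]
      have := hL.dist_le_mul a b
      rw [Real.dist_eq, Real.dist_eq] at this
      exact this.trans (mul_le_mul_of_nonneg_right (le_max_right _ _) (abs_nonneg _)))
  have hl' : Tendsto (fun q => ∫ x, f x ∂(nu q)) FF (nhds l) :=
    hl.congr' (FF_event 0 fun q _ h3 hp => (nu_integral hp h3 f).symm)
  rw [tendsto_nhds_unique hU1 (hl'.mono_left hU)]
  exact hl'

end part7

/-- There exists a unique probability measure `μ` on `[0, ∞)`
(here: on `ℝ`, giving no mass to `(-∞, 0)`) such that for every bounded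
continuous `f`, the averages `(1/(q-2)) ∑_{χ ≠ χ₀ mod q} f(|L'/L(1,χ)|)`
converge to `∫ f dμ` as `q → ∞` through the odd primes. -/
theorem exists_unique_limit_measure :
    ∃! μ : Measure ℝ, IsProbabilityMeasure μ ∧ μ (Set.Iio 0) = 0 ∧
      ∀ f : BoundedContinuousFunction ℝ ℝ,
        Tendsto (fun q : ℕ => charAverage q f)
          (atTop ⊓ principal {q : ℕ | q.Prime ∧ Odd q}) (nhds (∫ t, f t ∂μ)) := by
  obtain ⟨μ, hμ⟩ := exists_limit
  have key : ∀ f : BoundedContinuousFunction ℝ ℝ,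
      Tendsto (fun q : ℕ => charAverage q f) FF (nhds (∫ t, f t ∂(μ : Measure ℝ))) := by
    intro f
    exact (ProbabilityMeasure.tendsto_iff_forall_integral_tendsto.1 hμ f).congr'
      (FF_event 0 fun q _ h3 hp => nu_integral hp h3 f)
  refine ⟨μ, ⟨inferInstance, ?_, key⟩, ?_⟩
  · have h := ProbabilityMeasure.le_liminf_measure_open_of_tendsto hμ (isOpen_Iio (a := (0:ℝ)))
    refine le_antisymm (h.trans ?_) (zero_le)
    have e : (fun q => (nuP q : Measure ℝ) (Set.Iio 0)) = fun _ => 0 := funext nu_neg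
    rw [e]; simp
  · rintro μ' ⟨hp, -, h⟩
    refine ext_of_forall_integral_eq_of_IsFiniteMeasure fun f => ?_
    exact tendsto_nhds_unique (l := FF) (h f) (key f)
end

section
/- There exist real numbers a > 0 and c > 0 such that liminf over odd primes q of (1/(q−2)) · #{ χ mod q, χ ≠ χ₀ : |L'/L(1, χ)| ≤ a } is at most 1 − c. -/
open Filter

/-- `(1/(q-2)) · #{χ mod q : χ ≠ χ₀ and P(|L'/L(1, χ)|)}`, the proportion of
non-principal Dirichlet characters modulo `q` whose value `|L'/L(1, χ)|`
satisfies the predicate `P` (defined to be `0` for `q < 2`). -/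
noncomputable def charProportion (q : ℕ) (P : ℝ → Prop) : ℝ :=
  if h : 2 ≤ q then by
    haveI : NeZero q := ⟨by omega⟩
    exact ({χ : DirichletCharacter ℂ q | χ ≠ 1 ∧
        P ‖logDeriv (DirichletCharacter.LFunction χ) 1‖}.ncard : ℝ) /
      ((q : ℝ) - 2)
  else 0

/-- The `m`-th block term. -/
noncomputable def blockTerm (q a m : ℕ) (s : ℂ) : ℂ :=
  ((a + q * m : ℕ) : ℂ) ^ (-s) - ((q + q * m : ℕ) : ℂ) ^ (-s)

/-- A bounded convex open neighbourhood of `1` and `2`. -/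
def domU : Set ℂ := {s : ℂ | 1 / 2 < s.re} ∩ Metric.ball 0 4

lemma domU_open : IsOpen domU :=
  (isOpen_lt continuous_const Complex.continuous_re).inter Metric.isOpen_ball

lemma domU_convex : Convex ℝ domU :=
  (convex_halfSpace_re_gt _).inter (convex_ball _ _)

lemma one_mem_domU : (1 : ℂ) ∈ domU := by
  refine ⟨?_, ?_⟩ <;> norm_num

lemma two_mem_domU : (2 : ℂ) ∈ domU := by
  refine ⟨?_, ?_⟩ <;> norm_num

lemma blockTerm_bound {q a : ℕ} (ha : 1 ≤ a) (haq : a ≤ q) (m : ℕ) {s : ℂ} (hs : s ∈ domU) :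
    ‖blockTerm q a m s‖ ≤ (4 * q) * ((m + 1 : ℕ) : ℝ) ^ (-(3 / 2) : ℝ) := by
  obtain ⟨hs1, hs2⟩ := hs
  simp only [Set.mem_ofPred_eq] at hs1
  simp only [Metric.mem_ball, dist_zero_right] at hs2
  have hs0 : -s ≠ 0 := by
    intro h
    have : s = 0 := by simpa using h
    subst this
    norm_num at hs1
  have h1 : ((m + 1 : ℕ) : ℝ) ≤ ((a + q * m : ℕ) : ℝ) := by
    norm_cast
    nlinarith
  have hm : (1 : ℝ) ≤ ((m + 1 : ℕ) : ℝ) := by norm_cast; omega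
  have h2 : ((a + q * m : ℕ) : ℝ) ≤ ((q + q * m : ℕ) : ℝ) := by
    norm_cast; omega
  have key := Convex.norm_image_sub_le_of_norm_hasDerivWithin_le
    (f := fun x : ℝ => (x : ℂ) ^ (-s)) (f' := fun x : ℝ => -s * (x : ℂ) ^ (-s - 1))
    (s := Set.Icc ((a + q * m : ℕ) : ℝ) ((q + q * m : ℕ) : ℝ))
    (C := 4 * ((m + 1 : ℕ) : ℝ) ^ (-(3 / 2) : ℝ)) ?_ ?_ (convex_Icc _ _)
    (x := ((q + q * m : ℕ) : ℝ)) (y := ((a + q * m : ℕ) : ℝ)) ⟨h2, le_rfl⟩ ⟨le_rfl, h2⟩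
  · simp only [Complex.ofReal_natCast] at key
    refine key.trans ?_
    have : ‖((a + q * m : ℕ) : ℝ) - ((q + q * m : ℕ) : ℝ)‖ ≤ q := by
      rw [Real.norm_eq_abs, abs_le]
      push_cast
      have : (1 : ℝ) ≤ a := by exact_mod_cast ha
      have : (a : ℝ) ≤ q := by exact_mod_cast haq
      constructor <;> linarith
    calc _ ≤ 4 * ((m + 1 : ℕ) : ℝ) ^ (-(3 / 2) : ℝ) * q := by gcongr
      _ = _ := by ring
  · intro x hx
    have hx0 : x ≠ 0 := by linarith [hx.1]
    exact (hasDerivAt_ofReal_cpow_const hx0 hs0).hasDerivWithinAt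
  · intro x hx
    have hx0 : 0 < x := by linarith [hx.1]
    rw [norm_mul, norm_neg, Complex.norm_cpow_eq_rpow_re_of_pos hx0]
    have : x ^ (-s - 1).re ≤ ((m + 1 : ℕ) : ℝ) ^ (-(3 / 2) : ℝ) := by
      calc x ^ (-s - 1).re ≤ x ^ (-(3 / 2) : ℝ) := by
            apply Real.rpow_le_rpow_of_exponent_le (by linarith [hx.1])
            simp; linarith
        _ ≤ _ := by
            apply Real.rpow_le_rpow_of_nonpos (by linarith) (by linarith [hx.1]) (by norm_num)
    gcongr

lemma summable_bound (q : ℕ) :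
    Summable (fun m : ℕ => (4 * q : ℝ) * ((m + 1 : ℕ) : ℝ) ^ (-(3 / 2) : ℝ)) := by
  apply Summable.mul_left
  have := (Real.summable_nat_rpow (p := (-(3 / 2) : ℝ))).2 (by norm_num)
  exact (summable_nat_add_iff 1).2 this

lemma blockTerm_hasDerivAt {q a : ℕ} (ha : 1 ≤ a) (hq : 1 ≤ q) (m : ℕ) (s : ℂ) :
    HasDerivAt (blockTerm q a m)
      (-(((a + q * m : ℕ) : ℂ) ^ (-s) * Complex.log ((a + q * m : ℕ) : ℂ)) +
        ((q + q * m : ℕ) : ℂ) ^ (-s) * Complex.log ((q + q * m : ℕ) : ℂ)) s := by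
  have h1 : ((a + q * m : ℕ) : ℂ) ≠ 0 := by norm_cast; omega
  have h2 : ((q + q * m : ℕ) : ℂ) ≠ 0 := by norm_cast; omega
  have := ((hasDerivAt_id s).neg.const_cpow (c := ((a + q * m : ℕ) : ℂ)) (Or.inl h1)).sub
    ((hasDerivAt_id s).neg.const_cpow (c := ((q + q * m : ℕ) : ℂ)) (Or.inl h2))
  refine this.congr_deriv ?_
  simp

lemma LFunction_eq_two {q : ℕ} [Fact q.Prime] {χ : DirichletCharacter ℂ q} (hχ : χ ≠ 1) {s : ℂ}
    (hs : 1 < s.re) :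
    DirichletCharacter.LFunction χ s =
      ∑ j : ZMod q, χ j * ∑' m, blockTerm q j.val m s := by
  have : NeZero q := ⟨(Fact.out : q.Prime).ne_zero⟩
  have hq : 1 ≤ q := (Fact.out : q.Prime).one_le
  have hs0 : s ≠ 0 := by rintro rfl; norm_num at hs
  have hsum : ∀ a : ℕ, Summable (fun m : ℕ => ((a + q * m : ℕ) : ℂ) ^ (-s)) := by
    intro a
    have h0 : Summable (fun n : ℕ => (n : ℂ) ^ (-s)) := by
      have := (Complex.summable_one_div_nat_cpow (p := s)).2 hs
      simpa [Complex.cpow_neg] using this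
    exact h0.comp_injective (i := fun m : ℕ => a + q * m) (fun x y h => by
      simp only [Nat.add_left_cancel_iff] at h
      exact Nat.eq_of_mul_eq_mul_left hq h)
  rw [DirichletCharacter.LFunction_eq_LSeries χ hs, LSeries,
    Nat.sumByResidueClasses (ZMod.LSeriesSummable_of_one_lt_re χ hs) q]
  have hz : ∑ j : ZMod q, χ j * ∑' m : ℕ, ((q + q * m : ℕ) : ℂ) ^ (-s) = 0 := by
    rw [← Finset.sum_mul, MulChar.sum_eq_zero_of_ne_one hχ, zero_mul]
  rw [← sub_zero (∑ j : ZMod q, _), ← hz, ← Finset.sum_sub_distrib]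
  refine Finset.sum_congr rfl fun j _ => ?_
  have e : ∑' m, LSeries.term (fun n : ℕ => χ n) s (j.val + q * m) =
      χ j * ∑' m : ℕ, ((j.val + q * m : ℕ) : ℂ) ^ (-s) := by
    rw [← tsum_mul_left]
    refine tsum_congr fun m => ?_
    rw [LSeries.term_of_ne_zero' hs0, Complex.cpow_neg, div_eq_mul_inv]
    congr 2
    simp
  rw [e, ← mul_sub, ← (hsum _).tsum_sub (hsum _)]
  rfl

theorem LFunction_repr {q : ℕ} [Fact q.Prime] {χ : DirichletCharacter ℂ q} (hχ : χ ≠ 1) :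
    Set.EqOn (DirichletCharacter.LFunction χ) (fun s =>
      ∑ j : ZMod q, χ j * ∑' m, blockTerm q j.val m s) domU := by
  have : NeZero q := ⟨(Fact.out : q.Prime).ne_zero⟩
  have hq : 1 ≤ q := (Fact.out : q.Prime).one_le
  refine AnalyticOnNhd.eqOn_of_preconnected_of_eventuallyEq (𝕜 := ℂ) (z₀ := 2) ?_ ?_
    domU_convex.isPreconnected two_mem_domU ?_
  · exact (DirichletCharacter.differentiable_LFunction hχ).differentiableOn.analyticOnNhd domU_open
  · refine DifferentiableOn.analyticOnNhd ?_ domU_open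
    refine DifferentiableOn.fun_sum fun j _ => ?_
    by_cases hj : j = 0
    · subst hj
      simp only [MulChar.map_zero, zero_mul]
      fun_prop
    · have hj1 : 1 ≤ j.val := Nat.one_le_iff_ne_zero.2 ((ZMod.val_ne_zero j).2 hj)
      refine DifferentiableOn.const_mul ?_ _
      exact Complex.differentiableOn_tsum_of_summable_norm (summable_bound q)
        (fun m s _ => (blockTerm_hasDerivAt hj1 hq m s).differentiableAt.differentiableWithinAt)
        domU_open (fun m s hs => blockTerm_bound hj1 (ZMod.val_lt j).le m hs)
  · have : {z : ℂ | 1 < z.re} ∈ nhds (2 : ℂ) :=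
      (isOpen_lt continuous_const Complex.continuous_re).mem_nhds (by norm_num)
    filter_upwards [this] with z hz
    exact LFunction_eq_two hχ hz

theorem exists_repr (q : ℕ) [Fact q.Prime] : ∃ f g : ZMod q → ℝ, f 0 = 0 ∧ g 0 = 0 ∧
    (∀ j : ZMod q, j ≠ 0 → HasSum (fun m : ℕ =>
      Real.log ((j.val : ℝ) + q * m) / ((j.val : ℝ) + q * m)
        - Real.log ((q : ℝ) + q * m) / ((q : ℝ) + q * m)) (f j)) ∧
    (∀ j : ZMod q, j ≠ 0 → HasSum (fun m : ℕ =>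
      1 / ((j.val : ℝ) + q * m) - 1 / ((q : ℝ) + q * m)) (g j)) ∧
    ∀ χ : DirichletCharacter ℂ q, χ ≠ 1 →
      DirichletCharacter.LFunction χ 1 = ∑ j, χ j * (g j : ℂ) ∧
      deriv (DirichletCharacter.LFunction χ) 1 = - ∑ j, χ j * (f j : ℂ) := by
  have : NeZero q := ⟨(Fact.out : q.Prime).ne_zero⟩
  have hq : 1 ≤ q := (Fact.out : q.Prime).one_le
  have hG : ∀ j : ZMod q, ∃ x : ℝ, (j = 0 → x = 0) ∧ (j ≠ 0 → (HasSum (fun m : ℕ =>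
      1 / ((j.val : ℝ) + q * m) - 1 / ((q : ℝ) + q * m)) x ∧
        ∑' m, blockTerm q j.val m 1 = (x : ℂ))) := by
    intro j
    by_cases hj : j = 0
    · exact ⟨0, by simp, by simp [hj]⟩
    have hj1 : 1 ≤ j.val := Nat.one_le_iff_ne_zero.2 ((ZMod.val_ne_zero j).2 hj)
    have hs : Summable (fun m => blockTerm q j.val m 1) :=
      Summable.of_norm_bounded (summable_bound q)
        (fun m => blockTerm_bound hj1 (ZMod.val_lt j).le m one_mem_domU)
    have e : (fun m => blockTerm q j.val m 1) = fun m : ℕ =>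
      ((1 / ((j.val : ℝ) + q * m) - 1 / ((q : ℝ) + q * m) : ℝ) : ℂ) := by
      funext m
      simp only [blockTerm, Complex.cpow_neg_one]
      push_cast
      simp only [one_div]
    rw [e] at hs ⊢
    rw [Complex.summable_ofReal] at hs
    exact ⟨_, fun h => absurd h hj, fun _ => ⟨hs.hasSum, (Complex.ofReal_tsum _).symm⟩⟩
  have hF : ∀ j : ZMod q, ∃ x : ℝ, (j = 0 → x = 0) ∧ (j ≠ 0 → (HasSum (fun m : ℕ =>
      Real.log ((j.val : ℝ) + q * m) / ((j.val : ℝ) + q * m)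
        - Real.log ((q : ℝ) + q * m) / ((q : ℝ) + q * m)) x ∧
        HasDerivAt (fun s => ∑' m, blockTerm q j.val m s) (-(x : ℂ)) 1)) := by
    intro j
    by_cases hj : j = 0
    · exact ⟨0, by simp, by simp [hj]⟩
    have hj1 : 1 ≤ j.val := Nat.one_le_iff_ne_zero.2 ((ZMod.val_ne_zero j).2 hj)
    have hd : ∀ m, DifferentiableOn ℂ (blockTerm q j.val m) domU := fun m s _ =>
      (blockTerm_hasDerivAt hj1 hq m s).differentiableAt.differentiableWithinAt
    have hb : ∀ m, ∀ s ∈ domU, ‖blockTerm q j.val m s‖ ≤ _ :=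
      fun m s hs => blockTerm_bound hj1 (ZMod.val_lt j).le m hs
    have h1 := Complex.hasSum_deriv_of_summable_norm (summable_bound q) hd domU_open hb
      one_mem_domU
    have h2 := (Complex.differentiableOn_tsum_of_summable_norm (summable_bound q) hd domU_open
      hb).differentiableAt (domU_open.mem_nhds one_mem_domU)
    have e : (fun m => deriv (blockTerm q j.val m) 1) = fun m : ℕ =>
      -((Real.log ((j.val : ℝ) + q * m) / ((j.val : ℝ) + q * m)
        - Real.log ((q : ℝ) + q * m) / ((q : ℝ) + q * m) : ℝ) : ℂ) := by
      funext m
      rw [(blockTerm_hasDerivAt hj1 hq m 1).deriv, Complex.cpow_neg_one, Complex.cpow_neg_one,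
        ← Complex.natCast_log, ← Complex.natCast_log]
      push_cast
      ring
    rw [e] at h1
    have h3 := h1.neg
    simp only [neg_neg] at h3
    have hs := Complex.summable_ofReal.1 h3.summable
    refine ⟨_, fun h => absurd h hj, fun _ => ⟨hs.hasSum, ?_⟩⟩
    have h4 := h3.unique (Complex.hasSum_ofReal.2 hs.hasSum)
    rw [← h4, neg_neg]
    exact h2.hasDerivAt
  choose g hg0 hg using hG
  choose f hf0 hf using hF
  refine ⟨f, g, hf0 0 rfl, hg0 0 rfl, fun j hj => (hf j hj).1, fun j hj => (hg j hj).1, ?_⟩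
  intro χ hχ
  have hr := LFunction_repr hχ
  constructor
  · rw [hr one_mem_domU]
    refine Finset.sum_congr rfl fun j _ => ?_
    by_cases hj : j = 0
    · subst hj; rw [MulChar.map_zero, zero_mul, zero_mul]
    · rw [(hg j hj).2]
  · rw [(hr.eventuallyEq_of_mem (domU_open.mem_nhds one_mem_domU)).deriv_eq]
    have : HasDerivAt (fun s => ∑ j : ZMod q, χ j * ∑' m, blockTerm q j.val m s)
        (∑ j, χ j * (-(f j : ℂ))) 1 := by
      refine HasDerivAt.fun_sum fun j _ => ?_
      by_cases hj : j = 0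
      · subst hj
        simp only [MulChar.map_zero, zero_mul]
        exact hasDerivAt_const (1 : ℂ) (0 : ℂ)
      · exact (hf j hj).2.const_mul _
    rw [this.deriv]
    simp

lemma block_bounds {h : ℝ → ℝ} (hanti : AntitoneOn h (Set.Ici 3)) (hnn : ∀ x, 1 ≤ x → 0 ≤ h x)
    {q a : ℝ} (hq : 3 ≤ q) (ha : 1 ≤ a) (haq : a ≤ q) {U : ℝ}
    (hU : HasSum (fun m : ℕ => h (a + q * m) - h (q + q * m)) U) :
    h a - h q ≤ U ∧ U ≤ h a := by
  have hP : ∀ M : ℕ, h a - h q ≤ ∑ m ∈ Finset.range (M + 1), (h (a + q * m) - h (q + q * m)) ∧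
      ∑ m ∈ Finset.range (M + 1), (h (a + q * m) - h (q + q * m)) ≤ h a - h (q + q * M) := by
    intro M
    induction M with
    | zero => simp
    | succ M ih =>
      rw [Finset.sum_range_succ]
      have hM : (0 : ℝ) ≤ q * M := by positivity
      have e1 : h (q + q * (M + 1 : ℕ)) ≤ h (a + q * (M + 1 : ℕ)) := by
        apply hanti <;> (try simp only [Set.mem_Ici]) <;> push_cast <;> nlinarith
      have e2 : h (a + q * (M + 1 : ℕ)) ≤ h (q + q * M) := by
        apply hanti <;> (try simp only [Set.mem_Ici]) <;> push_cast <;> nlinarith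
      constructor <;> linarith [ih.1, ih.2]
  have ht := (tendsto_add_atTop_iff_nat 1).2 hU.tendsto_sum_nat
  constructor
  · exact ge_of_tendsto' ht fun M => (hP M).1
  · refine le_of_tendsto' ht fun M => (hP M).2.trans ?_
    have hM : (0 : ℝ) ≤ q * M := by positivity
    have := hnn (q + q * M) (by linarith)
    linarith

/-- The constant in the second moment bounds. -/
noncomputable def momC : ℝ := 16 * (∑' n : ℕ, (n : ℝ) ^ (-(3 / 2) : ℝ)) + 16

lemma momC_pos : 0 < momC := by
  have : 0 ≤ ∑' n : ℕ, (n : ℝ) ^ (-(3 / 2) : ℝ) := tsum_nonneg fun n => by positivity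
  unfold momC
  linarith

lemma sum_sq_le {h : ℝ → ℝ} (hanti : AntitoneOn h (Set.Ici 3)) (hnn : ∀ x, 1 ≤ x → 0 ≤ h x)
    (hb : ∀ x, 1 ≤ x → h x ^ 2 ≤ 16 * x ^ (-(3 / 2) : ℝ))
    {q : ℕ} [Fact q.Prime] (hq : 3 ≤ q) {f : ZMod q → ℝ} (hf0 : f 0 = 0)
    (hf : ∀ j : ZMod q, j ≠ 0 → HasSum (fun m : ℕ =>
      h ((j.val : ℝ) + q * m) - h ((q : ℝ) + q * m)) (f j)) :
    ∑ j, f j ^ 2 ≤ momC := by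
  have hqR : (3 : ℝ) ≤ q := by exact_mod_cast hq
  have h1 : ∀ j : ZMod q, f j ^ 2 ≤ 16 * (j.val : ℝ) ^ (-(3 / 2) : ℝ) +
      16 * (q : ℝ) ^ (-(3 / 2) : ℝ) := by
    intro j
    by_cases hj : j = 0
    · subst hj
      rw [hf0]
      have : 0 ≤ (((0 : ZMod q).val : ℕ) : ℝ) ^ (-(3 / 2) : ℝ) := by positivity
      have : 0 ≤ (q : ℝ) ^ (-(3 / 2) : ℝ) := by positivity
      linarith
    have hj1 : 1 ≤ j.val := Nat.one_le_iff_ne_zero.2 ((ZMod.val_ne_zero j).2 hj)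
    have hj1R : (1 : ℝ) ≤ j.val := by exact_mod_cast hj1
    have hjq : (j.val : ℝ) ≤ q := by exact_mod_cast (ZMod.val_lt j).le
    obtain ⟨l, u⟩ := block_bounds hanti hnn hqR hj1R hjq (hf j hj)
    have b1 := hb _ hj1R
    have b2 := hb q (by linarith)
    have n1 := hnn _ hj1R
    have n2 := hnn q (by linarith)
    have : f j ^ 2 ≤ h j.val ^ 2 + h q ^ 2 := by
      rcases le_total 0 (f j) with h0 | h0 <;> nlinarith
    linarith
  have hsm : Summable (fun n : ℕ => (n : ℝ) ^ (-(3 / 2) : ℝ)) :=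
    Real.summable_nat_rpow.2 (by norm_num)
  have h2 : ∑ j : ZMod q, (j.val : ℝ) ^ (-(3 / 2) : ℝ) ≤ ∑' n : ℕ, (n : ℝ) ^ (-(3 / 2) : ℝ) := by
    have := hsm.sum_le_tsum (Finset.univ.image (ZMod.val : ZMod q → ℕ))
      (fun n _ => by positivity)
    rwa [Finset.sum_image (fun x _ y _ hxy => ZMod.val_injective q hxy)] at this
  have h3 : (q : ℝ) * (q : ℝ) ^ (-(3 / 2) : ℝ) ≤ 1 := by
    have h0 : (0 : ℝ) < q := by linarith
    have : (q : ℝ) * (q : ℝ) ^ (-(3 / 2) : ℝ) = (q : ℝ) ^ (-(1 / 2) : ℝ) := by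
      rw [← Real.rpow_one_add' h0.le (by norm_num)]
      norm_num
    rw [this]
    exact Real.rpow_le_one_of_one_le_of_nonpos (by linarith) (by norm_num)
  calc ∑ j, f j ^ 2 ≤ ∑ j : ZMod q, (16 * (j.val : ℝ) ^ (-(3 / 2) : ℝ) +
      16 * (q : ℝ) ^ (-(3 / 2) : ℝ)) := Finset.sum_le_sum fun j _ => h1 j
    _ = 16 * ∑ j : ZMod q, (j.val : ℝ) ^ (-(3 / 2) : ℝ) +
      16 * ((q : ℝ) * (q : ℝ) ^ (-(3 / 2) : ℝ)) := by
        rw [Finset.sum_add_distrib, ← Finset.mul_sum]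
        simp [ZMod.card]
        ring
    _ ≤ momC := by unfold momC; linarith

lemma one_div_anti : AntitoneOn (fun x : ℝ => 1 / x) (Set.Ici 3) := by
  intro x hx y _ hxy
  simp only [Set.mem_Ici] at hx
  exact one_div_le_one_div_of_le (by linarith) hxy

lemma log_div_anti : AntitoneOn (fun x : ℝ => Real.log x / x) (Set.Ici 3) :=
  Real.log_div_self_antitoneOn.mono fun x hx => by
    simp only [Set.mem_Ici] at *
    linarith [Real.exp_one_lt_d9]

lemma log_div_bound (x : ℝ) (hx : 1 ≤ x) :
    (Real.log x / x) ^ 2 ≤ 16 * x ^ (-(3 / 2) : ℝ) := by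
  have h0 : 0 < x := by linarith
  have h1 := Real.log_le_rpow_div (x := x) (ε := 1 / 4) h0.le (by norm_num)
  have h2 := Real.log_nonneg hx
  have h3 : (x ^ (1 / 4 : ℝ)) ^ 2 = x ^ (-(3 / 2) : ℝ) * x ^ 2 := by
    rw [← Real.rpow_natCast (x ^ (1 / 4 : ℝ)), ← Real.rpow_mul h0.le, ← Real.rpow_natCast x 2,
      ← Real.rpow_add h0]
    norm_num
  rw [div_pow, div_le_iff₀ (by positivity), mul_assoc, ← h3]
  calc Real.log x ^ 2 ≤ (x ^ (1 / 4 : ℝ) / (1 / 4)) ^ 2 := by gcongr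
    _ = _ := by ring

lemma one_div_bound (x : ℝ) (hx : 1 ≤ x) :
    (1 / x) ^ 2 ≤ 16 * x ^ (-(3 / 2) : ℝ) := by
  have h0 : 0 < x := by linarith
  have : x ^ (-2 : ℝ) ≤ x ^ (-(3 / 2) : ℝ) :=
    Real.rpow_le_rpow_of_exponent_le hx (by norm_num)
  have e : (1 / x) ^ 2 = x ^ (-2 : ℝ) := by
    rw [Real.rpow_neg h0.le]
    norm_num
  rw [e]
  have : 0 ≤ x ^ (-(3 / 2) : ℝ) := by positivity
  linarith

lemma parseval {q : ℕ} [Fact q.Prime] {f : ZMod q → ℝ} (hf0 : f 0 = 0) :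
    ∑ χ : DirichletCharacter ℂ q, ‖∑ j, χ j * (f j : ℂ)‖ ^ 2 = ((q : ℝ) - 1) * ∑ j, f j ^ 2 := by
  have : NeZero q := ⟨(Fact.out : q.Prime).ne_zero⟩
  have ht : (q.totient : ℂ) = (q : ℂ) - 1 := by
    rw [Nat.totient_prime Fact.out, Nat.cast_sub (Fact.out : q.Prime).one_le, Nat.cast_one]
  have : ((∑ χ : DirichletCharacter ℂ q, ‖∑ j, χ j * (f j : ℂ)‖ ^ 2 : ℝ) : ℂ) =
      (((q : ℝ) - 1) * ∑ j, f j ^ 2 : ℝ) := by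
    push_cast
    have e : ∀ χ : DirichletCharacter ℂ q, ((‖∑ j, χ j * (f j : ℂ)‖ : ℝ) : ℂ) ^ 2 =
        ∑ a, ∑ b, ((f a : ℂ) * f b) * (χ a⁻¹ * χ b) := by
      intro χ
      rw [← Complex.conj_mul', map_sum, Finset.sum_mul_sum]
      refine Finset.sum_congr rfl fun a _ => Finset.sum_congr rfl fun b _ => ?_
      have : (starRingEnd ℂ) (χ a) = χ a⁻¹ := by
        have := MulChar.star_apply' χ a
        rw [MulChar.inv_apply'] at this
        exact this
      rw [map_mul, this, Complex.conj_ofReal]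
      ring
    simp_rw [e]
    rw [Finset.sum_comm, Finset.mul_sum]
    refine Finset.sum_congr rfl fun a _ => ?_
    rw [Finset.sum_comm]
    by_cases ha : a = 0
    · subst ha; simp [hf0]
    simp_rw [← Finset.mul_sum, DirichletCharacter.sum_char_inv_mul_char_eq ℂ (isUnit_iff_ne_zero.2 ha)]
    rw [ht]
    simp
    ring
  exact_mod_cast this

lemma first_moment {q : ℕ} [Fact q.Prime] {f : ZMod q → ℝ} {a : ZMod q} (ha : a ≠ 0) :
    ((q : ℝ) - 1) * f a ≤ ∑ χ : DirichletCharacter ℂ q, ‖∑ j, χ j * (f j : ℂ)‖ := by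
  have : NeZero q := ⟨(Fact.out : q.Prime).ne_zero⟩
  have ht : (q.totient : ℂ) = (q : ℂ) - 1 := by
    rw [Nat.totient_prime Fact.out, Nat.cast_sub (Fact.out : q.Prime).one_le, Nat.cast_one]
  have e : ∑ χ : DirichletCharacter ℂ q, χ a⁻¹ * ∑ j, χ j * (f j : ℂ) =
      (((q : ℝ) - 1) * f a : ℝ) := by
    simp_rw [Finset.mul_sum]
    rw [Finset.sum_comm]
    simp_rw [← mul_assoc, ← Finset.sum_mul,
      DirichletCharacter.sum_char_inv_mul_char_eq ℂ (isUnit_iff_ne_zero.2 ha)]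
    rw [ht]
    simp
  calc ((q : ℝ) - 1) * f a ≤ ‖((((q : ℝ) - 1) * f a : ℝ) : ℂ)‖ := by
        rw [Complex.norm_real]; exact le_abs_self _
    _ ≤ ∑ χ : DirichletCharacter ℂ q, ‖χ a⁻¹ * ∑ j, χ j * (f j : ℂ)‖ := by
        rw [← e]; exact norm_sum_le _ _
    _ ≤ _ := by
        refine Finset.sum_le_sum fun χ _ => ?_
        rw [norm_mul]
        exact mul_le_of_le_one_left (norm_nonneg _) (χ.norm_le_one _)

lemma card_char {q : ℕ} [Fact q.Prime] :
    (Fintype.card (DirichletCharacter ℂ q) : ℝ) = (q : ℝ) - 1 := by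
  have : NeZero q := ⟨(Fact.out : q.Prime).ne_zero⟩
  rw [← Nat.card_eq_fintype_card, DirichletCharacter.card_eq_totient_of_hasEnoughRootsOfUnity,
    Nat.totient_prime Fact.out, Nat.cast_sub (Fact.out : q.Prime).one_le, Nat.cast_one]

/-- Lower bound for the twisted first moment. -/
noncomputable def lowD : ℝ := Real.log 2 / 4

lemma lowD_pos : 0 < lowD := by
  have := Real.log_pos (one_lt_two)
  unfold lowD
  linarith

lemma many_good {q : ℕ} [Fact q.Prime] {f g : ZMod q → ℝ} (hf0 : f 0 = 0) (hg0 : g 0 = 0)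
    (hf : ∑ j, f j ^ 2 ≤ momC) (hg : ∑ j, g j ^ 2 ≤ momC) {b : ZMod q} (hb : b ≠ 0)
    (hfb : lowD ≤ f b) {G : Finset (DirichletCharacter ℂ q)}
    (hG : ∀ χ, χ ∉ G → ‖∑ j, χ j * (f j : ℂ)‖ ≤
      lowD / (2 * √momC) * ‖∑ j, χ j * (g j : ℂ)‖) :
    ((q : ℝ) - 1) * (lowD ^ 2 / (4 * momC)) ≤ G.card := by
  classical
  have hC := momC_pos
  have hD := lowD_pos
  have hsC : 0 < √momC := Real.sqrt_pos.2 hC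
  have hq1 : (0 : ℝ) < (q : ℝ) - 1 := by
    have : (1 : ℝ) < q := by exact_mod_cast (Fact.out : q.Prime).one_lt
    linarith
  set S : DirichletCharacter ℂ q → ℝ := fun χ => ‖∑ j, χ j * (f j : ℂ)‖ with hS
  set T : DirichletCharacter ℂ q → ℝ := fun χ => ‖∑ j, χ j * (g j : ℂ)‖ with hT
  have pS : ∑ χ, S χ ^ 2 ≤ ((q : ℝ) - 1) * momC := by
    rw [hS, parseval hf0]; gcongr
  have pT : ∑ χ, T χ ^ 2 ≤ ((q : ℝ) - 1) * momC := by
    rw [hT, parseval hg0]; gcongr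
  have m1 : ((q : ℝ) - 1) * lowD ≤ ∑ χ, S χ :=
    (mul_le_mul_of_nonneg_left hfb hq1.le).trans (first_moment hb)
  have tT : ∑ χ, T χ ≤ ((q : ℝ) - 1) * √momC := by
    refine le_of_sq_le_sq ?_ (by positivity)
    have := sq_sum_le_card_mul_sum_sq (s := (Finset.univ : Finset (DirichletCharacter ℂ q)))
      (f := T)
    rw [Finset.card_univ, card_char] at this
    calc _ ≤ _ := this
      _ ≤ ((q : ℝ) - 1) * (((q : ℝ) - 1) * momC) := by gcongr
      _ = _ := by rw [mul_pow, Real.sq_sqrt hC.le]; ring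
  have sG : (∑ χ ∈ G, S χ) ^ 2 ≤ G.card * (((q : ℝ) - 1) * momC) := by
    refine (sq_sum_le_card_mul_sum_sq (s := G) (f := S)).trans ?_
    gcongr
    exact (Finset.sum_le_sum_of_subset_of_nonneg (Finset.subset_univ G)
      (fun _ _ _ => by positivity)).trans pS
  have sGc : ∑ χ ∈ Gᶜ, S χ ≤ ((q : ℝ) - 1) * lowD / 2 := by
    calc ∑ χ ∈ Gᶜ, S χ ≤ ∑ χ ∈ Gᶜ, lowD / (2 * √momC) * T χ :=
          Finset.sum_le_sum fun χ h => hG χ (Finset.mem_compl.1 h)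
      _ ≤ ∑ χ, lowD / (2 * √momC) * T χ :=
          Finset.sum_le_sum_of_subset_of_nonneg (Finset.subset_univ _)
            (fun _ _ _ => by positivity)
      _ = lowD / (2 * √momC) * ∑ χ, T χ := by rw [Finset.mul_sum]
      _ ≤ lowD / (2 * √momC) * (((q : ℝ) - 1) * √momC) := by gcongr
      _ = _ := by field_simp
  have h5 : ((q : ℝ) - 1) * lowD / 2 ≤ ∑ χ ∈ G, S χ := by
    have := Finset.sum_add_sum_compl G S
    linarith
  have h6 : (((q : ℝ) - 1) * lowD / 2) ^ 2 ≤ G.card * (((q : ℝ) - 1) * momC) :=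
    (pow_le_pow_left₀ (by positivity) h5 2).trans sG
  rw [← mul_div_assoc, div_le_iff₀ (by positivity)]
  refine le_of_mul_le_mul_left ?_ hq1
  nlinarith

lemma prop_bound {q : ℕ} (hp : q.Prime) (hq : 16 ≤ q)
    (hbig : 2 ≤ (lowD ^ 2 / (4 * momC)) * q) :
    charProportion q (fun x => x ≤ lowD / (2 * √momC)) ≤ 1 - lowD ^ 2 / (4 * momC) / 2 := by
  classical
  have : Fact q.Prime := ⟨hp⟩
  have : NeZero q := ⟨hp.ne_zero⟩
  have hC := momC_pos
  have hD := lowD_pos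
  have hqR : (16 : ℝ) ≤ q := by exact_mod_cast hq
  obtain ⟨f, g, hf0, hg0, hf, hg, hL⟩ := exists_repr q
  have nn1 : ∀ x : ℝ, 1 ≤ x → 0 ≤ 1 / x := fun x hx => by positivity
  have nn2 : ∀ x : ℝ, 1 ≤ x → 0 ≤ Real.log x / x := fun x hx =>
    div_nonneg (Real.log_nonneg hx) (by linarith)
  have sf := sum_sq_le (h := fun x => Real.log x / x) log_div_anti nn2 log_div_bound
    (by omega : 3 ≤ q) hf0 hf
  have sg := sum_sq_le (h := fun x => 1 / x) one_div_anti nn1 one_div_bound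
    (by omega : 3 ≤ q) hg0 hg
  have v2 : ((2 : ℕ) : ZMod q).val = 2 := ZMod.val_natCast_of_lt (by omega)
  have hb : ((2 : ℕ) : ZMod q) ≠ 0 := by
    rw [← ZMod.val_ne_zero, v2]; norm_num
  have hfb : lowD ≤ f ((2 : ℕ) : ZMod q) := by
    have h1 := hf _ hb
    rw [v2] at h1
    have h2 := (block_bounds (h := fun x => Real.log x / x) log_div_anti nn2
      (q := q) (a := (2 : ℕ)) (by linarith) (by norm_num) (by push_cast; linarith) h1).1
    have h3 : Real.log q / q ≤ Real.log 16 / 16 :=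
      log_div_anti (a := 16) (b := q) (by norm_num [Set.mem_Ici])
        (by simp only [Set.mem_Ici]; linarith) hqR
    have h4 : Real.log 16 = 4 * Real.log 2 := by
      rw [show (16 : ℝ) = 2 ^ 4 by norm_num, Real.log_pow]; norm_num
    rw [h4] at h3
    simp only [Nat.cast_ofNat] at h2 ⊢
    unfold lowD
    linarith
  set B : Finset (DirichletCharacter ℂ q) := Finset.univ.filter fun χ =>
    ‖∑ j, χ j * (f j : ℂ)‖ ≤ lowD / (2 * √momC) * ‖∑ j, χ j * (g j : ℂ)‖ with hB
  have hgood := many_good hf0 hg0 sf sg hb hfb (G := Bᶜ) (fun χ hχ => by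
    have : χ ∈ B := by simpa using hχ
    exact (Finset.mem_filter.1 this).2)
  have hcard : (B.card : ℝ) + Bᶜ.card = (q : ℝ) - 1 := by
    rw [← card_char, ← Finset.card_add_card_compl B]
    push_cast
    ring
  have hsub : {χ : DirichletCharacter ℂ q | χ ≠ 1 ∧
      ‖logDeriv (DirichletCharacter.LFunction χ) 1‖ ≤ lowD / (2 * √momC)} ⊆ (B : Set _) := by
    rintro χ ⟨h1, h2⟩
    have hne := DirichletCharacter.LFunction_apply_one_ne_zero h1
    rw [logDeriv_apply, norm_div, div_le_iff₀ (norm_pos_iff.2 hne), (hL χ h1).1, (hL χ h1).2,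
      norm_neg] at h2
    simp only [hB, Finset.coe_filter, Finset.mem_univ, true_and]
    exact h2
  have hn : ({χ : DirichletCharacter ℂ q | χ ≠ 1 ∧
      ‖logDeriv (DirichletCharacter.LFunction χ) 1‖ ≤ lowD / (2 * √momC)}.ncard : ℝ) ≤ B.card := by
    have := Set.ncard_le_ncard hsub (Finset.finite_toSet _)
    rw [Set.ncard_coe_finset] at this
    exact_mod_cast this
  rw [charProportion, dif_pos hp.two_le, div_le_iff₀ (by linarith)]
  refine hn.trans ?_
  nlinarith

/-- There exist `a > 0` and `c > 0` such that the liminf over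
odd primes `q` of `(1/(q-2)) · #{χ ≠ χ₀ mod q : |L'/L(1,χ)| ≤ a}` is at most
`1 - c`. -/
theorem liminf_proportion_le :
    ∃ a : ℝ, 0 < a ∧ ∃ c : ℝ, 0 < c ∧
      liminf (fun q : ℕ => charProportion q (fun x => x ≤ a))
        (atTop ⊓ principal {q : ℕ | q.Prime ∧ Odd q}) ≤ 1 - c := by
  have hC := momC_pos
  have hD := lowD_pos
  have hk : 0 < lowD ^ 2 / (4 * momC) := by positivity
  refine ⟨lowD / (2 * √momC), by positivity, lowD ^ 2 / (4 * momC) / 2, by positivity, ?_⟩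
  have : NeBot (atTop ⊓ principal {q : ℕ | q.Prime ∧ Odd q}) := by
    rw [← frequently_mem_iff_neBot, frequently_atTop]
    intro n
    obtain ⟨p, hp, hpp⟩ := Nat.exists_infinite_primes (n + 3)
    exact ⟨p, by omega, hpp, hpp.odd_of_ne_two (by omega)⟩
  apply liminf_le_of_frequently_le
  · apply Eventually.frequently
    rw [eventually_inf_principal]
    obtain ⟨N, hN⟩ := exists_nat_gt (2 / (lowD ^ 2 / (4 * momC)))
    filter_upwards [eventually_ge_atTop (max 16 N)] with q hq hp
    refine prop_bound hp.1 ((le_max_left _ _).trans hq) ?_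
    rw [div_lt_iff₀' hk] at hN
    have : (N : ℝ) ≤ q := by exact_mod_cast (le_max_right _ _).trans hq
    exact hN.le.trans (by gcongr)
  · refine ⟨0, ?_⟩
    rw [eventually_map]
    refine Eventually.of_forall fun q => ?_
    simp only [ge_iff_le, charProportion]
    split_ifs with h
    · have : (2 : ℝ) ≤ q := by exact_mod_cast h
      exact div_nonneg (Nat.cast_nonneg _) (by linarith)
    · exact le_rfl
end

section
/- There exists a constant C > 0 such that for every real t ≥ 1, liminf over odd primes q of (1/(q−2)) · #{ χ mod q, χ ≠ χ₀ : |L'/L(1, χ)| ≥ t } is at most C · e^{−√t / 2}. -/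
open Filter

/-- Twist of a real arithmetic function by `χ(n)/n`. -/
noncomputable def twistFn {q : ℕ} (χ : DirichletCharacter ℂ q) (f : ArithmeticFunction ℝ) :
    ArithmeticFunction ℂ :=
  ⟨fun n => (f n : ℂ) * χ (n : ZMod q) / n, by simp⟩

lemma twistFn_apply {q : ℕ} (χ : DirichletCharacter ℂ q) (f : ArithmeticFunction ℝ) (n : ℕ) :
    twistFn χ f n = (f n : ℂ) * χ (n : ZMod q) / n := rfl

lemma twistFn_mul {q : ℕ} (χ : DirichletCharacter ℂ q) (f g : ArithmeticFunction ℝ) :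
    twistFn χ (f * g) = twistFn χ f * twistFn χ g := by
  ext n
  rw [twistFn_apply, ArithmeticFunction.mul_apply, ArithmeticFunction.mul_apply]
  push_cast
  rw [Finset.sum_mul, Finset.sum_div]
  refine Finset.sum_congr rfl fun x hx => ?_
  obtain ⟨h1, h2⟩ := Nat.mem_divisorsAntidiagonal.1 hx
  rw [twistFn_apply, twistFn_apply, ← h1]
  push_cast
  rw [map_mul]
  ring

/-- Dirichlet polynomial attached to `f`. -/
noncomputable def dpoly {q : ℕ} (χ : DirichletCharacter ℂ q) (f : ArithmeticFunction ℝ) : ℂ :=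
  LSeries (fun n => twistFn χ f n) 0

def SuppLe (f : ArithmeticFunction ℝ) (Y : ℕ) : Prop := ∀ n, Y < n → f n = 0

lemma SuppLe.mul {f g : ArithmeticFunction ℝ} {Y Z : ℕ} (hf : SuppLe f Y) (hg : SuppLe g Z) :
    SuppLe (f * g) (Y * Z) := by
  intro n hn
  rw [ArithmeticFunction.mul_apply]
  refine Finset.sum_eq_zero fun x hx => ?_
  obtain ⟨h1, h2⟩ := Nat.mem_divisorsAntidiagonal.1 hx
  by_cases h : x.1 ≤ Y
  · have : Z < x.2 := by
      by_contra h3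
      have := Nat.mul_le_mul h (not_lt.1 h3)
      omega
    rw [hg _ this, mul_zero]
  · rw [hf _ (not_le.1 h), zero_mul]

lemma suppLe_one : SuppLe 1 1 := by
  intro n hn
  exact ArithmeticFunction.one_apply_ne (by omega)

lemma SuppLe.mono {f : ArithmeticFunction ℝ} {Y Z : ℕ} (hf : SuppLe f Y) (h : Y ≤ Z) :
    SuppLe f Z := fun n hn => hf n (by omega)

lemma SuppLe.sub {f g : ArithmeticFunction ℝ} {Y : ℕ} (hf : SuppLe f Y) (hg : SuppLe g Y) :
    SuppLe (f - g) Y := by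
  intro n hn
  rw [sub_eq_add_neg, ArithmeticFunction.add_apply, hf n hn]
  have : (-g) n = - g n := rfl
  rw [this, hg n hn]; simp

lemma SuppLe.pow {f : ArithmeticFunction ℝ} {Y : ℕ} (hf : SuppLe f Y) (k : ℕ) :
    SuppLe (f ^ k) (Y ^ k) := by
  induction k with
  | zero => simpa using suppLe_one
  | succ k ih => rw [pow_succ, pow_succ]; exact ih.mul hf

lemma term_zero_eq {q : ℕ} (χ : DirichletCharacter ℂ q) (f : ArithmeticFunction ℝ) :
    LSeries.term (fun n => twistFn χ f n) 0 = fun n => twistFn χ f n := by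
  funext n
  rcases eq_or_ne n 0 with rfl | h
  · simp
  · simp [LSeries.term_of_ne_zero h]

lemma SuppLe.summable {q : ℕ} (χ : DirichletCharacter ℂ q) {f : ArithmeticFunction ℝ} {Y : ℕ}
    (hf : SuppLe f Y) : LSeriesSummable (fun n => twistFn χ f n) 0 := by
  rw [LSeriesSummable, term_zero_eq]
  refine summable_of_ne_finset_zero (s := Finset.Icc 1 Y) fun n hn => ?_
  rcases Nat.eq_zero_or_pos n with rfl | h
  · simp
  · rw [twistFn_apply, hf n (by simp at hn; omega)]; simp

lemma dpoly_eq {q : ℕ} (χ : DirichletCharacter ℂ q) {f : ArithmeticFunction ℝ} {Y : ℕ}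
    (hf : SuppLe f Y) :
    dpoly χ f = ∑ n ∈ Finset.Icc 1 Y, (f n : ℂ) * χ (n : ZMod q) / n := by
  rw [dpoly, LSeries, term_zero_eq]
  rw [tsum_eq_sum (s := Finset.Icc 1 Y)]
  · rfl
  · intro n hn
    rcases Nat.eq_zero_or_pos n with rfl | h
    · simp
    · rw [twistFn_apply, hf n (by simp at hn; omega)]; simp

lemma dpoly_mul {q : ℕ} (χ : DirichletCharacter ℂ q) {f g : ArithmeticFunction ℝ} {Y Z : ℕ}
    (hf : SuppLe f Y) (hg : SuppLe g Z) : dpoly χ (f * g) = dpoly χ f * dpoly χ g := by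
  rw [dpoly, twistFn_mul]
  exact ArithmeticFunction.LSeries_mul' (hf.summable χ) (hg.summable χ)

lemma dpoly_one {q : ℕ} (χ : DirichletCharacter ℂ q) : dpoly χ 1 = 1 := by
  rw [dpoly_eq χ suppLe_one]; simp

lemma dpoly_sub {q : ℕ} (χ : DirichletCharacter ℂ q) {f g : ArithmeticFunction ℝ} {Y : ℕ}
    (hf : SuppLe f Y) (hg : SuppLe g Y) : dpoly χ (f - g) = dpoly χ f - dpoly χ g := by
  rw [dpoly_eq χ hf, dpoly_eq χ hg, dpoly_eq χ (hf.sub hg), ← Finset.sum_sub_distrib]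
  refine Finset.sum_congr rfl fun n _ => ?_
  have : (f - g) n = f n - g n := by
    rw [sub_eq_add_neg, ArithmeticFunction.add_apply]; rfl
  rw [this]; push_cast; ring

lemma dpoly_pow {q : ℕ} (χ : DirichletCharacter ℂ q) {f : ArithmeticFunction ℝ} {Y : ℕ}
    (hf : SuppLe f Y) (k : ℕ) : dpoly χ (f ^ k) = dpoly χ f ^ k := by
  induction k with
  | zero => simp [dpoly_one]
  | succ k ih => rw [pow_succ, pow_succ, dpoly_mul χ (hf.pow k) hf, ih]

/-! Mean squares -/

lemma char_orth {q : ℕ} [NeZero q] (a b : ZMod q) :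
    ‖∑ χ : DirichletCharacter ℂ q, χ a * (starRingEnd ℂ) (χ b)‖ ≤
      if a = b then (q.totient : ℝ) else 0 := by
  by_cases hb : IsUnit b
  · have := DirichletCharacter.sum_char_inv_mul_char_eq ℂ hb a
    have h2 : ∑ χ : DirichletCharacter ℂ q, χ a * (starRingEnd ℂ) (χ b) =
        ∑ χ : DirichletCharacter ℂ q, χ b⁻¹ * χ a := by
      refine Finset.sum_congr rfl fun χ _ => ?_
      rw [mul_comm]
      congr 1
      rw [starRingEnd_apply, MulChar.star_apply', MulChar.inv_apply]
      congr 1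
      obtain ⟨u, rfl⟩ := hb
      rw [Ring.inverse_unit]
      simp
    rw [h2, this]
    by_cases h : a = b
    · simp [h]
    · simp [h, Ne.symm h]
  · have : ∑ χ : DirichletCharacter ℂ q, χ a * (starRingEnd ℂ) (χ b) = 0 := by
      refine Finset.sum_eq_zero fun χ _ => ?_
      rw [MulChar.map_nonunit χ hb]; simp
    rw [this, norm_zero]
    split_ifs <;> positivity

lemma meansq_exact {q : ℕ} [NeZero q] (f : ℕ → ℝ) (Y : ℕ) :
    ∑ χ : DirichletCharacter ℂ q, ‖∑ n ∈ Finset.Icc 1 Y, (f n : ℂ) * χ (n : ZMod q) / n‖ ^ 2 ≤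
      q.totient * ∑ n ∈ Finset.Icc 1 Y, ∑ m ∈ Finset.Icc 1 Y,
        if (n : ZMod q) = (m : ZMod q) then |f n| * |f m| / (n * m) else 0 := by
  have key : ((∑ χ : DirichletCharacter ℂ q,
      ‖∑ n ∈ Finset.Icc 1 Y, (f n : ℂ) * χ (n : ZMod q) / n‖ ^ 2 : ℝ) : ℂ) =
      ∑ n ∈ Finset.Icc 1 Y, ∑ m ∈ Finset.Icc 1 Y, (f n * f m / (n * m) : ℂ) *
        ∑ χ : DirichletCharacter ℂ q, χ (n : ZMod q) * (starRingEnd ℂ) (χ (m : ZMod q)) := by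
    push_cast
    simp_rw [← Complex.mul_conj', map_sum, Finset.sum_mul_sum, Finset.mul_sum]
    rw [Finset.sum_comm]
    refine Finset.sum_congr rfl fun n _ => ?_
    rw [Finset.sum_comm]
    refine Finset.sum_congr rfl fun m _ => Finset.sum_congr rfl fun χ _ => ?_
    simp only [map_mul, map_div₀, Complex.conj_ofReal, Complex.conj_natCast]
    ring
  have h0 : (∑ χ : DirichletCharacter ℂ q,
      ‖∑ n ∈ Finset.Icc 1 Y, (f n : ℂ) * χ (n : ZMod q) / n‖ ^ 2 : ℝ) = 
      ‖((∑ χ : DirichletCharacter ℂ q,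
      ‖∑ n ∈ Finset.Icc 1 Y, (f n : ℂ) * χ (n : ZMod q) / n‖ ^ 2 : ℝ) : ℂ)‖ := by
    rw [Complex.norm_real, Real.norm_of_nonneg]
    positivity
  rw [h0, key, Finset.mul_sum]
  refine (norm_sum_le _ _).trans (Finset.sum_le_sum fun n _ => ?_)
  rw [Finset.mul_sum]
  refine (norm_sum_le _ _).trans (Finset.sum_le_sum fun m _ => ?_)
  rw [norm_mul]
  refine (mul_le_mul_of_nonneg_left (char_orth _ _) (norm_nonneg _)).trans (le_of_eq ?_)
  split_ifs
  · simp; ring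
  · simp

lemma sum_congr_le {q : ℕ} (hq : 0 < q) (n Y : ℕ) :
    ∑ m ∈ (Finset.Icc 1 Y).filter (fun m => n < m ∧ (n : ZMod q) = (m : ZMod q)), (1 / (m : ℝ)) ≤
      (1 + Real.log Y) / q := by
  have hsub : (Finset.Icc 1 Y).filter (fun m => n < m ∧ (n : ZMod q) = (m : ZMod q)) ⊆
      (Finset.Icc 1 Y).image (fun j => n + q * j) := by
    intro m hm
    simp only [Finset.mem_filter, Finset.mem_Icc] at hm
    obtain ⟨⟨h1, h2⟩, h3, h4⟩ := hm
    rw [ZMod.natCast_eq_natCast_iff, Nat.modEq_iff_dvd' h3.le] at h4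
    obtain ⟨j, hj⟩ := h4
    have hj0 : j ≠ 0 := by rintro rfl; omega
    have : j ≤ q * j := Nat.le_mul_of_pos_left j hq
    exact Finset.mem_image.2 ⟨j, Finset.mem_Icc.2 ⟨by omega, by omega⟩, by omega⟩
  refine (Finset.sum_le_sum_of_subset_of_nonneg hsub fun _ _ _ => by positivity).trans ?_
  rw [Finset.sum_image]
  swap
  · intro a _ b _ h
    have : q * a = q * b := by simpa using h
    exact Nat.eq_of_mul_eq_mul_left hq this
  have hh := harmonic_le_one_add_log Y
  rw [harmonic_eq_sum_Icc] at hh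
  push_cast at hh
  calc _ ≤ ∑ j ∈ Finset.Icc 1 Y, ((j : ℝ)⁻¹) / q := by
        refine Finset.sum_le_sum fun j hj => ?_
        have hj1 : (0 : ℝ) < j := by exact_mod_cast (Finset.mem_Icc.1 hj).1
        have hq1 : (0 : ℝ) < q := by exact_mod_cast hq
        rw [inv_eq_one_div, div_div]
        push_cast
        apply one_div_le_one_div_of_le (by positivity)
        have : (0 : ℝ) ≤ n := by positivity
        nlinarith
    _ ≤ _ := by
        rw [← Finset.sum_div]
        gcongr

lemma meansq_le {q : ℕ} [NeZero q] (f : ℕ → ℝ) (Y : ℕ) (A : ℝ) (hA : ∀ n ∈ Finset.Icc 1 Y, |f n| ≤ A) :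
    ∑ χ : DirichletCharacter ℂ q, ‖∑ n ∈ Finset.Icc 1 Y, (f n : ℂ) * χ (n : ZMod q) / n‖ ^ 2 ≤
      q.totient * ((∑ n ∈ Finset.Icc 1 Y, f n ^ 2 / (n : ℝ) ^ 2) +
        2 * A ^ 2 * (1 + Real.log Y) ^ 2 / q) := by
  refine (meansq_exact f Y).trans ?_
  gcongr
  have hq : 0 < q := Nat.pos_of_ne_zero (NeZero.ne q)
  have hh := harmonic_le_one_add_log Y
  rw [harmonic_eq_sum_Icc] at hh
  push_cast at hh
  have hone : 0 ≤ 1 + Real.log Y := by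
    refine le_trans (Finset.sum_nonneg fun _ _ => by positivity) hh
  -- triangular sum
  have tri : ∑ n ∈ Finset.Icc 1 Y, ∑ m ∈ Finset.Icc 1 Y,
      (if n < m ∧ (n : ZMod q) = (m : ZMod q) then A ^ 2 / ((n : ℝ) * m) else 0) ≤
      A ^ 2 * (1 + Real.log Y) ^ 2 / q := by
    calc _ ≤ ∑ n ∈ Finset.Icc 1 Y, (n : ℝ)⁻¹ * (A ^ 2 * ((1 + Real.log Y) / q)) := by
          refine Finset.sum_le_sum fun n _ => ?_
          rw [← Finset.sum_filter]
          have := sum_congr_le hq n Y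
          calc _ = (n : ℝ)⁻¹ * (A ^ 2 * ∑ m ∈ (Finset.Icc 1 Y).filter (fun m => n < m ∧ (n : ZMod q) = (m : ZMod q)), (1 / (m : ℝ))) := by
                rw [Finset.mul_sum, Finset.mul_sum]
                refine Finset.sum_congr rfl fun m _ => ?_
                rw [div_mul_eq_div_div]; ring
            _ ≤ _ := by gcongr
      _ ≤ (1 + Real.log Y) * (A ^ 2 * ((1 + Real.log Y) / q)) := by
          rw [← Finset.sum_mul]
          gcongr
      _ = _ := by ring
  have tri2 : ∑ n ∈ Finset.Icc 1 Y, ∑ m ∈ Finset.Icc 1 Y,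
      (if m < n ∧ (n : ZMod q) = (m : ZMod q) then A ^ 2 / ((n : ℝ) * m) else 0) ≤
      A ^ 2 * (1 + Real.log Y) ^ 2 / q := by
    rw [Finset.sum_comm]
    refine le_trans (le_of_eq ?_) tri
    refine Finset.sum_congr rfl fun n _ => Finset.sum_congr rfl fun m _ => ?_
    rw [mul_comm (m : ℝ)]
    simp only [eq_comm (a := (m : ZMod q))]
  have diag : ∑ n ∈ Finset.Icc 1 Y, f n ^ 2 / (n : ℝ) ^ 2 = ∑ n ∈ Finset.Icc 1 Y, ∑ m ∈ Finset.Icc 1 Y,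
      if n = m then f n ^ 2 / (n : ℝ) ^ 2 else 0 := by
    refine Finset.sum_congr rfl fun n hn => ?_
    rw [Finset.sum_ite_eq, if_pos hn]
  calc _ ≤ (∑ n ∈ Finset.Icc 1 Y, f n ^ 2 / (n : ℝ) ^ 2) + (∑ n ∈ Finset.Icc 1 Y, ∑ m ∈ Finset.Icc 1 Y,
      (if n < m ∧ (n : ZMod q) = (m : ZMod q) then A ^ 2 / ((n : ℝ) * m) else 0) + ∑ n ∈ Finset.Icc 1 Y, ∑ m ∈ Finset.Icc 1 Y,
      (if m < n ∧ (n : ZMod q) = (m : ZMod q) then A ^ 2 / ((n : ℝ) * m) else 0)) := by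
        rw [diag, ← Finset.sum_add_distrib, ← Finset.sum_add_distrib]
        refine Finset.sum_le_sum fun n hn => ?_
        rw [← Finset.sum_add_distrib, ← Finset.sum_add_distrib]
        refine Finset.sum_le_sum fun m hm => ?_
        have h1 := hA n hn
        have h2 := hA m hm
        have h3 : |f n| * |f m| / (n * m) ≤ A ^ 2 / (n * m) := by
          rw [sq]
          gcongr
          exact (abs_nonneg _).trans h1
        by_cases hc : (n : ZMod q) = (m : ZMod q)
        · rcases lt_trichotomy n m with h | h | h
          · simp [hc, h, h.ne, h.not_gt, h3]
          · subst h
            simp [← sq]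
          · simp [hc, h, h.ne', h.not_gt, h3]
        · have : n ≠ m := fun h => hc (by rw [h])
          simp [hc, this]
    _ ≤ _ := by
        have : 2 * A ^ 2 * (1 + Real.log Y) ^ 2 / q = A ^ 2 * (1 + Real.log Y) ^ 2 / q + A ^ 2 * (1 + Real.log Y) ^ 2 / q := by ring
        rw [this]
        gcongr

/-! Truncation of `L(1,χ)` and `L'(1,χ)` -/

lemma charsum_period {q : ℕ} [NeZero q] {χ : DirichletCharacter ℂ q} (hχ : χ ≠ 1) (m : ℕ) :
    ∑ n ∈ Finset.range (m + q), χ (n : ZMod q) = ∑ n ∈ Finset.range m, χ (n : ZMod q) := by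
  rw [Finset.sum_range_add]
  have h : ∑ i ∈ Finset.range q, χ ((m + i : ℕ) : ZMod q) = ∑ a : ZMod q, χ ((m : ZMod q) + a) := by
    refine Finset.sum_bij' (fun i _ => (i : ZMod q)) (fun a _ => a.val) ?_ ?_ ?_ ?_ ?_
    · simp
    · intro a _; simpa using ZMod.val_lt a
    · intro i hi; exact ZMod.val_cast_of_lt (by simpa using hi)
    · intro a _; simp
    · intro i _; push_cast; rfl
  rw [h, Fintype.sum_equiv (Equiv.addLeft (m : ZMod q)) (fun a => χ ((m : ZMod q) + a)) (fun a => χ a)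
    (fun a => by simp), MulChar.sum_eq_zero_of_ne_one hχ, add_zero]

lemma charsum_le {q : ℕ} [NeZero q] {χ : DirichletCharacter ℂ q} (hχ : χ ≠ 1) (m : ℕ) :
    ‖∑ n ∈ Finset.range m, χ (n : ZMod q)‖ ≤ q := by
  induction m using Nat.strong_induction_on with
  | _ m ih =>
    by_cases h : m < q
    · refine (norm_sum_le _ _).trans ((Finset.sum_le_card_nsmul _ _ 1 fun n _ => χ.norm_le_one _).trans ?_)
      simp only [Finset.card_range, nsmul_eq_mul, mul_one]
      exact_mod_cast h.le
    · obtain ⟨k, rfl⟩ := Nat.exists_eq_add_of_le' (not_lt.1 h)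
      rw [charsum_period hχ]
      exact ih k (by have := NeZero.ne q; omega)

lemma abel_tail_s3 {q : ℕ} [NeZero q] {χ : DirichletCharacter ℂ q} (hχ : χ ≠ 1) (g : ℕ → ℝ) (X : ℕ)
    (hg : ∀ n, X ≤ n → g (n + 1) ≤ g n) (hg0 : ∀ n, 0 ≤ g n) (Y : ℕ) (hY : X ≤ Y) :
    ‖∑ n ∈ Finset.Ico X Y, (g n : ℂ) * χ (n : ZMod q)
      - g Y * ∑ n ∈ Finset.range Y, χ (n : ZMod q)‖ ≤ q * (2 * g X - g Y) := by
  induction Y, hY using Nat.le_induction with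
  | base =>
    simp only [Finset.Ico_self, Finset.sum_empty, zero_sub, norm_neg, norm_mul, Complex.norm_real,
      Real.norm_of_nonneg (hg0 X)]
    have := mul_le_mul_of_nonneg_left (charsum_le hχ X) (hg0 X)
    linarith
  | succ Y hY ih =>
    have e : ∑ n ∈ Finset.Ico X (Y + 1), (g n : ℂ) * χ (n : ZMod q)
        - g (Y + 1) * ∑ n ∈ Finset.range (Y + 1), χ (n : ZMod q) =
        (∑ n ∈ Finset.Ico X Y, (g n : ℂ) * χ (n : ZMod q)
        - g Y * ∑ n ∈ Finset.range Y, χ (n : ZMod q)) +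
        ((g Y - g (Y + 1) : ℝ) : ℂ) * ∑ n ∈ Finset.range (Y + 1), χ (n : ZMod q) := by
      rw [Finset.sum_Ico_succ_top hY, Finset.sum_range_succ]
      push_cast
      ring
    rw [e]
    refine (norm_add_le _ _).trans ?_
    have h1 : 0 ≤ g Y - g (Y + 1) := by linarith [hg Y hY]
    rw [norm_mul, Complex.norm_real, Real.norm_of_nonneg h1]
    have := mul_le_mul_of_nonneg_left (charsum_le hχ (Y + 1)) h1
    nlinarith

lemma hasSum_tail {q : ℕ} [NeZero q] {χ : DirichletCharacter ℂ q} (hχ : χ ≠ 1) (g : ℕ → ℝ) (X : ℕ)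
    (hg : ∀ n, X ≤ n → g (n + 1) ≤ g n) (hg0 : ∀ n, 0 ≤ g n) {S : ℂ}
    (hS : HasSum (fun n : ℕ => (g n : ℂ) * χ (n : ZMod q)) S) :
    ‖S - ∑ n ∈ Finset.range X, (g n : ℂ) * χ (n : ZMod q)‖ ≤ 2 * q * g X := by
  have h1 := hS.tendsto_sum_nat
  have h2 := (h1.sub_const (∑ n ∈ Finset.range X, (g n : ℂ) * χ (n : ZMod q))).norm
  refine le_of_tendsto h2 ?_
  filter_upwards [eventually_ge_atTop X] with Y hY
  rw [← Finset.sum_Ico_eq_sub _ hY]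
  have h3 := abel_tail_s3 hχ g X hg hg0 Y hY
  have h4 : ‖(g Y : ℂ) * ∑ n ∈ Finset.range Y, χ (n : ZMod q)‖ ≤ g Y * q := by
    rw [norm_mul, Complex.norm_real, Real.norm_of_nonneg (hg0 Y)]
    exact mul_le_mul_of_nonneg_left (charsum_le hχ Y) (hg0 Y)
  have h5 := norm_le_norm_sub_add (∑ n ∈ Finset.Ico X Y, (g n : ℂ) * χ (n : ZMod q))
    (g Y * ∑ n ∈ Finset.range Y, χ (n : ZMod q))
  linarith

lemma Lfun_tail {q : ℕ} [NeZero q] {χ : DirichletCharacter ℂ q} (hχ : χ ≠ 1) (X : ℕ) (hX : 1 ≤ X) :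
    ‖DirichletCharacter.LFunction χ 1 - ∑ n ∈ Finset.range X, (((n : ℝ) ^ (-(1 : ℝ)) : ℝ) : ℂ) * χ (n : ZMod q)‖
      ≤ 2 * q * (X : ℝ) ^ (-(1 : ℝ)) := by
  have hXR : (1 : ℝ) ≤ X := by exact_mod_cast hX
  have hc : Continuous (fun s : ℝ => DirichletCharacter.LFunction χ s) :=
    (DirichletCharacter.differentiable_LFunction hχ).continuous.comp Complex.continuous_ofReal
  have h1 : Tendsto (fun s : ℝ => DirichletCharacter.LFunction χ s) (nhdsWithin 1 (Set.Ioi 1))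
      (nhds (DirichletCharacter.LFunction χ 1)) := by
    have := (hc.tendsto 1).mono_left (nhdsWithin_le_nhds (s := Set.Ioi 1))
    simpa using this
  have h2 : Tendsto (fun s : ℝ => ∑ n ∈ Finset.range X, (((n : ℝ) ^ (-s) : ℝ) : ℂ) * χ (n : ZMod q))
      (nhdsWithin 1 (Set.Ioi 1))
      (nhds (∑ n ∈ Finset.range X, (((n : ℝ) ^ (-(1 : ℝ)) : ℝ) : ℂ) * χ (n : ZMod q))) := by
    refine tendsto_finsetSum _ fun n _ => ?_
    refine Tendsto.mul_const _ ?_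
    refine (Complex.continuous_ofReal.tendsto _).comp ?_
    refine Tendsto.mono_left ?_ (nhdsWithin_le_nhds (s := Set.Ioi (1 : ℝ)))
    rcases Nat.eq_zero_or_pos n with rfl | hn
    · rw [Nat.cast_zero, Real.zero_rpow (by norm_num)]
      refine tendsto_const_nhds.congr' ?_
      filter_upwards [eventually_ne_nhds (one_ne_zero (α := ℝ))] with s hs
      rw [Real.zero_rpow (by simpa using hs)]
    · exact (Real.continuousAt_const_rpow (by positivity)).tendsto.comp (tendsto_neg 1)
  refine le_of_tendsto (h1.sub h2).norm ?_
  filter_upwards [self_mem_nhdsWithin] with s hs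
  have hs1 : (1 : ℝ) < s := hs
  have hs2 : 1 < (s : ℂ).re := by simpa using hs1
  have hsum := (DirichletCharacter.LSeriesSummable_of_one_lt_re χ hs2).hasSum
  have hS : HasSum (fun n : ℕ => (((n : ℝ) ^ (-s) : ℝ) : ℂ) * χ (n : ZMod q))
      (DirichletCharacter.LFunction χ s) := by
    rw [DirichletCharacter.LFunction_eq_LSeries χ hs2]
    refine hsum.congr_fun ?_ |> id
    intro n
    rcases Nat.eq_zero_or_pos n with rfl | hn
    · rw [Nat.cast_zero, Real.zero_rpow (by linarith)]; simp
    · rw [LSeries.term_of_ne_zero hn.ne', Complex.ofReal_cpow (by positivity)]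
      push_cast
      rw [Complex.cpow_neg]
      ring
  have h3 := hasSum_tail hχ (fun n : ℕ => (n : ℝ) ^ (-s)) X (fun n hn => ?_)
    (fun n => by positivity) hS
  · refine h3.trans ?_
    gcongr
  · have : (0 : ℝ) < n := by exact_mod_cast (by omega : 0 < n)
    exact Real.rpow_le_rpow_of_nonpos this (by push_cast; linarith) (by linarith)

lemma Lderiv_tail_s3 {q : ℕ} [NeZero q] {χ : DirichletCharacter ℂ q} (hχ : χ ≠ 1) (X : ℕ) (hX : 3 ≤ X) :
    ‖deriv (DirichletCharacter.LFunction χ) 1 +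
      ∑ n ∈ Finset.range X, ((Real.log n * (n : ℝ) ^ (-(1 : ℝ)) : ℝ) : ℂ) * χ (n : ZMod q)‖
      ≤ 2 * q * (Real.log X * (X : ℝ) ^ (-(1 : ℝ))) := by
  have hXR : (3 : ℝ) ≤ X := by exact_mod_cast hX
  have hd := DirichletCharacter.differentiable_LFunction hχ
  have hc : Continuous (fun s : ℝ => deriv (DirichletCharacter.LFunction χ) s) :=
    (hd.contDiff.continuous_deriv (n := 1) le_rfl).comp Complex.continuous_ofReal
  have h1 : Tendsto (fun s : ℝ => deriv (DirichletCharacter.LFunction χ) s) (nhdsWithin 1 (Set.Ioi 1))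
      (nhds (deriv (DirichletCharacter.LFunction χ) 1)) := by
    have := (hc.tendsto 1).mono_left (nhdsWithin_le_nhds (s := Set.Ioi 1))
    simpa using this
  have h2 : Tendsto (fun s : ℝ => ∑ n ∈ Finset.range X, ((Real.log n * (n : ℝ) ^ (-s) : ℝ) : ℂ) * χ (n : ZMod q))
      (nhdsWithin 1 (Set.Ioi 1))
      (nhds (∑ n ∈ Finset.range X, ((Real.log n * (n : ℝ) ^ (-(1 : ℝ)) : ℝ) : ℂ) * χ (n : ZMod q))) := by
    refine tendsto_finsetSum _ fun n _ => ?_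
    refine Tendsto.mul_const _ ?_
    refine (Complex.continuous_ofReal.tendsto _).comp ?_
    refine Tendsto.const_mul _ ?_
    refine Tendsto.mono_left ?_ (nhdsWithin_le_nhds (s := Set.Ioi (1 : ℝ)))
    rcases Nat.eq_zero_or_pos n with rfl | hn
    · rw [Nat.cast_zero, Real.zero_rpow (by norm_num)]
      refine tendsto_const_nhds.congr' ?_
      filter_upwards [eventually_ne_nhds (one_ne_zero (α := ℝ))] with s hs
      rw [Real.zero_rpow (by simpa using hs)]
    · exact (Real.continuousAt_const_rpow (by positivity)).tendsto.comp (tendsto_neg 1)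
  refine le_of_tendsto (h1.add h2).norm ?_
  filter_upwards [self_mem_nhdsWithin] with s hs
  have hs1 : (1 : ℝ) < s := hs
  have hs2 : 1 < (s : ℂ).re := by simpa using hs1
  have hab : LSeries.abscissaOfAbsConv (fun n : ℕ => χ (n : ZMod q)) < ((s : ℂ).re : EReal) := by
    rw [DirichletCharacter.absicssaOfAbsConv_eq_one (NeZero.ne q)]
    exact_mod_cast hs2
  have hder : deriv (DirichletCharacter.LFunction χ) s =
      -LSeries (LSeries.logMul (fun n : ℕ => χ (n : ZMod q))) s := by
    rw [← LSeries_deriv hab]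
    refine Filter.EventuallyEq.deriv_eq ?_
    have : {z : ℂ | 1 < z.re} ∈ nhds (s : ℂ) :=
      (isOpen_lt continuous_const Complex.continuous_re).mem_nhds hs2
    filter_upwards [this] with z hz
    exact DirichletCharacter.LFunction_eq_LSeries χ hz
  have hsum := (LSeriesSummable_logMul_of_lt_re hab).hasSum
  have hS : HasSum (fun n : ℕ => ((Real.log n * (n : ℝ) ^ (-s) : ℝ) : ℂ) * χ (n : ZMod q))
      (LSeries (LSeries.logMul (fun n : ℕ => χ (n : ZMod q))) s) := by
    refine hsum.congr_fun ?_ |> id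
    intro n
    rcases Nat.eq_zero_or_pos n with rfl | hn
    · rw [Nat.cast_zero, Real.zero_rpow (by linarith)]; simp
    · rw [LSeries.term_of_ne_zero hn.ne', Complex.ofReal_mul, Complex.ofReal_cpow (by positivity)]
      push_cast
      rw [Complex.cpow_neg, LSeries.logMul]
      ring
  have hn0 : ∀ n : ℕ, 0 ≤ Real.log n * (n : ℝ) ^ (-s) := fun n =>
    mul_nonneg (Real.log_natCast_nonneg n) (by positivity)
  have h3 := hasSum_tail hχ (fun n : ℕ => Real.log n * (n : ℝ) ^ (-s)) X (fun n hn => ?_) hn0 hS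
  · rw [hder, neg_add_eq_sub, norm_sub_rev]
    refine h3.trans ?_
    have : 0 ≤ Real.log X := Real.log_natCast_nonneg X
    gcongr
    · linarith
  · have hn3 : (3 : ℝ) ≤ n := by exact_mod_cast hX.trans hn
    have hanti := Real.log_div_self_rpow_antitoneOn (a := s) (by linarith)
    have he : Real.exp s⁻¹ ≤ n := by
      have : s⁻¹ ≤ 1 := inv_le_one_of_one_le₀ hs1.le
      have := Real.exp_le_exp.2 this
      linarith [Real.exp_one_lt_d9]
    have := hanti (show (n : ℝ) ∈ Set.Ici (Real.exp s⁻¹) from he)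
      (show ((n + 1 : ℕ) : ℝ) ∈ Set.Ici (Real.exp s⁻¹) by
        simp only [Set.mem_Ici]; push_cast; linarith) (by push_cast; linarith)
    simp only at this ⊢
    rw [Real.rpow_neg (by positivity), Real.rpow_neg (by positivity), ← div_eq_mul_inv, ← div_eq_mul_inv]
    exact this

/-! Coefficients -/

open ArithmeticFunction in
/-- Truncation of an arithmetic function. -/
noncomputable def truncFn (N : ℕ) (f : ArithmeticFunction ℝ) : ArithmeticFunction ℝ :=
  ⟨fun n => if n ≤ N then f n else 0, by simp⟩

lemma truncFn_apply (N : ℕ) (f : ArithmeticFunction ℝ) (n : ℕ) :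
    truncFn N f n = if n ≤ N then f n else 0 := rfl

lemma truncFn_supp (N : ℕ) (f : ArithmeticFunction ℝ) : SuppLe (truncFn N f) N := by
  intro n hn; rw [truncFn_apply, if_neg (by omega)]

lemma truncFn_mul_eq (f g : ArithmeticFunction ℝ) {N X n : ℕ} (hN : n ≤ N) (hX : n ≤ X) :
    (truncFn N f * truncFn X g) n = (f * g) n := by
  rw [ArithmeticFunction.mul_apply, ArithmeticFunction.mul_apply]
  refine Finset.sum_congr rfl fun x hx => ?_
  have h1 := Nat.divisor_le (Nat.fst_mem_divisors_of_mem_antidiagonal hx)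
  have h2 := Nat.divisor_le (Nat.snd_mem_divisors_of_mem_antidiagonal hx)
  rw [truncFn_apply, truncFn_apply, if_pos (by omega), if_pos (by omega)]

/-- the function `ζ` with real values. -/
noncomputable def zR : ArithmeticFunction ℝ := ((ArithmeticFunction.zeta : ArithmeticFunction ℕ) : ArithmeticFunction ℝ)
/-- the Möbius function with real values. -/
noncomputable def muR : ArithmeticFunction ℝ := ((ArithmeticFunction.moebius : ArithmeticFunction ℤ) : ArithmeticFunction ℝ)

lemma zR_apply {n : ℕ} (hn : n ≠ 0) : zR n = 1 := by
  simp [zR, hn]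

lemma truncZ_bd (X n : ℕ) : 0 ≤ truncFn X zR n ∧ truncFn X zR n ≤ 1 := by
  rw [truncFn_apply]
  rcases eq_or_ne n 0 with rfl | h
  · simp
  · split_ifs <;> simp [zR_apply h]

lemma truncM_bd (N n : ℕ) : |truncFn N muR n| ≤ 1 := by
  rw [truncFn_apply]
  split_ifs
  · have := ArithmeticFunction.abs_moebius_le_one (n := n)
    simp only [muR, ArithmeticFunction.intCoe_apply]
    exact_mod_cast this
  · simp

lemma truncV_bd (N n : ℕ) : 0 ≤ truncFn N ArithmeticFunction.vonMangoldt n ∧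
    truncFn N ArithmeticFunction.vonMangoldt n ≤ ArithmeticFunction.vonMangoldt n := by
  rw [truncFn_apply]
  have := ArithmeticFunction.vonMangoldt_nonneg (n := n)
  split_ifs <;> simp [this]

lemma sum_fst_vM (n : ℕ) : ∑ x ∈ n.divisorsAntidiagonal, ArithmeticFunction.vonMangoldt x.1 = Real.log n := by
  rw [Nat.sum_divisorsAntidiagonal (f := fun a _ => ArithmeticFunction.vonMangoldt a)]
  exact ArithmeticFunction.vonMangoldt_sum

lemma sum_snd_vM (n : ℕ) : ∑ x ∈ n.divisorsAntidiagonal, ArithmeticFunction.vonMangoldt x.2 = Real.log n := by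
  rw [Nat.sum_divisorsAntidiagonal' (f := fun _ a => ArithmeticFunction.vonMangoldt a)]
  exact ArithmeticFunction.vonMangoldt_sum

lemma sub_apply' (f g : ArithmeticFunction ℝ) (n : ℕ) : (f - g) n = f n - g n := by
  rw [sub_eq_add_neg, ArithmeticFunction.add_apply]; rfl

/-- coefficients of `L' + P L`. -/
noncomputable def bFn (N X : ℕ) : ArithmeticFunction ℝ :=
  truncFn N ArithmeticFunction.vonMangoldt * truncFn X zR - truncFn X ArithmeticFunction.log

/-- coefficients of `L M - 1`. -/
noncomputable def cFn (N X : ℕ) : ArithmeticFunction ℝ :=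
  truncFn N muR * truncFn X zR - 1

lemma bFn_zero {N X n : ℕ} (hN : n ≤ N) (hX : n ≤ X) : bFn N X n = 0 := by
  rw [bFn, sub_apply', truncFn_mul_eq _ _ hN hX, truncFn_apply, if_pos hX, zR,
    ArithmeticFunction.vonMangoldt_mul_zeta, sub_self]

lemma cFn_zero {N X n : ℕ} (hN : n ≤ N) (hX : n ≤ X) : cFn N X n = 0 := by
  rw [cFn, sub_apply', truncFn_mul_eq _ _ hN hX, zR, muR,
    ArithmeticFunction.coe_moebius_mul_coe_zeta, sub_self]

lemma bFn_le (N X n : ℕ) : |bFn N X n| ≤ Real.log n := by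
  have h1 : 0 ≤ (truncFn N ArithmeticFunction.vonMangoldt * truncFn X zR) n := by
    rw [ArithmeticFunction.mul_apply]
    exact Finset.sum_nonneg fun x _ => mul_nonneg (truncV_bd N _).1 (truncZ_bd X _).1
  have h2 : (truncFn N ArithmeticFunction.vonMangoldt * truncFn X zR) n ≤ Real.log n := by
    rw [ArithmeticFunction.mul_apply, ← sum_fst_vM]
    refine Finset.sum_le_sum fun x _ => ?_
    have a := truncV_bd N x.1
    have b := truncZ_bd X x.2
    nlinarith
  have h3 : 0 ≤ truncFn X ArithmeticFunction.log n ∧ truncFn X ArithmeticFunction.log n ≤ Real.log n := by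
    rw [truncFn_apply]
    have := Real.log_natCast_nonneg n
    split_ifs <;> simp [ArithmeticFunction.log_apply, this]
  rw [bFn, sub_apply', abs_le]
  constructor <;> linarith [h3.1, h3.2]

lemma cFn_eq {N X n : ℕ} (hN : 1 ≤ N) (hn : N < n) : cFn N X n = (truncFn N muR * truncFn X zR) n := by
  rw [cFn, sub_apply', ArithmeticFunction.one_apply_ne (by omega), sub_zero]

lemma cFn_le_card {N X n : ℕ} (hN : 1 ≤ N) (hX : N ≤ X) : |cFn N X n| ≤ n.divisors.card := by
  by_cases h : n ≤ N
  · rw [cFn_zero h (by omega)]; simp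
  · rw [cFn_eq hN (by omega), ArithmeticFunction.mul_apply]
    refine (Finset.abs_sum_le_sum_abs _ _).trans ?_
    refine (Finset.sum_le_card_nsmul _ _ 1 fun x _ => ?_).trans ?_
    · rw [abs_mul, abs_of_nonneg (truncZ_bd X _).1]
      exact mul_le_one₀ (truncM_bd N _) (truncZ_bd X _).1 (truncZ_bd X _).2
    · rw [← Nat.map_div_right_divisors]; simp

lemma cFn_le_N {N X n : ℕ} (hN : 1 ≤ N) (hX : N ≤ X) : |cFn N X n| ≤ N := by
  by_cases h : n ≤ N
  · rw [cFn_zero h (by omega)]; simp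
  · rw [cFn_eq hN (by omega), ArithmeticFunction.mul_apply]
    refine (Finset.abs_sum_le_sum_abs _ _).trans ?_
    calc _ ≤ ∑ x ∈ n.divisorsAntidiagonal, (if x.1 ≤ N then (1 : ℝ) else 0) := by
          refine Finset.sum_le_sum fun x _ => ?_
          rw [abs_mul, abs_of_nonneg (truncZ_bd X _).1]
          split_ifs with h1
          · exact mul_le_one₀ (truncM_bd N _) (truncZ_bd X _).1 (truncZ_bd X _).2
          · rw [truncFn_supp N _ _ (by omega)]; simp
      _ = ∑ d ∈ n.divisors, (if d ≤ N then (1 : ℝ) else 0) :=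
          Nat.sum_divisorsAntidiagonal (f := fun d _ => if d ≤ N then (1 : ℝ) else 0)
      _ = ((n.divisors.filter (fun d => d ≤ N)).card : ℝ) := by
          rw [Finset.sum_boole]
      _ ≤ _ := by
          have : (n.divisors.filter (fun d => d ≤ N)).card ≤ (Finset.Icc 1 N).card := by
            refine Finset.card_le_card fun d hd => ?_
            rw [Finset.mem_filter] at hd
            exact Finset.mem_Icc.2 ⟨Nat.pos_of_mem_divisors hd.1, hd.2⟩
          rw [Nat.card_Icc] at this
          exact_mod_cast (by simpa using this)

lemma vPow_bd (N k n : ℕ) : 0 ≤ (truncFn N ArithmeticFunction.vonMangoldt ^ k) n ∧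
    (truncFn N ArithmeticFunction.vonMangoldt ^ k) n ≤ Real.log n ^ k := by
  induction k generalizing n with
  | zero =>
    rw [pow_zero, pow_zero, ArithmeticFunction.one_apply]
    split_ifs <;> simp
  | succ k ih =>
    rw [pow_succ, ArithmeticFunction.mul_apply]
    constructor
    · exact Finset.sum_nonneg fun x _ => mul_nonneg (ih _).1 (truncV_bd N _).1
    · calc _ ≤ ∑ x ∈ n.divisorsAntidiagonal, Real.log n ^ k * ArithmeticFunction.vonMangoldt x.2 := by
            refine Finset.sum_le_sum fun x hx => ?_
            have h1 := Nat.divisor_le (Nat.fst_mem_divisors_of_mem_antidiagonal hx)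
            have h0 := Nat.pos_of_mem_divisors (Nat.fst_mem_divisors_of_mem_antidiagonal hx)
            have h0' : (0 : ℝ) < x.1 := by exact_mod_cast h0
            have h2 : Real.log x.1 ≤ Real.log n := Real.log_le_log h0' (by exact_mod_cast h1)
            have h3 : (truncFn N ArithmeticFunction.vonMangoldt ^ k) x.1 ≤ Real.log n ^ k :=
              (ih _).2.trans (pow_le_pow_left₀ (Real.log_natCast_nonneg _) h2 k)
            exact mul_le_mul h3 (truncV_bd N _).2 (truncV_bd N _).1
              (pow_nonneg (Real.log_natCast_nonneg _) k)
        _ = _ := by rw [← Finset.mul_sum, sum_snd_vM, pow_succ]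

/-! Numerical series -/

/-- `ζ(3/2)`. -/
noncomputable def zThree : ℝ := ∑' n : ℕ, (n : ℝ) ^ (-(3 / 2) : ℝ)

lemma summable_three : Summable (fun n : ℕ => (n : ℝ) ^ (-(3 / 2) : ℝ)) :=
  Real.summable_nat_rpow.2 (by norm_num)

lemma zThree_ge : 1 ≤ zThree := by
  have := summable_three.le_tsum 1 (fun n _ => by positivity)
  simpa [zThree] using this

lemma log_pow_le (k n : ℕ) (hn : 1 ≤ n) : (Real.log n ^ k) ^ 2 / (n : ℝ) ^ 2 ≤
    4 ^ k * (2 * k).factorial * (n : ℝ) ^ (-(3 / 2) : ℝ) := by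
  have hn0 : (0 : ℝ) < n := by exact_mod_cast hn
  have h1 := Real.pow_div_factorial_le_exp (Real.log n / 2) (by have := Real.log_natCast_nonneg n; positivity) (2 * k)
  have h2 : Real.exp (Real.log n / 2) = (n : ℝ) ^ (1 / 2 : ℝ) := by
    rw [Real.rpow_def_of_pos hn0]; congr 1; ring
  rw [h2, div_le_iff₀ (by positivity)] at h1
  have h3 : (n : ℝ) ^ (-(3 / 2) : ℝ) = (n : ℝ) ^ (1 / 2 : ℝ) / (n : ℝ) ^ 2 := by
    rw [← Real.rpow_natCast, ← Real.rpow_sub hn0]; norm_num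
  rw [h3, ← mul_div_assoc]
  gcongr
  have h4 : (Real.log n ^ k) ^ 2 = 4 ^ k * (Real.log n / 2) ^ (2 * k) := by
    rw [pow_mul, ← mul_pow, ← pow_mul, mul_comm k 2, pow_mul]
    congr 1; ring
  rw [h4]
  calc _ ≤ (4 : ℝ) ^ k * ((n : ℝ) ^ (1 / 2 : ℝ) * (2 * k).factorial) := by gcongr
    _ = _ := by ring

lemma sum_three_le (s : Finset ℕ) : ∑ n ∈ s, (n : ℝ) ^ (-(3 / 2) : ℝ) ≤ zThree :=
  summable_three.sum_le_tsum s (fun n _ => by positivity)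

lemma summable_div : Summable (fun n : ℕ => (n.divisors.card : ℝ) ^ 2 / (n : ℝ) ^ 2) := by
  have hz : LSeriesSummable (fun n => ((ArithmeticFunction.zeta : ArithmeticFunction ℕ) : ArithmeticFunction ℂ) n) 2 := by
    have := ArithmeticFunction.LSeriesSummable_zeta_iff (s := 2) |>.2 (by norm_num)
    simpa using this
  set z : ArithmeticFunction ℂ := ((ArithmeticFunction.zeta : ArithmeticFunction ℕ) : ArithmeticFunction ℂ) with hzdef
  have h2 := ArithmeticFunction.LSeriesSummable_mul hz hz
  have h4 := ArithmeticFunction.LSeriesSummable_mul h2 h2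
  have hd : ∀ n, (z * z) n = (n.divisors.card : ℂ) := by
    intro n
    rw [hzdef, ArithmeticFunction.coe_mul_zeta_apply]
    rw [Finset.sum_congr rfl (g := fun _ => (1 : ℂ))]
    · simp
    · intro i hi
      simp [(Nat.pos_of_mem_divisors hi).ne']
  have hn := h4.norm
  refine Summable.of_nonneg_of_le (fun n => by positivity) (fun n => ?_) hn
  rcases eq_or_ne n 0 with rfl | h0
  · simp
  rw [LSeries.term_of_ne_zero h0, norm_div]
  have e1 : ‖(n : ℂ) ^ (2 : ℂ)‖ = (n : ℝ) ^ 2 := by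
    have : (n : ℂ) ^ (2 : ℂ) = (n : ℂ) ^ 2 := by
      exact_mod_cast Complex.cpow_natCast (n : ℂ) 2
    rw [this]; simp
  rw [e1]
  gcongr
  rw [ArithmeticFunction.mul_apply]
  have e2 : ∑ x ∈ n.divisorsAntidiagonal, (z * z) x.1 * (z * z) x.2 =
      ((∑ x ∈ n.divisorsAntidiagonal, x.1.divisors.card * x.2.divisors.card : ℕ) : ℂ) := by
    push_cast
    exact Finset.sum_congr rfl fun x _ => by rw [hd, hd]
  rw [e2, Complex.norm_natCast]
  have e3 : n.divisors.card ^ 2 ≤ ∑ x ∈ n.divisorsAntidiagonal, x.1.divisors.card * x.2.divisors.card := by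
    have : n.divisors.card ^ 2 = ∑ x ∈ n.divisorsAntidiagonal, n.divisors.card := by
      rw [Finset.sum_const, smul_eq_mul, sq, ← Nat.map_div_right_divisors, Finset.card_map]
    rw [this]
    refine Finset.sum_le_sum fun x hx => ?_
    have := (Nat.mem_divisorsAntidiagonal.1 hx).1
    rw [← this, Nat.divisors_mul]
    exact Finset.card_mul_le
  exact_mod_cast e3

lemma small_tail {h : ℕ → ℝ} (hs : Summable h) {ε : ℝ} (hε : 0 < ε) :
    ∃ N0 : ℕ, ∀ N ≥ N0, ∀ (f : ℕ → ℝ) (Y : ℕ), (∀ n ≤ N, f n = 0) →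
      (∀ n, 1 ≤ n → f n ^ 2 / (n : ℝ) ^ 2 ≤ h n) →
      ∑ n ∈ Finset.Icc 1 Y, f n ^ 2 / (n : ℝ) ^ 2 ≤ ε := by
  obtain ⟨s, hs⟩ := summable_iff_vanishing_norm.1 hs ε hε
  obtain ⟨N0, hN0⟩ := s.exists_nat_subset_range
  refine ⟨N0, fun N hN f Y h0 hle => ?_⟩
  have h1 : ∑ n ∈ Finset.Icc 1 Y, f n ^ 2 / (n : ℝ) ^ 2 ≤ ∑ n ∈ (Finset.Icc 1 Y).filter (fun n => N < n), h n := by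
    rw [Finset.sum_filter]
    refine Finset.sum_le_sum fun n hn => ?_
    split_ifs with hc
    · exact hle n (Finset.mem_Icc.1 hn).1
    · rw [h0 n (by omega)]; simp
  refine h1.trans ((le_abs_self _).trans (hs _ ?_).le)
  rw [Finset.disjoint_left]
  intro n hn hns
  have := Finset.mem_range.1 (hN0 hns)
  have := (Finset.mem_filter.1 hn).2
  omega

/-! Assembling -/

/-- the off-diagonal error. -/
noncomputable def offErr (q : ℕ) : ℝ := 512 * Real.log q ^ 4 / q

lemma offErr_tendsto : Tendsto offErr atTop (nhds 0) := by
  have h := (Real.isLittleO_pow_log_id_atTop (n := 4)).tendsto_div_nhds_zero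
  have h2 := (h.const_mul 512).comp tendsto_natCast_atTop_atTop
  simp only [mul_zero] at h2
  refine h2.congr fun q => ?_
  simp [offErr, mul_div_assoc]

lemma one_le_log {q : ℕ} (hq : 3 ≤ q) : 1 ≤ Real.log q := by
  have hq' : (3 : ℝ) ≤ q := by exact_mod_cast hq
  rw [Real.le_log_iff_exp_le (by linarith)]
  linarith [Real.exp_one_lt_d9]

lemma meansq_unif {q : ℕ} [NeZero q] (hq : 3 ≤ q) {f : ArithmeticFunction ℝ} (hf : SuppLe f (q ^ 3))
    (hA : ∀ n ∈ Finset.Icc 1 (q ^ 3), |f n| ≤ 4 * Real.log q) {S : ℝ}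
    (hS : ∑ n ∈ Finset.Icc 1 (q ^ 3), f n ^ 2 / (n : ℝ) ^ 2 ≤ S) :
    ∑ χ : DirichletCharacter ℂ q, ‖dpoly χ f‖ ^ 2 ≤ q * (S + offErr q) := by
  have h1 := meansq_le (q := q) f (q ^ 3) _ hA
  simp_rw [dpoly_eq _ hf]
  have hl := one_le_log hq
  have hq0 : (0 : ℝ) < q := by exact_mod_cast (by omega : 0 < q)
  have h2 : 2 * (4 * Real.log q) ^ 2 * (1 + Real.log ((q ^ 3 : ℕ) : ℝ)) ^ 2 / q ≤ offErr q := by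
    rw [offErr]
    refine div_le_div_of_nonneg_right ?_ hq0.le
    push_cast
    rw [Real.log_pow]
    push_cast
    calc 2 * (4 * Real.log q) ^ 2 * (1 + 3 * Real.log q) ^ 2
        ≤ 2 * (4 * Real.log q) ^ 2 * (4 * Real.log q) ^ 2 := by gcongr; linarith
      _ = _ := by ring
  refine h1.trans ?_
  have h3 : (q.totient : ℝ) ≤ q := by exact_mod_cast Nat.totient_le q
  have h4 : 0 ≤ S + offErr q := by
    have : 0 ≤ offErr q := by rw [offErr]; positivity
    have : 0 ≤ S := le_trans (Finset.sum_nonneg fun _ _ => by positivity) hS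
    positivity
  refine mul_le_mul h3 (add_le_add hS h2) ?_ hq0.le
  have : 0 ≤ ∑ n ∈ Finset.Icc 1 (q ^ 3), f n ^ 2 / (n : ℝ) ^ 2 := Finset.sum_nonneg fun _ _ => by positivity
  positivity

open Classical in
lemma cheb {q : ℕ} [NeZero q] (f : DirichletCharacter ℂ q → ℝ) {l E : ℝ} (hl : 0 < l)
    (hE : ∑ χ : DirichletCharacter ℂ q, f χ ^ 2 ≤ E) :
    ((Finset.univ.filter (fun χ => l ≤ f χ)).card : ℝ) ≤ E / l ^ 2 := by
  rw [le_div_iff₀ (by positivity)]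
  refine le_trans ?_ hE
  calc _ = ∑ χ ∈ Finset.univ.filter (fun χ => l ≤ f χ), l ^ 2 := by simp
    _ ≤ ∑ χ ∈ Finset.univ.filter (fun χ => l ≤ f χ), f χ ^ 2 := by
        refine Finset.sum_le_sum fun χ h => ?_
        have := (Finset.mem_filter.1 h).2
        gcongr
    _ ≤ _ := Finset.sum_le_sum_of_subset_of_nonneg (Finset.subset_univ _) fun _ _ _ => by positivity

lemma dpoly_trunc {q : ℕ} (χ : DirichletCharacter ℂ q) (f : ArithmeticFunction ℝ) (X : ℕ) :
    dpoly χ (truncFn X f) =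
      ∑ n ∈ Finset.range (X + 1), ((f n * (n : ℝ) ^ (-(1 : ℝ)) : ℝ) : ℂ) * χ (n : ZMod q) := by
  rw [dpoly_eq χ (truncFn_supp X f)]
  have : Finset.range (X + 1) = insert 0 (Finset.Icc 1 X) := by
    ext n; simp; omega
  rw [this, Finset.sum_insert (by simp)]
  simp only [Nat.cast_zero, ArithmeticFunction.map_zero, zero_mul, Complex.ofReal_zero, zero_add]
  refine Finset.sum_congr rfl fun n hn => ?_
  rw [truncFn_apply, if_pos (Finset.mem_Icc.1 hn).2, Real.rpow_neg_one]
  push_cast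
  ring

lemma L_approx {q : ℕ} [NeZero q] (hq : 3 ≤ q) {χ : DirichletCharacter ℂ q} (hχ : χ ≠ 1) :
    ‖DirichletCharacter.LFunction χ 1 - dpoly χ (truncFn (q ^ 2) zR)‖ ≤ 6 * Real.log q / q := by
  have h := Lfun_tail hχ (q ^ 2 + 1) (by omega)
  have e : dpoly χ (truncFn (q ^ 2) zR) = ∑ n ∈ Finset.range (q ^ 2 + 1),
      (((n : ℝ) ^ (-(1 : ℝ)) : ℝ) : ℂ) * χ (n : ZMod q) := by
    rw [dpoly_trunc]
    refine Finset.sum_congr rfl fun n _ => ?_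
    rcases eq_or_ne n 0 with rfl | h0
    · simp [Real.zero_rpow]
    · rw [zR_apply h0, one_mul]
  rw [e]
  refine h.trans ?_
  have hl := one_le_log hq
  have hq0 : (0 : ℝ) < q := by exact_mod_cast (by omega : 0 < q)
  rw [Real.rpow_neg_one]
  push_cast
  rw [← div_eq_mul_inv, div_le_div_iff₀ (by positivity) hq0]
  nlinarith [sq_nonneg (q : ℝ)]

lemma L'_approx {q : ℕ} [NeZero q] (hq : 3 ≤ q) {χ : DirichletCharacter ℂ q} (hχ : χ ≠ 1) :
    ‖deriv (DirichletCharacter.LFunction χ) 1 + dpoly χ (truncFn (q ^ 2) ArithmeticFunction.log)‖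
      ≤ 6 * Real.log q / q := by
  have hq2 : 3 ≤ q ^ 2 + 1 := by nlinarith
  have h := Lderiv_tail_s3 hχ (q ^ 2 + 1) hq2
  rw [dpoly_trunc]
  simp only [ArithmeticFunction.log_apply]
  refine h.trans ?_
  have hl := one_le_log hq
  have hq0 : (0 : ℝ) < q := by exact_mod_cast (by omega : 0 < q)
  have hlog : Real.log ((q ^ 2 + 1 : ℕ) : ℝ) ≤ 3 * Real.log q := by
    have : Real.log ((q : ℝ) ^ 3) = 3 * Real.log q := by rw [Real.log_pow]; norm_num
    rw [← this]
    refine Real.log_le_log (by positivity) ?_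
    have : q ^ 2 + 1 ≤ q ^ 3 := by nlinarith
    exact_mod_cast this
  rw [Real.rpow_neg_one]
  calc _ ≤ 2 * (q : ℝ) * (3 * Real.log q * ((q ^ 2 + 1 : ℕ) : ℝ)⁻¹) := by gcongr
    _ = 6 * q * Real.log q / (q ^ 2 + 1) := by push_cast; ring
    _ ≤ _ := by
      rw [div_le_div_iff₀ (by positivity) hq0]
      nlinarith

/-- Deterministic part: a large value of `L'/L` forces one of four events. -/
lemma four_events {q : ℕ} [NeZero q] (hq : 3 ≤ q) {χ : DirichletCharacter ℂ q} (hχ : χ ≠ 1)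
    {t K : ℝ} {N : ℕ} (ht : 2 ≤ t) (hK : 0 < K) (hN : 1 ≤ N)
    (he : 6 * Real.log q / q * (1 + t / 2) ≤ 1 / (8 * K))
    (hP : ‖dpoly χ (truncFn N ArithmeticFunction.vonMangoldt)‖ < t / 2)
    (hB : ‖dpoly χ (bFn N (q ^ 2))‖ < 1 / (8 * K))
    (hC : ‖dpoly χ (cFn N (q ^ 2))‖ < 1 / 2)
    (hM : ‖dpoly χ (truncFn N muR)‖ < K) :
    ‖logDeriv (DirichletCharacter.LFunction χ) 1‖ < t := by
  set L := DirichletCharacter.LFunction χ 1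
  set L' := deriv (DirichletCharacter.LFunction χ) 1 with hL'
  have h1 := L_approx hq hχ
  have h2 := L'_approx hq hχ
  have hX1 : 1 ≤ N * q ^ 2 := Nat.mul_pos (by omega) (by positivity)
  have eB : dpoly χ (bFn N (q ^ 2)) = dpoly χ (truncFn N ArithmeticFunction.vonMangoldt) *
      dpoly χ (truncFn (q ^ 2) zR) - dpoly χ (truncFn (q ^ 2) ArithmeticFunction.log) := by
    rw [bFn, dpoly_sub χ ((truncFn_supp N _).mul (truncFn_supp (q ^ 2) _))
      ((truncFn_supp (q ^ 2) _).mono (Nat.le_mul_of_pos_left _ (by omega))),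
      dpoly_mul χ (truncFn_supp N _) (truncFn_supp (q ^ 2) _)]
  have eC : dpoly χ (cFn N (q ^ 2)) = dpoly χ (truncFn N muR) *
      dpoly χ (truncFn (q ^ 2) zR) - 1 := by
    rw [cFn, dpoly_sub χ ((truncFn_supp N _).mul (truncFn_supp (q ^ 2) _))
      (suppLe_one.mono hX1), dpoly_one,
      dpoly_mul χ (truncFn_supp N _) (truncFn_supp (q ^ 2) _)]
  rw [eB] at hB
  rw [eC] at hC
  generalize dpoly χ (truncFn N ArithmeticFunction.vonMangoldt) = P at *
  generalize dpoly χ (truncFn (q ^ 2) zR) = LX at *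
  generalize dpoly χ (truncFn (q ^ 2) ArithmeticFunction.log) = LX' at *
  generalize dpoly χ (truncFn N muR) = M at *
  set e := 6 * Real.log q / q with hedef
  have he0 : 0 ≤ e := (norm_nonneg _).trans h1
  have hee : e ≤ 1 / (8 * K) := by nlinarith
  -- lower bound for LX
  have h3 : 1 / 2 < ‖M * LX‖ := by
    have : ‖(1 : ℂ)‖ ≤ ‖M * LX - 1‖ + ‖M * LX‖ := by
      have := norm_sub_le (M * LX) (M * LX - 1)
      simp only [sub_sub_cancel] at this
      linarith
    rw [norm_one] at this
    linarith
  have h4 : 1 / (2 * K) < ‖LX‖ := by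
    rw [norm_mul] at h3
    rw [div_lt_iff₀ (by positivity)]
    have := mul_le_mul_of_nonneg_right hM.le (norm_nonneg LX)
    linarith
  have h5 : 1 / (4 * K) < ‖L‖ := by
    have : ‖LX‖ ≤ ‖L - LX‖ + ‖L‖ := by
      rw [norm_sub_rev]
      have := norm_add_le (LX - L) L
      simpa using this
    have a1 : 1 / (2 * K) = 4 * (1 / (8 * K)) := by field_simp; norm_num
    have a2 : 1 / (4 * K) = 2 * (1 / (8 * K)) := by field_simp; norm_num
    have a3 : 0 < 1 / (8 * K) := by positivity
    linarith
  have h6 : ‖L'‖ ≤ ‖P‖ * ‖L‖ + (‖P * LX - LX'‖ + e + ‖P‖ * e) := by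
    have : L' = (L' + LX') + (P * LX - LX') + P * (L - LX) - P * L := by ring
    have b1 : ‖P * (L - LX)‖ ≤ ‖P‖ * e := by
      rw [norm_mul]; exact mul_le_mul_of_nonneg_left h1 (norm_nonneg _)
    have b2 := norm_sub_le ((L' + LX') + (P * LX - LX') + P * (L - LX)) (P * L)
    have b3 := norm_add₃_le (a := L' + LX') (b := P * LX - LX') (c := P * (L - LX))
    rw [← this] at b2
    rw [norm_mul P L] at b2
    linarith
  have hLpos : 0 < ‖L‖ := lt_trans (by positivity) h5
  have h7 : ‖L'‖ < t * ‖L‖ := by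
    have a2 : 1 / (4 * K) = 2 * (1 / (8 * K)) := by field_simp; norm_num
    have c1 : ‖P‖ * e ≤ t / 2 * e := mul_le_mul_of_nonneg_right hP.le he0
    have c2 : ‖P‖ * ‖L‖ ≤ t / 2 * ‖L‖ := mul_le_mul_of_nonneg_right hP.le hLpos.le
    have c3 : 1 * ‖L‖ ≤ t / 2 * ‖L‖ := mul_le_mul_of_nonneg_right (by linarith) hLpos.le
    nlinarith
  rw [logDeriv_apply, norm_div, div_lt_iff₀ hLpos]
  exact h7

lemma exp_choice {t : ℝ} (ht : 2 ≤ t) : ∃ k : ℕ,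
    4 ^ k * ((2 * k).factorial : ℝ) / (((t / 2) ^ k) ^ 2) ≤ Real.exp 3 * Real.exp (-Real.sqrt t / 2) := by
  refine ⟨⌊t / 24⌋₊, ?_⟩
  set k := ⌊t / 24⌋₊
  have hk1 : (k : ℝ) ≤ t / 24 := Nat.floor_le (by positivity)
  have hk2 : t / 24 < k + 1 := Nat.lt_floor_add_one _
  have hf : ((2 * k).factorial : ℝ) ≤ (2 * k : ℝ) ^ (2 * k) := by
    exact_mod_cast Nat.factorial_le_pow (2 * k)
  have ht0 : 0 < t := by linarith
  calc _ ≤ 4 ^ k * (2 * k : ℝ) ^ (2 * k) / (((t / 2) ^ k) ^ 2) := by gcongr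
    _ = (8 * k / t) ^ (2 * k) := by
        rw [pow_mul (2 * (k : ℝ)), pow_mul (8 * k / t), ← pow_mul (t / 2) k 2, mul_comm k 2,
          pow_mul (t / 2) 2 k, ← mul_pow, ← div_pow]
        congr 1
        field_simp
        ring
    _ ≤ (Real.exp (-1)) ^ (2 * k) := by
        gcongr
        rw [div_le_iff₀ ht0]
        have h3 : (1 : ℝ) / 3 ≤ Real.exp (-1) := by
          rw [Real.exp_neg, ← one_div]
          exact one_div_le_one_div_of_le (Real.exp_pos _) (by linarith [Real.exp_one_lt_d9])
        nlinarith
    _ = Real.exp (-(2 * k)) := by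
        rw [← Real.exp_nat_mul]; congr 1; push_cast; ring
    _ ≤ _ := by
        rw [← Real.exp_add]
        apply Real.exp_le_exp.2
        have := Real.sq_sqrt ht0.le
        nlinarith [sq_nonneg (Real.sqrt t - 3)]

open Classical in
lemma count_bound (t : ℝ) (ht : 2 ≤ t) : ∀ᶠ q : ℕ in atTop, ∀ [NeZero q],
    ((Finset.univ.filter (fun χ : DirichletCharacter ℂ q => χ ≠ 1 ∧
      t ≤ ‖logDeriv (DirichletCharacter.LFunction χ) 1‖)).card : ℝ) ≤
      q * ((Real.exp 3 * zThree + 7) * Real.exp (-Real.sqrt t / 2)) := by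
  set ε := Real.exp (-Real.sqrt t / 2) with hεdef
  have hε : 0 < ε := Real.exp_pos _
  have hZ := zThree_ge
  obtain ⟨k, hk⟩ := exp_choice ht
  set K := Real.sqrt (zThree / ε) with hKdef
  have hK : 0 < K := Real.sqrt_pos.2 (by positivity)
  have hK2 : zThree / K ^ 2 = ε := by
    rw [hKdef, Real.sq_sqrt (by positivity)]
    field_simp
  set δ := 1 / (8 * K) with hδdef
  have hδ : 0 < δ := by positivity
  have hs1 : Summable (fun n : ℕ => 4 ^ 1 * ((2 * 1).factorial : ℝ) * (n : ℝ) ^ (-(3 / 2) : ℝ)) :=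
    summable_three.mul_left _
  obtain ⟨N1, hN1⟩ := small_tail hs1 (ε := ε * δ ^ 2) (by positivity)
  obtain ⟨N2, hN2⟩ := small_tail summable_div (ε := ε / 4) (by positivity)
  set N := max (max N1 N2) 1 with hNdef
  have hNN1 : N1 ≤ N := by omega
  have hNN2 : N2 ≤ N := by omega
  have hN1' : 1 ≤ N := by omega
  have hlogt : Tendsto (fun q : ℕ => Real.log q) atTop atTop :=
    Real.tendsto_log_atTop.comp tendsto_natCast_atTop_atTop
  have herr : Tendsto (fun q : ℕ => 6 * Real.log q / q * (1 + t / 2)) atTop (nhds 0) := by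
    have h := (Real.isLittleO_pow_log_id_atTop (n := 1)).tendsto_div_nhds_zero
    have h2 := ((h.const_mul 6).mul_const (1 + t / 2)).comp tendsto_natCast_atTop_atTop
    simp only [mul_zero, zero_mul] at h2
    refine h2.congr fun q => ?_
    simp [mul_div_assoc]
  set η := min (min (ε * δ ^ 2) (ε / 4)) (min ε 1) with hη
  have hη0 : 0 < η := by positivity
  filter_upwards [eventually_ge_atTop 3, eventually_ge_atTop N, eventually_ge_atTop (N ^ k),
    hlogt.eventually_ge_atTop (N : ℝ), hlogt.eventually_ge_atTop (Real.log ((N ^ k : ℕ) : ℝ) ^ k),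
    herr.eventually_le_const hδ, offErr_tendsto.eventually_le_const hη0]
    with q hq hqN hqNk hlN hlV he hoff
  intro _
  have hl := one_le_log hq
  have hq0 : (0 : ℝ) < q := by exact_mod_cast (by omega : 0 < q)
  have hqq2 : q ≤ q ^ 2 := by nlinarith
  have hqq3 : q ≤ q ^ 3 := by nlinarith
  have o1 : offErr q ≤ ε * δ ^ 2 := hoff.trans ((min_le_left _ _).trans (min_le_left _ _))
  have o2 : offErr q ≤ ε / 4 := hoff.trans ((min_le_left _ _).trans (min_le_right _ _))
  have o3 : offErr q ≤ ε := hoff.trans ((min_le_right _ _).trans (min_le_left _ _))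
  have o4 : offErr q ≤ 1 := hoff.trans ((min_le_right _ _).trans (min_le_right _ _))
  -- event A
  have mA := meansq_unif hq (f := truncFn N ArithmeticFunction.vonMangoldt ^ k)
    (S := 4 ^ k * (2 * k).factorial * zThree)
    (((truncFn_supp N _).pow k).mono (hqNk.trans hqq3)) (by
      intro n hn
      rw [abs_of_nonneg (vPow_bd N k n).1]
      by_cases h : n ≤ N ^ k
      · have hn0 : (0 : ℝ) < n := by exact_mod_cast (Finset.mem_Icc.1 hn).1
        have h1 : Real.log n ≤ Real.log ((N ^ k : ℕ) : ℝ) := Real.log_le_log hn0 (by exact_mod_cast h)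
        have h2 := pow_le_pow_left₀ (Real.log_natCast_nonneg n) h1 k
        linarith [(vPow_bd N k n).2]
      · rw [(truncFn_supp N _).pow k n (by omega)]; positivity)
    (by
      refine le_trans (Finset.sum_le_sum (g := fun n : ℕ => 4 ^ k * ((2 * k).factorial : ℝ) * (n : ℝ) ^ (-(3 / 2) : ℝ)) fun n hn => ?_) ?_
      · refine le_trans ?_ (log_pow_le k n (Finset.mem_Icc.1 hn).1)
        have := vPow_bd N k n
        gcongr
        · exact this.1
        · exact this.2
      · rw [← Finset.mul_sum]
        gcongr
        exact sum_three_le _)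
  -- event B
  have mB := meansq_unif hq (f := bFn N (q ^ 2)) (S := ε * δ ^ 2)
    (((((truncFn_supp N _).mul (truncFn_supp (q ^ 2) _)).sub
      ((truncFn_supp (q ^ 2) _).mono (Nat.le_mul_of_pos_left _ (by omega))))).mono (by
        rw [pow_succ' q 2]; gcongr)) (by
      intro n hn
      refine (bFn_le _ _ _).trans ?_
      have hn0 : (0 : ℝ) < n := by exact_mod_cast (Finset.mem_Icc.1 hn).1
      have h1 : Real.log n ≤ Real.log ((q : ℝ) ^ 3) :=
        Real.log_le_log hn0 (by exact_mod_cast (Finset.mem_Icc.1 hn).2)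
      rw [Real.log_pow] at h1
      push_cast at h1
      linarith)
    (hN1 N hNN1 _ _ (fun n hn => bFn_zero hn (by omega)) (fun n hn => by
      refine le_trans ?_ (log_pow_le 1 n hn)
      rw [pow_one, ← sq_abs]
      have := bFn_le N (q ^ 2) n
      gcongr))
  -- event C
  have mC := meansq_unif hq (f := cFn N (q ^ 2)) (S := ε / 4)
    ((((truncFn_supp N _).mul (truncFn_supp (q ^ 2) _)).sub
      (suppLe_one.mono (Nat.mul_pos (by omega) (by positivity)))).mono (by
        rw [pow_succ' q 2]; gcongr)) (by
      intro n hn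
      refine (cFn_le_N hN1' (by omega)).trans ?_
      linarith)
    (hN2 N hNN2 _ _ (fun n hn => cFn_zero hn (by omega)) (fun n hn => by
      rw [← sq_abs]
      have := cFn_le_card (n := n) hN1' (show N ≤ q ^ 2 by omega)
      gcongr))
  -- event D
  have mD := meansq_unif hq (f := truncFn N muR) (S := zThree)
    ((truncFn_supp N _).mono (by omega)) (by
      intro n hn
      refine (truncM_bd N n).trans (by linarith))
    (by
      refine le_trans (Finset.sum_le_sum fun n hn => ?_) (sum_three_le (Finset.Icc 1 (q ^ 3)))
      have h1 := log_pow_le 0 n (Finset.mem_Icc.1 hn).1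
      simp only [pow_zero, one_pow, mul_zero, Nat.factorial_zero, Nat.cast_one, mul_one, one_mul] at h1
      refine le_trans ?_ h1
      have := truncM_bd N n
      rw [← sq_abs]
      gcongr
      exact pow_le_one₀ (abs_nonneg _) this)
  have ht2 : 1 ≤ t / 2 := by linarith
  have cA := cheb _ (l := (t / 2) ^ k) (by positivity) mA
  have cB := cheb _ hδ mB
  have cC := cheb _ (l := 1 / 2) (by norm_num) mC
  have cD := cheb _ hK mD
  -- union bound
  have hsub : (Finset.univ.filter (fun χ : DirichletCharacter ℂ q => χ ≠ 1 ∧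
      t ≤ ‖logDeriv (DirichletCharacter.LFunction χ) 1‖)) ⊆
      ((Finset.univ.filter (fun χ : DirichletCharacter ℂ q =>
        (t / 2) ^ k ≤ ‖dpoly χ (truncFn N ArithmeticFunction.vonMangoldt ^ k)‖)) ∪
      (Finset.univ.filter (fun χ : DirichletCharacter ℂ q => δ ≤ ‖dpoly χ (bFn N (q ^ 2))‖))) ∪
      ((Finset.univ.filter (fun χ : DirichletCharacter ℂ q => 1 / 2 ≤ ‖dpoly χ (cFn N (q ^ 2))‖)) ∪
      (Finset.univ.filter (fun χ : DirichletCharacter ℂ q => K ≤ ‖dpoly χ (truncFn N muR)‖))) := by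
    intro χ hχ
    obtain ⟨h1, h2⟩ := (Finset.mem_filter.1 hχ).2
    by_contra hcon
    simp only [Finset.mem_union, Finset.mem_filter, Finset.mem_univ, true_and, not_or, not_le] at hcon
    obtain ⟨⟨a, b⟩, c, d⟩ := hcon
    have a' : ‖dpoly χ (truncFn N ArithmeticFunction.vonMangoldt)‖ < t / 2 := by
      rw [dpoly_pow χ (truncFn_supp N _), norm_pow] at a
      exact lt_of_pow_lt_pow_left₀ k (by positivity) a
    exact absurd (four_events hq h1 ht hK hN1' he a' b c d) (not_lt.2 h2)
  have hcard := (Finset.card_le_card hsub).trans (Finset.card_union_le _ _)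
  have hu1 := Finset.card_union_le (Finset.univ.filter (fun χ : DirichletCharacter ℂ q =>
        (t / 2) ^ k ≤ ‖dpoly χ (truncFn N ArithmeticFunction.vonMangoldt ^ k)‖))
      (Finset.univ.filter (fun χ : DirichletCharacter ℂ q => δ ≤ ‖dpoly χ (bFn N (q ^ 2))‖))
  have hu2 := Finset.card_union_le
      (Finset.univ.filter (fun χ : DirichletCharacter ℂ q => 1 / 2 ≤ ‖dpoly χ (cFn N (q ^ 2))‖))
      (Finset.univ.filter (fun χ : DirichletCharacter ℂ q => K ≤ ‖dpoly χ (truncFn N muR)‖))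
  have htot := hcard.trans (add_le_add hu1 hu2)
  have htotR := (Nat.cast_le (α := ℝ)).2 htot
  push_cast at htotR
  -- numerics
  have bA : q * (4 ^ k * (2 * k).factorial * zThree + offErr q) / ((t / 2) ^ k) ^ 2 ≤
      q * (Real.exp 3 * ε * zThree + ε) := by
    rw [mul_div_assoc, add_div]
    gcongr
    · rw [mul_div_right_comm]
      gcongr
    · have : (1 : ℝ) ≤ ((t / 2) ^ k) ^ 2 := one_le_pow₀ (one_le_pow₀ ht2)
      have hoff0 : 0 ≤ offErr q := by rw [offErr]; positivity
      exact (div_le_self hoff0 this).trans o3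
  have bB : q * (ε * δ ^ 2 + offErr q) / δ ^ 2 ≤ q * (2 * ε) := by
    rw [div_le_iff₀ (by positivity)]
    calc _ ≤ q * (ε * δ ^ 2 + ε * δ ^ 2) := by gcongr
      _ = _ := by ring
  have bC : q * (ε / 4 + offErr q) / (1 / 2) ^ 2 ≤ q * (2 * ε) := by
    rw [div_le_iff₀ (by positivity)]
    calc _ ≤ q * (ε / 4 + ε / 4) := by gcongr
      _ = _ := by ring
  have bD : q * (zThree + offErr q) / K ^ 2 ≤ q * (2 * ε) := by
    calc _ ≤ q * (zThree + zThree) / K ^ 2 := by gcongr; linarith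
      _ = q * (2 * (zThree / K ^ 2)) := by ring
      _ = _ := by rw [hK2]
  have : (q : ℝ) * ((Real.exp 3 * zThree + 7) * ε) = q * (Real.exp 3 * ε * zThree + ε) + q * (2 * ε)
    + (q * (2 * ε) + q * (2 * ε)) := by ring
  rw [this]
  linarith

lemma ncard_le (q : ℕ) [NeZero q] (s : Set (DirichletCharacter ℂ q)) : s.ncard ≤ q := by
  have h := DirichletCharacter.card_eq_totient_of_hasEnoughRootsOfUnity ℂ q
  have := Set.ncard_le_card s
  exact this.trans (h.le.trans (Nat.totient_le q))

/-- There is `C > 0` such that for every real `t ≥ 1`, the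
liminf over odd primes `q` of
`(1/(q-2)) · #{χ ≠ χ₀ mod q : |L'/L(1,χ)| ≥ t}` is at most `C·e^{-√t/2}`. -/
theorem liminf_tail_bound :
    ∃ C : ℝ, 0 < C ∧ ∀ t : ℝ, 1 ≤ t →
      liminf (fun q : ℕ => charProportion q (fun x => t ≤ x))
        (atTop ⊓ principal {q : ℕ | q.Prime ∧ Odd q}) ≤
      C * Real.exp (-Real.sqrt t / 2) := by
  have hZ := zThree_ge
  have hone : (1 : ℝ) ≤ Real.exp 3 := Real.one_le_exp (by norm_num)
  have hez : 0 ≤ Real.exp 3 * zThree := by positivity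
  refine ⟨3 * (Real.exp 3 * zThree + 7), by positivity, fun t ht => ?_⟩
  have hne : (atTop ⊓ principal {q : ℕ | q.Prime ∧ Odd q}).NeBot := by
    rw [← frequently_mem_iff_neBot, frequently_atTop]
    intro a
    obtain ⟨p, hp1, hp2⟩ := Nat.exists_infinite_primes (max a 3)
    exact ⟨p, by omega, hp2, hp2.odd_of_ne_two (by omega)⟩
  have hbdd : IsBoundedUnder (fun x1 x2 => x1 ≥ x2) (atTop ⊓ principal {q : ℕ | q.Prime ∧ Odd q})
      (fun q : ℕ => charProportion q (fun x => t ≤ x)) := by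
    refine isBoundedUnder_of ⟨0, fun q => ?_⟩
    simp only [charProportion]
    split_ifs with h
    · have : (2 : ℝ) ≤ q := by exact_mod_cast h
      exact div_nonneg (by positivity) (by linarith)
    · exact le_rfl
  refine liminf_le_of_frequently_le (Eventually.frequently (Eventually.filter_mono inf_le_left ?_)) hbdd
  set ε := Real.exp (-Real.sqrt t / 2) with hεdef
  have hε : 0 < ε := Real.exp_pos _
  -- it suffices to bound the count
  suffices h : ∀ᶠ q : ℕ in atTop, ∀ [NeZero q], (({χ : DirichletCharacter ℂ q | χ ≠ 1 ∧
        t ≤ ‖logDeriv (DirichletCharacter.LFunction χ) 1‖}.ncard : ℝ)) ≤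
        q * ((Real.exp 3 * zThree + 7) * ε) by
    filter_upwards [h, eventually_ge_atTop 3] with q h1 hq
    haveI : NeZero q := ⟨by omega⟩
    have hq' : (3 : ℝ) ≤ q := by exact_mod_cast hq
    simp only [charProportion]
    rw [dif_pos (by omega), div_le_iff₀ (by linarith)]
    refine h1.trans ?_
    have : 0 ≤ (Real.exp 3 * zThree + 7) * ε := by positivity
    nlinarith
  by_cases h2 : 2 ≤ t
  · filter_upwards [count_bound t h2] with q hq
    intro _
    refine le_trans (le_of_eq ?_) hq
    classical
    rw [← Set.ncard_coe_finset]
    simp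
  · refine Eventually.of_forall fun q => ?_
    intro _
    have h3 : (1 : ℝ) ≤ (Real.exp 3 * zThree + 7) * ε := by
      have hs : Real.sqrt t ≤ 2 := by
        rw [Real.sqrt_le_left (by norm_num)]; linarith
      have he : Real.exp (-1) ≤ ε := Real.exp_le_exp.2 (by linarith)
      have h4 : (1 : ℝ) / 3 ≤ Real.exp (-1) := by
        rw [Real.exp_neg, ← one_div]
        exact one_div_le_one_div_of_le (Real.exp_pos _) (by linarith [Real.exp_one_lt_d9])
      nlinarith
    have h5 : (({χ : DirichletCharacter ℂ q | χ ≠ 1 ∧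
        t ≤ ‖logDeriv (DirichletCharacter.LFunction χ) 1‖}.ncard : ℝ)) ≤ q := by
      exact_mod_cast ncard_le q _
    have hq0 : (0 : ℝ) ≤ q := by positivity
    nlinarith
end

section
/- There is an absolute constant A > 0 with the following property. Let s₀ ∈ ℂ, R > 0, let F be holomorphic on the closed disc |s − s₀| ≤ R, let M ≥ |F(s)| for all s in that disc, and suppose m > 0 satisfies |F(s₀)| ≥ m. Then for every s with |s − s₀| ≤ R/4 at which F(s) ≠ 0, one has |F'(s)/F(s) − ∑_{ρ : F(ρ)=0, |ρ − s₀| ≤ R/2} 1/(s − ρ)| ≤ A · log(M/m) / R, where the zeros ρ of F in the disc |ρ − s₀| ≤ R/2 are counted with multiplicity. -/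
/-- The multiplicity of `ρ` as a zero of `F`: the analytic order of vanishing
of `F` at `ρ` if `F` is analytic there (and `0` otherwise). -/
noncomputable def zeroMultiplicity (F : ℂ → ℂ) (ρ : ℂ) : ℕ :=
  letI := Classical.propDecidable (AnalyticAt ℂ F ρ)
  if h : AnalyticAt ℂ F ρ then (analyticOrderAt F ρ).toNat else 0

open Filter Topology in
theorem aux_log_bound (c : ℂ) (r L : ℝ) (g : ℂ → ℂ) (hr : 0 < r) (hL : 0 < L)
    (hg : DifferentiableOn ℂ g (Metric.ball c r))
    (h0 : ∀ z ∈ Metric.ball c r, g z ≠ 0)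
    (hb : ∀ z ∈ Metric.ball c r, ‖g z‖ ≤ Real.exp L * ‖g c‖)
    (s : ℂ) (hs : s ∈ Metric.closedBall c (r / 2)) :
    ‖deriv g s / g s‖ ≤ 24 * L / r := by
  have hc : c ∈ Metric.ball c r := Metric.mem_ball_self hr
  have hd : DifferentiableOn ℂ (fun z => deriv g z / g z) (Metric.ball c r) :=
    (hg.deriv Metric.isOpen_ball).div hg h0
  obtain ⟨H, hH⟩ := hd.isExactOn_ball
  have hHd : DifferentiableOn ℂ H (Metric.ball c r) := fun z hz =>
    (hH z hz).differentiableAt.differentiableWithinAt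
  have hconst : ∀ z ∈ Metric.ball c r,
      Complex.exp (-(H z - H c)) * g z = g c := by
    intro z hz
    have hder : ∀ w ∈ Metric.ball c r,
        HasDerivAt (fun w => Complex.exp (-(H w - H c)) * g w) 0 w := by
      intro w hw
      have h1 := (((hH w hw).sub_const (H c)).neg.cexp).mul
        ((hg.differentiableAt (Metric.isOpen_ball.mem_nhds hw)).hasDerivAt)
      have hne := h0 w hw
      have h2 : Complex.exp (-(H w - H c)) * -(deriv g w / g w) * g w +
          Complex.exp (-(H w - H c)) * deriv g w = 0 := by
        field_simp
        ring
      exact h2 ▸ h1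
    have := Metric.isOpen_ball.is_const_of_deriv_eq_zero
      (convex_ball c r).isPreconnected
      (fun w hw => (hder w hw).differentiableAt.differentiableWithinAt)
      (fun w hw => (hder w hw).deriv) hz hc
    simpa using this
  have hre : ∀ z ∈ Metric.ball c r, (H z - H c).re ≤ L := by
    intro z hz
    have h1 := hconst z hz
    have h2 : g z = Complex.exp (H z - H c) * g c := by
      rw [← h1, ← mul_assoc, ← Complex.exp_add]; simp
    have h3 := hb z hz
    rw [h2, norm_mul, Complex.norm_exp] at h3
    have h4 := le_of_mul_le_mul_right h3 (norm_pos_iff.2 (h0 c hc))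
    exact Real.exp_le_exp.1 h4
  have hBC : ∀ z ∈ Metric.closedBall c (3 * r / 4), ‖H z - H c‖ ≤ 6 * L := by
    intro z hz
    have hz' : ‖z - c‖ ≤ 3 * r / 4 := by simpa [dist_eq_norm] using hz
    have := Complex.borelCaratheodory_zero (f := fun w => H (c + w) - H c) (R := r) (M := L)
      (z := z - c) hL ?_ ?_ hr ?_ (by simp)
    · simp only [add_sub_cancel] at this
      refine this.trans ?_
      rw [div_le_iff₀ (by linarith)]
      nlinarith
    · refine DifferentiableOn.sub_const (hHd.comp (by fun_prop) ?_) _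
      intro w hw
      simpa using hw
    · intro w hw
      exact hre _ (by simpa using hw)
    · simp only [Metric.mem_ball, dist_zero_right]; linarith
  have hs' : dist s c ≤ r / 2 := hs
  have hsub : Metric.closedBall s (r / 4) ⊆ Metric.closedBall c (3 * r / 4) :=
    Metric.closedBall_subset_closedBall' (by linarith)
  have hsub2 : Metric.closedBall c (3 * r / 4) ⊆ Metric.ball c r :=
    Metric.closedBall_subset_ball (by linarith)
  have hC := Complex.norm_deriv_le_of_forall_mem_sphere_norm_le (c := s) (R := r / 4)
    (C := 6 * L) (f := fun z => H z - H c) (by positivity) ?_ ?_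
  · have hss : s ∈ Metric.ball c r := by simp only [Metric.mem_ball]; linarith
    rw [((hH s hss).sub_const (H c)).deriv] at hC
    refine hC.trans (le_of_eq ?_)
    field_simp
    ring
  · apply DifferentiableOn.diffContOnCl
    rw [closure_ball s (by positivity)]
    exact (hHd.mono (hsub.trans hsub2)).sub_const _
  · intro z hz
    exact hBC z (hsub (Metric.sphere_subset_closedBall hz))

open Filter Topology in
theorem aux_factor (U : Set ℂ) (F : ℂ → ℂ) (n : ℂ → ℕ) (hF : DifferentiableOn ℂ F U)
    (Z : Finset ℂ) (hZU : ∀ a ∈ Z, U ∈ 𝓝 a)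
    (hloc : ∀ a ∈ Z, ∃ h : ℂ → ℂ, AnalyticAt ℂ h a ∧ h a ≠ 0 ∧
      ∀ᶠ z in 𝓝 a, F z = (z - a) ^ n a * h z) :
    ∃ g : ℂ → ℂ, DifferentiableOn ℂ g U ∧ (∀ a ∈ Z, g a ≠ 0) ∧
      ∀ z ∈ U, F z = (∏ a ∈ Z, (z - a) ^ n a) * g z := by
  classical
  induction Z using Finset.induction_on with
  | empty => exact ⟨F, hF, by simp, by simp⟩
  | insert a Z ha ih =>
    obtain ⟨g, hg, hgZ, hFg⟩ := ih (fun b hb => hZU b (Finset.mem_insert_of_mem hb))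
      (fun b hb => hloc b (Finset.mem_insert_of_mem hb))
    obtain ⟨h, hh, hha, hFh⟩ := hloc a (Finset.mem_insert_self a Z)
    have hUa := hZU a (Finset.mem_insert_self a Z)
    set Q : ℂ → ℂ := fun z => ∏ b ∈ Z, (z - b) ^ n b with hQ
    have hQd : Differentiable ℂ Q := by
      rw [hQ]; fun_prop
    have hQa : Q a ≠ 0 := by
      simp only [hQ]
      refine Finset.prod_ne_zero_iff.2 fun b hb => pow_ne_zero _ (sub_ne_zero.2 ?_)
      rintro rfl; exact ha hb
    have hQev : ∀ᶠ z in 𝓝 a, Q z ≠ 0 := hQd.continuous.continuousAt.eventually_ne hQa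
    have hgev : ∀ᶠ z in 𝓝 a, g z = (z - a) ^ n a * (h z / Q z) := by
      filter_upwards [hQev, hFh, hUa] with z h1 h2 h3
      have h4 := hFg z h3
      rw [h2] at h4
      change _ = Q z * g z at h4
      field_simp
      rw [h4]; ring
    set g' : ℂ → ℂ := fun z => if z = a then h a / Q a else g z / (z - a) ^ n a with hg'
    have hg'ev : g' =ᶠ[𝓝 a] fun z => h z / Q z := by
      filter_upwards [hgev] with z hz
      by_cases hza : z = a
      · simp [hg', hza]
      · have : z - a ≠ 0 := sub_ne_zero.2 hza
        simp only [hg', if_neg hza, hz]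
        field_simp
    have hg'a : ∀ z, z ≠ a → g' z = g z / (z - a) ^ n a := fun z hz => by simp [hg', hz]
    refine ⟨g', ?_, ?_, ?_⟩
    · intro z hz
      by_cases hza : z = a
      · subst hza
        refine DifferentiableAt.differentiableWithinAt ?_
        refine DifferentiableAt.congr_of_eventuallyEq ?_ hg'ev
        exact hh.differentiableAt.div hQd.differentiableAt hQa
      · have hd : DifferentiableWithinAt ℂ (fun z => g z / (z - a) ^ n a) U z := by
          refine (hg z hz).div (by fun_prop) (pow_ne_zero _ (sub_ne_zero.2 hza))
        refine hd.congr_of_eventuallyEq ?_ (hg'a z hza)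
        filter_upwards [mem_nhdsWithin_of_mem_nhds (isOpen_ne.mem_nhds hza)] with w hw
        exact hg'a w hw
    · intro b hb
      rcases Finset.mem_insert.1 hb with rfl | hbZ
      · simp only [hg', if_true]; exact div_ne_zero hha hQa
      · have hba : b ≠ a := by rintro rfl; exact ha hbZ
        rw [hg'a b hba]
        exact div_ne_zero (hgZ b hbZ) (pow_ne_zero _ (sub_ne_zero.2 hba))
    · intro z hz
      rw [Finset.prod_insert ha]
      by_cases hza : z = a
      · subst hza
        have h1 := hgev.self_of_nhds
        have h2 := hg'ev.self_of_nhds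
        rw [hFg z hz, h1, h2]; ring
      · have : z - a ≠ 0 := sub_ne_zero.2 hza
        rw [hFg z hz, hg'a z hza]
        field_simp

/-- There is an absolute constant `A > 0` such that: if `F` is
holomorphic on `|s - s₀| ≤ R`, bounded by `M` there, and `|F(s₀)| ≥ m > 0`,
then for every `s` with `|s - s₀| ≤ R/4` and `F(s) ≠ 0`,
`|F'(s)/F(s) - ∑_{ρ : F(ρ)=0, |ρ-s₀| ≤ R/2} 1/(s-ρ)| ≤ A log(M/m)/R`,
the zeros being counted with multiplicity. -/
theorem logDeriv_expansion_over_zeros :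
    ∃ A : ℝ, 0 < A ∧
      ∀ (s₀ : ℂ) (R : ℝ) (F : ℂ → ℂ) (M m : ℝ),
        0 < R →
        DifferentiableOn ℂ F (Metric.closedBall s₀ R) →
        (∀ s ∈ Metric.closedBall s₀ R, ‖F s‖ ≤ M) →
        0 < m → m ≤ ‖F s₀‖ →
        ∀ s ∈ Metric.closedBall s₀ (R / 4), F s ≠ 0 →
          ‖deriv F s / F s -
              ∑ᶠ ρ ∈ {ρ : ℂ | F ρ = 0 ∧ ρ ∈ Metric.closedBall s₀ (R / 2)},
                (zeroMultiplicity F ρ : ℂ) / (s - ρ)‖ ≤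
            A * Real.log (M / m) / R := by
  refine ⟨48, by norm_num, ?_⟩
  intro s₀ R F M m hR hF hM hm hmF s hs hFs
  have hU : ∀ z ∈ Metric.ball s₀ R, Metric.closedBall s₀ R ∈ nhds z := fun z hz =>
    Filter.mem_of_superset (Metric.isOpen_ball.mem_nhds hz) Metric.ball_subset_closedBall
  have hsub : Metric.closedBall s₀ (R / 2) ⊆ Metric.ball s₀ R :=
    Metric.closedBall_subset_ball (by linarith)
  have hs₀R : s₀ ∈ Metric.ball s₀ R := Metric.mem_ball_self hR
  have hF0 : F s₀ ≠ 0 := norm_pos_iff.1 (hm.trans_le hmF)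
  have hA : AnalyticOnNhd ℂ F (Metric.ball s₀ R) :=
    (hF.mono Metric.ball_subset_closedBall).analyticOnNhd Metric.isOpen_ball
  have hnf : ∀ z ∈ Metric.ball s₀ R, ¬ ∃ᶠ w in nhdsWithin z {z}ᶜ, F w = 0 := by
    intro z hz hfr
    exact hF0 (hA.eqOn_zero_of_preconnected_of_frequently_eq_zero
      (convex_ball s₀ R).isPreconnected hz hfr hs₀R)
  have hfin : {ρ : ℂ | F ρ = 0 ∧ ρ ∈ Metric.closedBall s₀ (R / 2)}.Finite := by
    by_contra hinf
    obtain ⟨z, hz, hacc⟩ := Set.Infinite.exists_accPt_of_subset_isCompact hinf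
      (isCompact_closedBall s₀ (R / 2)) (fun ρ hρ => hρ.2)
    refine hnf z (hsub hz) ?_
    exact (accPt_iff_frequently_nhdsNE.1 hacc).mono fun w hw => hw.1
  have hloc : ∀ a ∈ hfin.toFinset, ∃ h : ℂ → ℂ, AnalyticAt ℂ h a ∧ h a ≠ 0 ∧
      ∀ᶠ z in nhds a, F z = (z - a) ^ zeroMultiplicity F a * h z := by
    intro a ha
    have ha' : a ∈ Metric.ball s₀ R := hsub (hfin.mem_toFinset.1 ha).2
    have hne : analyticOrderAt F a ≠ ⊤ := by
      intro htop
      exact hnf a ha' ((analyticOrderAt_eq_top.1 htop).filter_mono nhdsWithin_le_nhds).frequently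
    have hz : analyticOrderAt F a = (zeroMultiplicity F a : ℕ∞) := by
      rw [zeroMultiplicity, dif_pos (hA a ha'), ENat.natCast_toNat hne]
    simpa using (hA a ha').analyticOrderAt_eq_natCast.1 hz
  obtain ⟨g, hg, hgZ, hFg⟩ := aux_factor (Metric.closedBall s₀ R) F (zeroMultiplicity F) hF
    hfin.toFinset (fun a ha => hU a (hsub (hfin.mem_toFinset.1 ha).2)) hloc
  rw [finsum_mem_eq_finite_toFinset_sum _ hfin]
  set Z := hfin.toFinset with hZ
  set n := zeroMultiplicity F
  set P : ℂ → ℂ := fun z => ∏ a ∈ Z, (z - a) ^ n a with hP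
  have hFP : ∀ z ∈ Metric.closedBall s₀ R, F z = P z * g z := hFg
  have hZ2 : ∀ a ∈ Z, dist a s₀ ≤ R / 2 := fun a ha => (hfin.mem_toFinset.1 ha).2
  have hP0 : 0 < ‖P s₀‖ := by
    refine norm_pos_iff.2 fun h => hF0 ?_
    rw [hFP s₀ (Metric.ball_subset_closedBall hs₀R), h, zero_mul]
  have hg0 : ∀ z ∈ Metric.closedBall s₀ (R / 2), g z ≠ 0 := by
    intro z hz h
    have : F z = 0 := by
      rw [hFP z (Metric.ball_subset_closedBall (hsub hz)), h, mul_zero]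
    exact hgZ z (hfin.mem_toFinset.2 ⟨this, hz⟩) h
  have hMm : 1 ≤ M / m := by
    rw [one_le_div hm]
    exact hmF.trans (hM s₀ (Metric.ball_subset_closedBall hs₀R))
  have hM0 : 0 ≤ M := (norm_nonneg _).trans (hM s₀ (Metric.ball_subset_closedBall hs₀R))
  have hgb : ∀ z ∈ Metric.closedBall s₀ R, ‖g z‖ ≤ M / ‖P s₀‖ := by
    intro z hz
    rw [← closure_ball s₀ hR.ne'] at hz
    refine Complex.norm_le_of_forall_mem_frontier_norm_le Metric.isBounded_ball
      (DifferentiableOn.diffContOnCl ?_) ?_ hz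
    · rwa [closure_ball s₀ hR.ne']
    · intro w hw
      rw [frontier_ball s₀ hR.ne'] at hw
      have hwc := Metric.sphere_subset_closedBall hw
      have hwd : dist w s₀ = R := hw
      have hPle : ‖P s₀‖ ≤ ‖P w‖ := by
        simp only [hP, norm_prod, norm_pow]
        refine Finset.prod_le_prod (fun a _ => by positivity) fun a ha => ?_
        refine pow_le_pow_left₀ (norm_nonneg _) ?_ _
        rw [← dist_eq_norm, ← dist_eq_norm, dist_comm]
        have := hZ2 a ha
        have := dist_triangle w a s₀
        linarith
      rw [le_div_iff₀ hP0]
      calc ‖g w‖ * ‖P s₀‖ ≤ ‖g w‖ * ‖P w‖ := by gcongr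
        _ = ‖F w‖ := by rw [hFP w hwc, norm_mul, mul_comm]
        _ ≤ M := hM w hwc
  have hgs : ∀ z ∈ Metric.closedBall s₀ R, ‖g z‖ ≤ M / m * ‖g s₀‖ := by
    intro z hz
    refine (hgb z hz).trans ?_
    have h1 : m ≤ ‖P s₀‖ * ‖g s₀‖ := by
      rw [← norm_mul, ← hFP s₀ (Metric.ball_subset_closedBall hs₀R)]; exact hmF
    rw [div_le_iff₀ hP0]
    calc M = M / m * m := by field_simp
      _ ≤ M / m * (‖P s₀‖ * ‖g s₀‖) := by gcongr
      _ = _ := by ring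
  have hs4 : dist s s₀ ≤ R / 4 := hs
  have hsR : s ∈ Metric.ball s₀ R := by simp only [Metric.mem_ball]; linarith
  have hsa : ∀ a ∈ Z, s - a ≠ 0 := by
    intro a ha h
    rw [sub_eq_zero] at h
    exact hFs (h ▸ (hfin.mem_toFinset.1 ha).1)
  have hkey : deriv F s / F s - ∑ a ∈ Z, (n a : ℂ) / (s - a) = deriv g s / g s := by
    have hev : F =ᶠ[nhds s] fun z => P z * g z := by
      filter_upwards [hU s hsR] with z hz using hFP z hz
    have hPd : DifferentiableAt ℂ P s := by rw [hP]; fun_prop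
    have h1 : logDeriv F s = logDeriv P s + logDeriv g s := by
      rw [← logDeriv_mul]
      · rw [logDeriv_apply, logDeriv_apply, hev.deriv_eq, hev.self_of_nhds]
      · exact Finset.prod_ne_zero_iff.2 fun a ha => pow_ne_zero _ (hsa a ha)
      · exact hg0 s (by simp only [Metric.mem_closedBall]; linarith)
      · exact hPd
      · exact hg.differentiableAt (hU s hsR)
    have h2 : logDeriv P s = ∑ a ∈ Z, (n a : ℂ) / (s - a) := by
      rw [hP, logDeriv_prod (f := fun a z => (z - a) ^ n a) (fun a ha => pow_ne_zero _ (hsa a ha)) (fun a _ => by fun_prop)]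
      refine Finset.sum_congr rfl fun a _ => ?_
      rw [logDeriv_fun_pow (by fun_prop)]
      simp [logDeriv_apply, div_eq_mul_inv]
    rw [← logDeriv_apply, ← logDeriv_apply, h1, h2]; ring
  rw [hkey]
  have hlog : 0 ≤ Real.log (M / m) := Real.log_nonneg hMm
  have hL : ∀ L : ℝ, Real.log (M / m) < L → ‖deriv g s / g s‖ * R / 48 ≤ L := by
    intro L hL
    have hbs : Metric.ball s₀ (R / 2) ⊆ Metric.closedBall s₀ R :=
      Metric.ball_subset_closedBall.trans (hsub.trans Metric.ball_subset_closedBall)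
    have := aux_log_bound s₀ (R / 2) L g (by positivity) (hlog.trans_lt hL) (hg.mono hbs)
      (fun z hz => hg0 z (Metric.ball_subset_closedBall hz)) ?_ s
      (by simp only [Metric.mem_closedBall]; linarith)
    · rw [le_div_iff₀ (by positivity)] at this
      linarith
    · intro z hz
      refine (hgs z (hbs hz)).trans ?_
      gcongr
      rw [← Real.log_le_iff_le_exp (by linarith)]
      exact hL.le
  have := le_of_forall_gt_imp_ge_of_dense hL
  rw [le_div_iff₀ hR]
  linarith
end
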